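/- Let H and f₁, f₂, … be multipliers of the Dirichlet space 𝒟 such that the column operator M_F^C has norm at most 1 and |H(z)|² ≤ ∑_{j=1}^∞ |f_j(z)|² for all z in the open unit disk 𝔻. Then there exists a constant K < ∞ such that for every h ∈ 𝒟 there exists a sequence u = (u_j) ∈ ⊕₁^∞ 𝒟 with ∑_{j=1}^∞ f_j(z) u_j(z) = H(z)³ h(z) for all z ∈ 𝔻 and ∑_j ‖u_j‖_𝒟² ≤ K² ‖h‖_𝒟². -/

import Mathlib

open Metric MeasureTheory Complex

/-- Taylor coefficient at 0. -/
noncomputable def dirCoeff (f : ℂ → ℂ) (n : ℕ) : ℂ :=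
  iteratedDeriv n f 0 / (n.factorial : ℂ)

/-- Membership in the Dirichlet space. -/
def MemDirichlet (f : ℂ → ℂ) : Prop :=
  DifferentiableOn ℂ f (ball (0:ℂ) 1) ∧
  Summable (fun n : ℕ => ((n : ℝ) + 1) * ‖dirCoeff f n‖ ^ 2)

/-- Squared Dirichlet norm. -/
noncomputable def dirNormSq (f : ℂ → ℂ) : ℝ :=
  ∑' n : ℕ, ((n : ℝ) + 1) * ‖dirCoeff f n‖ ^ 2

/-- Multiplier of the Dirichlet space. -/
def IsMultiplier (φ : ℂ → ℂ) : Prop :=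
  DifferentiableOn ℂ φ (ball (0:ℂ) 1) ∧
  ∀ f, MemDirichlet f → MemDirichlet (fun z => φ z * f z)

/-- Operator norm of the multiplication operator. -/
noncomputable def multNorm (φ : ℂ → ℂ) : ℝ :=
  sInf {C : ℝ | 0 ≤ C ∧ ∀ f, MemDirichlet f →
    dirNormSq (fun z => φ z * f z) ≤ C ^ 2 * dirNormSq f}

/-- The column operator of `F` has norm at most `C`. -/
def ColNormLE (F : ℕ → ℂ → ℂ) (C : ℝ) : Prop :=
  ∀ h, MemDirichlet h →
    Summable (fun j : ℕ => dirNormSq (fun z => F j z * h z)) ∧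
    (∑' j : ℕ, dirNormSq (fun z => F j z * h z)) ≤ C ^ 2 * dirNormSq h

namespace WolffDirichlet

open scoped ComplexConjugate Topology ENNReal

/-- The real-linear map `v ↦ v • a + conj v • b`. -/
noncomputable def wirtinger {V : Type*} [NormedAddCommGroup V] [NormedSpace ℂ V] (a b : V) :
    ℂ →L[ℝ] V :=
  (ContinuousLinearMap.id ℝ ℂ).smulRight a + (conjCLE : ℂ →L[ℝ] ℂ).smulRight b

lemma wirtinger_apply {V : Type*} [NormedAddCommGroup V] [NormedSpace ℂ V] (a b : V) (v : ℂ) :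
    wirtinger a b v = v • a + conj v • b := by
  simp [wirtinger]

/-- `X` has Wirtinger derivatives `a`, `b` on the unit disk, is bounded there, and its
derivatives are continuous and grow at most like `1 / (1 - |ζ|²)`. -/
def Tame {V : Type*} [NormedAddCommGroup V] [NormedSpace ℂ V] (X a b : ℂ → V) : Prop :=
  ContinuousOn a (ball 0 1) ∧ ContinuousOn b (ball 0 1) ∧
  ∃ C : ℝ, ∀ ζ ∈ ball (0 : ℂ) 1, HasFDerivAt X (wirtinger (a ζ) (b ζ)) ζ ∧ ‖X ζ‖ ≤ C ∧
    (1 - ‖ζ‖ ^ 2) * ‖a ζ‖ ≤ C ∧ (1 - ‖ζ‖ ^ 2) * ‖b ζ‖ ≤ C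

section Tame

variable {V W U : Type*} [NormedAddCommGroup V] [NormedSpace ℂ V] [NormedAddCommGroup W]
  [NormedSpace ℂ W] [NormedAddCommGroup U] [NormedSpace ℂ U]

lemma one_sub_sq_pos {ζ : ℂ} (hζ : ζ ∈ ball (0 : ℂ) 1) : 0 < 1 - ‖ζ‖ ^ 2 := by
  have h := mem_ball_zero_iff.1 hζ
  nlinarith [norm_nonneg ζ]

lemma hasFDerivAt_wirtinger_of_hasDerivAt {f : ℂ → V} {f' : V} {z : ℂ} (h : HasDerivAt f f' z) :
    HasFDerivAt f (wirtinger f' 0) z := by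
  have := h.hasFDerivAt.restrictScalars ℝ
  refine this.congr_fderiv ?_
  ext v
  simp [wirtinger]

lemma Tame.continuousOn {X a b : ℂ → V} (hX : Tame X a b) : ContinuousOn X (ball 0 1) := by
  obtain ⟨-, -, C, hC⟩ := hX
  exact fun ζ hζ => (hC ζ hζ).1.continuousAt.continuousWithinAt

lemma Tame.bilin {X a b : ℂ → V} {Y c d : ℂ → W} (hX : Tame X a b) (hY : Tame Y c d)
    (B : V →L[ℂ] W →L[ℂ] U) :
    Tame (fun ζ => B (X ζ) (Y ζ)) (fun ζ => B (X ζ) (c ζ) + B (a ζ) (Y ζ))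
      (fun ζ => B (X ζ) (d ζ) + B (b ζ) (Y ζ)) := by
  have hXc := hX.continuousOn
  have hYc := hY.continuousOn
  obtain ⟨ha, hb, C, hC⟩ := hX
  obtain ⟨hc, hd, D, hD⟩ := hY
  refine ⟨by fun_prop, by fun_prop, ‖B‖ * C * D + ‖B‖ * C * D, fun ζ hζ => ?_⟩
  obtain ⟨h1, h2, h3, h4⟩ := hC ζ hζ
  obtain ⟨k1, k2, k3, k4⟩ := hD ζ hζ
  have hw := one_sub_sq_pos hζ
  have hC0 : 0 ≤ C := (norm_nonneg _).trans h2
  have hD0 : 0 ≤ D := (norm_nonneg _).trans k2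
  have key : ∀ (x : V) (y : W), ‖x‖ ≤ C → (1 - ‖ζ‖ ^ 2) * ‖y‖ ≤ D →
      (1 - ‖ζ‖ ^ 2) * ‖B x y‖ ≤ ‖B‖ * C * D := by
    intro x y hx hy
    calc (1 - ‖ζ‖ ^ 2) * ‖B x y‖ ≤ (1 - ‖ζ‖ ^ 2) * (‖B‖ * ‖x‖ * ‖y‖) := by
          gcongr; exact B.le_opNorm₂ x y
      _ = ‖B‖ * ‖x‖ * ((1 - ‖ζ‖ ^ 2) * ‖y‖) := by ring
      _ ≤ _ := by gcongr
  have key' : ∀ (x : V) (y : W), (1 - ‖ζ‖ ^ 2) * ‖x‖ ≤ C → ‖y‖ ≤ D →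
      (1 - ‖ζ‖ ^ 2) * ‖B x y‖ ≤ ‖B‖ * C * D := by
    intro x y hx hy
    calc (1 - ‖ζ‖ ^ 2) * ‖B x y‖ ≤ (1 - ‖ζ‖ ^ 2) * (‖B‖ * ‖x‖ * ‖y‖) := by
          gcongr; exact B.le_opNorm₂ x y
      _ = ‖B‖ * ((1 - ‖ζ‖ ^ 2) * ‖x‖) * ‖y‖ := by ring
      _ ≤ _ := by gcongr
  refine ⟨?_, ?_, ?_, ?_⟩
  · have := (B.bilinearRestrictScalars ℝ).hasFDerivAt_of_bilinear h1 k1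
    refine this.congr_fderiv ?_
    ext v
    simp [wirtinger]
    abel
  · have h0 : 0 ≤ ‖B‖ * C * D := by positivity
    calc ‖B (X ζ) (Y ζ)‖ ≤ ‖B‖ * ‖X ζ‖ * ‖Y ζ‖ := B.le_opNorm₂ _ _
      _ ≤ ‖B‖ * C * D := by gcongr
      _ ≤ _ := by linarith
  · calc _ ≤ (1 - ‖ζ‖ ^ 2) * (‖B (X ζ) (c ζ)‖ + ‖B (a ζ) (Y ζ)‖) := by
          gcongr; exact norm_add_le _ _
      _ ≤ _ := by rw [mul_add]; exact add_le_add (key _ _ h2 k3) (key' _ _ h3 k2)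
  · calc _ ≤ (1 - ‖ζ‖ ^ 2) * (‖B (X ζ) (d ζ)‖ + ‖B (b ζ) (Y ζ)‖) := by
          gcongr; exact norm_add_le _ _
      _ ≤ _ := by rw [mul_add]; exact add_le_add (key _ _ h2 k4) (key' _ _ h4 k2)

lemma Tame.smul {X a b : ℂ → ℂ} {Y c d : ℂ → W} (hX : Tame X a b) (hY : Tame Y c d) :
    Tame (fun ζ => X ζ • Y ζ) (fun ζ => X ζ • c ζ + a ζ • Y ζ)
      (fun ζ => X ζ • d ζ + b ζ • Y ζ) :=
  hX.bilin hY (ContinuousLinearMap.lsmul ℂ ℂ)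

lemma Tame.apply {X a b : ℂ → (V →L[ℂ] W)} {Y c d : ℂ → V} (hX : Tame X a b) (hY : Tame Y c d) :
    Tame (fun ζ => X ζ (Y ζ)) (fun ζ => X ζ (c ζ) + a ζ (Y ζ))
      (fun ζ => X ζ (d ζ) + b ζ (Y ζ)) :=
  hX.bilin hY (ContinuousLinearMap.id ℂ (V →L[ℂ] W))

lemma Tame.add_const {X a b : ℂ → V} (hX : Tame X a b) (v : V) :
    Tame (fun ζ => X ζ + v) a b := by
  obtain ⟨ha, hb, C, hC⟩ := hX
  refine ⟨ha, hb, C + ‖v‖, fun ζ hζ => ?_⟩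
  obtain ⟨h1, h2, h3, h4⟩ := hC ζ hζ
  have := norm_nonneg v
  exact ⟨h1.add_const v, (norm_add_le _ _).trans (by linarith), by linarith, by linarith⟩

lemma Tame.inv {X a b : ℂ → ℂ} (hX : Tame X a b) {δ : ℝ} (hδ : 0 < δ)
    (h : ∀ ζ ∈ ball (0 : ℂ) 1, δ ≤ ‖X ζ‖) :
    Tame (fun ζ => (X ζ)⁻¹) (fun ζ => -(a ζ) / (X ζ) ^ 2) (fun ζ => -(b ζ) / (X ζ) ^ 2) := by
  have hXc := hX.continuousOn
  have hne : ∀ ζ ∈ ball (0 : ℂ) 1, X ζ ^ 2 ≠ 0 := fun ζ hζ => by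
    have := h ζ hζ
    exact pow_ne_zero _ (norm_pos_iff.1 (hδ.trans_le this))
  obtain ⟨ha, hb, C, hC⟩ := hX
  refine ⟨ha.neg.div (hXc.pow 2) hne, hb.neg.div (hXc.pow 2) hne, δ⁻¹ + C / δ ^ 2, fun ζ hζ => ?_⟩
  obtain ⟨h1, h2, h3, h4⟩ := hC ζ hζ
  have hw := one_sub_sq_pos hζ
  have hC0 : 0 ≤ C := (norm_nonneg _).trans h2
  have hb := h ζ hζ
  have h0 : X ζ ≠ 0 := fun h => by rw [h, norm_zero] at hb; linarith
  have key : ∀ x : ℂ, (1 - ‖ζ‖ ^ 2) * ‖x‖ ≤ C →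
      (1 - ‖ζ‖ ^ 2) * ‖-x / (X ζ) ^ 2‖ ≤ δ⁻¹ + C / δ ^ 2 := by
    intro x hx
    rw [norm_div, norm_neg, norm_pow, ← mul_div_assoc]
    have : (1 - ‖ζ‖ ^ 2) * ‖x‖ / ‖X ζ‖ ^ 2 ≤ C / δ ^ 2 := by gcongr
    have : 0 < δ⁻¹ := by positivity
    linarith
  refine ⟨?_, ?_, key _ h3, key _ h4⟩
  · have := ((hasDerivAt_inv h0).hasFDerivAt.restrictScalars ℝ).comp ζ h1
    refine this.congr_fderiv ?_
    ext v
    simp [wirtinger]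
    field_simp
  · rw [norm_inv]
    have : ‖X ζ‖⁻¹ ≤ δ⁻¹ := by gcongr
    have : 0 ≤ C / δ ^ 2 := by positivity
    linarith

lemma Tame.conj {X a b : ℂ → ℂ} (hX : Tame X a b) :
    Tame (fun ζ => conj (X ζ)) (fun ζ => conj (b ζ)) (fun ζ => conj (a ζ)) := by
  obtain ⟨ha, hb, C, hC⟩ := hX
  refine ⟨continuous_conj.comp_continuousOn hb, continuous_conj.comp_continuousOn ha, C,
    fun ζ hζ => ?_⟩
  obtain ⟨h1, h2, h3, h4⟩ := hC ζ hζ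
  refine ⟨?_, by simpa using h2, by simpa using h4, by simpa using h3⟩
  have := (conjCLE : ℂ →L[ℝ] ℂ).hasFDerivAt.comp ζ h1
  refine this.congr_fderiv ?_
  ext v
  simp [wirtinger]
  ring

lemma norm_deriv_le_of_bounded {f : ℂ → V} (hf : DifferentiableOn ℂ f (ball 0 1)) {M : ℝ}
    (hM : ∀ z ∈ ball (0 : ℂ) 1, ‖f z‖ ≤ M) {z : ℂ} (hz : z ∈ ball (0 : ℂ) 1) :
    (1 - ‖z‖ ^ 2) * ‖deriv f z‖ ≤ 4 * M := by
  have h1 : ‖z‖ < 1 := mem_ball_zero_iff.1 hz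
  have hsub : ball z (1 - ‖z‖) ⊆ ball 0 1 := ball_subset_ball' (by simp)
  have := norm_deriv_le_div_of_mapsTo_ball (f := f) (c := z) (R₁ := 1 - ‖z‖) (R₂ := 2 * M)
    (hf.mono hsub) (fun w hw => by
      rw [mem_closedBall, dist_eq_norm_sub]
      have := hM w (hsub hw)
      have := hM z hz
      exact (norm_sub_le _ _).trans (by linarith)) (by linarith)
  rw [le_div_iff₀ (by linarith)] at this
  nlinarith [norm_nonneg z, norm_nonneg (deriv f z),
    mul_nonneg (mul_nonneg (sub_nonneg.2 h1.le) (sub_nonneg.2 h1.le)) (norm_nonneg (deriv f z))]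

lemma tame_of_differentiableOn [CompleteSpace V] {f : ℂ → V}
    (hf : DifferentiableOn ℂ f (ball 0 1)) {M : ℝ}
    (hM : ∀ z ∈ ball (0 : ℂ) 1, ‖f z‖ ≤ M) : Tame f (deriv f) (fun _ => 0) := by
  refine ⟨(hf.deriv isOpen_ball).continuousOn, continuousOn_const, 4 * M, fun ζ hζ => ?_⟩
  have hM0 := (norm_nonneg _).trans (hM ζ hζ)
  refine ⟨hasFDerivAt_wirtinger_of_hasDerivAt ?_, (hM ζ hζ).trans (by linarith),
    norm_deriv_le_of_bounded hf hM hζ, by simpa using hM0⟩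
  exact ((hf ζ hζ).differentiableAt (isOpen_ball.mem_nhds hζ)).hasDerivAt

/-- The conjugate-linear Riesz map, as a real-linear map. -/
noncomputable def rieszReal (E : Type*) [NormedAddCommGroup E] [InnerProductSpace ℂ E] :
    E →L[ℝ] (E →L[ℂ] ℂ) :=
  AddMonoidHom.toRealLinearMap ((innerSL ℂ : E →L⋆[ℂ] E →L[ℂ] ℂ) : E →+ (E →L[ℂ] ℂ))
    (innerSL ℂ : E →L⋆[ℂ] E →L[ℂ] ℂ).continuous

lemma tame_innerSL {E : Type*} [NormedAddCommGroup E] [InnerProductSpace ℂ E] [CompleteSpace E]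
    {f : ℂ → E}
    (hf : DifferentiableOn ℂ f (ball 0 1)) {M : ℝ} (hM : ∀ z ∈ ball (0 : ℂ) 1, ‖f z‖ ≤ M) :
    Tame (fun ζ => innerSL ℂ (f ζ)) (fun _ => 0) (fun ζ => innerSL ℂ (deriv f ζ)) := by
  obtain ⟨ha, -, C, hC⟩ := tame_of_differentiableOn hf hM
  refine ⟨continuousOn_const, (innerSL ℂ).continuous.comp_continuousOn ha, C, fun ζ hζ => ?_⟩
  obtain ⟨h1, h2, h3, h4⟩ := hC ζ hζ
  refine ⟨?_, by simpa using h2, by simpa using h4, by simpa using h3⟩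
  have := (rieszReal E).hasFDerivAt.comp ζ h1
  refine this.congr_fderiv ?_
  ext v x
  change innerSL ℂ (wirtinger (deriv f ζ) 0 v) x = _
  simp [wirtinger]

/-- The weight `1 - |ζ|²`, as a complex-valued function. -/
noncomputable def diskWeight (ζ : ℂ) : ℂ := 1 - ζ * conj ζ

lemma diskWeight_eq (ζ : ℂ) : diskWeight ζ = ((1 - ‖ζ‖ ^ 2 : ℝ) : ℂ) := by
  rw [diskWeight, mul_conj']
  push_cast
  rfl

lemma norm_diskWeight {ζ : ℂ} (hζ : ζ ∈ ball (0 : ℂ) 1) : ‖diskWeight ζ‖ = 1 - ‖ζ‖ ^ 2 := by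
  rw [diskWeight_eq, norm_real, Real.norm_of_nonneg (one_sub_sq_pos hζ).le]

lemma tame_id : Tame (fun ζ : ℂ => ζ) (fun _ => 1) (fun _ => 0) := by
  have := tame_of_differentiableOn (f := fun ζ : ℂ => ζ) (M := 1) (by fun_prop)
    (fun z hz => (mem_ball_zero_iff.1 hz).le)
  simpa using this

lemma Tame.congr {X a b Y c d : ℂ → V} (hX : Tame X a b) (h : ∀ ζ, Y ζ = X ζ)
    (hc : ∀ ζ, c ζ = a ζ) (hd : ∀ ζ, d ζ = b ζ) : Tame Y c d := by
  obtain rfl : Y = X := funext h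
  obtain rfl : c = a := funext hc
  obtain rfl : d = b := funext hd
  exact hX

lemma tame_const (v : V) : Tame (fun _ : ℂ => v) (fun _ => 0) (fun _ => 0) := by
  refine ⟨continuousOn_const, continuousOn_const, ‖v‖, fun ζ hζ => ⟨?_, le_rfl, ?_, ?_⟩⟩
  · refine (hasFDerivAt_const v ζ).congr_fderiv ?_
    ext
    simp [wirtinger]
  all_goals simp

lemma tame_diskWeight : Tame diskWeight (fun ζ => -conj ζ) (fun ζ => -ζ) := by
  have := ((tame_const (-1 : ℂ)).smul (tame_id.smul tame_id.conj)).add_const 1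
  refine this.congr (fun ζ => ?_) (fun ζ => ?_) (fun ζ => ?_) <;> simp [diskWeight]
  ring

lemma integrableOn_ball_of_bounded {V : Type*} [NormedAddCommGroup V] {g : ℂ → V}
    (hg : ContinuousOn g (ball 0 1)) {M : ℝ} (hM : ∀ ζ ∈ ball (0 : ℂ) 1, ‖g ζ‖ ≤ M) :
    IntegrableOn g (ball 0 1) := by
  have : IsFiniteMeasure ((volume : Measure ℂ).restrict (ball 0 1)) :=
    ⟨by simp⟩
  exact Integrable.of_bound (hg.aestronglyMeasurable measurableSet_ball) M
    ((ae_restrict_iff' measurableSet_ball).2 (.of_forall hM))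

/-- A multiple by `(1 - |ζ|²)²` of a tame function has vanishing integrals of its
Wirtinger derivatives. -/
lemma Tame.integral_eq_zero {X a b : ℂ → V} (hX : Tame X a b) :
    (∫ ζ in ball (0 : ℂ) 1, (diskWeight ζ ^ 2 • a ζ - (2 * diskWeight ζ * conj ζ) • X ζ)) = 0 ∧
    (∫ ζ in ball (0 : ℂ) 1, (diskWeight ζ ^ 2 • b ζ - (2 * diskWeight ζ * ζ) • X ζ)) = 0 := by
  have hY : Tame (fun ζ => diskWeight ζ ^ 2 • X ζ)
      (fun ζ => diskWeight ζ ^ 2 • a ζ - (2 * diskWeight ζ * conj ζ) • X ζ)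
      (fun ζ => diskWeight ζ ^ 2 • b ζ - (2 * diskWeight ζ * ζ) • X ζ) := by
    refine (tame_diskWeight.smul (tame_diskWeight.smul hX)).congr ?_ ?_ ?_ <;> intro ζ <;>
      module
  obtain ⟨-, -, C, hC⟩ := hX
  have hCb : ∀ ζ ∈ ball (0 : ℂ) 1, ∀ v y : V, ‖ζ‖ ≤ 1 → ‖y‖ = ‖ζ‖ * ‖X ζ‖ →
      (1 - ‖ζ‖ ^ 2) * ‖v‖ ≤ C →
      ‖diskWeight ζ ^ 2 • v - (2 * diskWeight ζ) • y‖ ≤ 3 * C := by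
    intro ζ hζ v y h1 hy hv
    have hw := one_sub_sq_pos hζ
    have hw1 : 1 - ‖ζ‖ ^ 2 ≤ 1 := by nlinarith [norm_nonneg ζ]
    have hx := (hC ζ hζ).2.1
    refine (norm_sub_le _ _).trans ?_
    rw [norm_smul, norm_smul, norm_pow, norm_mul, norm_diskWeight hζ, hy]
    have e1 : (1 - ‖ζ‖ ^ 2) ^ 2 * ‖v‖ ≤ C := by
      have h0 : 0 ≤ (1 - ‖ζ‖ ^ 2) * ‖v‖ := by positivity
      nlinarith
    have e2 : (1 - ‖ζ‖ ^ 2) * (‖ζ‖ * ‖X ζ‖) ≤ 1 * (1 * C) := by gcongr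
    simp only [Complex.norm_ofNat]
    linarith
  set Y : ℂ → V := fun ζ => diskWeight ζ ^ 2 • X ζ with hYdef
  set α : ℂ → V := fun ζ => diskWeight ζ ^ 2 • a ζ - (2 * diskWeight ζ * conj ζ) • X ζ with hα
  set β : ℂ → V := fun ζ => diskWeight ζ ^ 2 • b ζ - (2 * diskWeight ζ * ζ) • X ζ with hβ
  have hYc := hY.continuousOn
  obtain ⟨hαc, hβc, D, hD⟩ := hY
  have hαb : ∀ ζ ∈ ball (0 : ℂ) 1, ‖α ζ‖ ≤ 3 * C := fun ζ hζ => by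
    have := hCb ζ hζ (a ζ) (conj ζ • X ζ) (mem_ball_zero_iff.1 hζ).le (by simp [norm_smul])
      (hC ζ hζ).2.2.1
    simpa only [hα, mul_smul] using this
  have hβb : ∀ ζ ∈ ball (0 : ℂ) 1, ‖β ζ‖ ≤ 3 * C := fun ζ hζ => by
    have := hCb ζ hζ (b ζ) (ζ • X ζ) (mem_ball_zero_iff.1 hζ).le (by simp [norm_smul])
      (hC ζ hζ).2.2.2
    simpa only [hβ, mul_smul] using this
  have hαi := integrableOn_ball_of_bounded hαc hαb
  have hβi := integrableOn_ball_of_bounded hβc hβb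
  have hYi := integrableOn_ball_of_bounded hYc fun ζ hζ => (hD ζ hζ).2.1
  set Y₀ := (ball (0 : ℂ) 1).indicator Y with hY₀
  have hder : ∀ ζ, HasFDerivAt Y₀
      ((ball (0 : ℂ) 1).indicator (fun ζ => wirtinger (α ζ) (β ζ)) ζ) ζ := by
    intro ζ
    by_cases hζ : ζ ∈ ball (0 : ℂ) 1
    · rw [Set.indicator_of_mem hζ]
      refine (hD ζ hζ).1.congr_of_eventuallyEq ?_
      filter_upwards [isOpen_ball.mem_nhds hζ] with x hx
      rw [hY₀, Set.indicator_of_mem hx]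
    · rw [Set.indicator_of_notMem hζ]
      refine Asymptotics.IsBigO.hasFDerivAt (n := 2) ?_ (by norm_num)
      refine Asymptotics.IsBigO.of_bound (4 * C) (.of_forall fun x => ?_)
      have hζ' : 1 ≤ ‖ζ‖ := by simpa using hζ
      by_cases hx : x ∈ ball (0 : ℂ) 1
      · rw [hY₀, Set.indicator_of_mem hx, hYdef, norm_smul, norm_pow, norm_diskWeight hx]
        have hw := one_sub_sq_pos hx
        have h1 := (hC x hx).2.1
        have h2 : ‖ζ‖ - ‖x‖ ≤ ‖x - ζ‖ := by rw [norm_sub_rev]; exact norm_sub_norm_le _ _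
        have h3 : 1 - ‖x‖ ^ 2 ≤ 2 * ‖x - ζ‖ := by
          nlinarith [norm_nonneg x, mem_ball_zero_iff.1 hx]
        calc (1 - ‖x‖ ^ 2) ^ 2 * ‖X x‖ ≤ (2 * ‖x - ζ‖) ^ 2 * C := by gcongr
          _ = _ := by simp; ring
      · rw [hY₀, Set.indicator_of_notMem hx, norm_zero]
        have hC0 : 0 ≤ C := (norm_nonneg _).trans (hC 0 (by simp)).2.1
        positivity
  have hv : ∀ v : ℂ, (∫ ζ in ball (0 : ℂ) 1, v • α ζ) +
      (∫ ζ in ball (0 : ℂ) 1, conj v • β ζ) = 0 := by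
    intro v
    have e : (fun ζ => (ball (0 : ℂ) 1).indicator (fun ζ => wirtinger (α ζ) (β ζ)) ζ v)
        = (ball (0 : ℂ) 1).indicator (fun ζ => v • α ζ + conj v • β ζ) := by
      funext ζ
      by_cases hζ : ζ ∈ ball (0 : ℂ) 1
      · rw [Set.indicator_of_mem hζ, Set.indicator_of_mem hζ, wirtinger_apply]
      · rw [Set.indicator_of_notMem hζ, Set.indicator_of_notMem hζ]; rfl
    have hi : IntegrableOn (fun ζ => v • α ζ + conj v • β ζ) (ball 0 1) :=
      (hαi.smul v).add (hβi.smul (conj v))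
    have := integral_bilinear_hasFDerivAt_right_eq_neg_left_of_integrable
      (μ := (volume : Measure ℂ))
      (f := fun _ : ℂ => (1 : ℝ)) (f' := fun _ => 0) (g := Y₀)
      (g' := (ball (0 : ℂ) 1).indicator (fun ζ => wirtinger (α ζ) (β ζ))) (v := v)
      (B := ContinuousLinearMap.lsmul ℝ ℝ) (by simp)
      (by
        simp only [ContinuousLinearMap.lsmul_apply, one_smul]
        rw [e, integrable_indicator_iff measurableSet_ball]
        exact hi)
      (by
        simp only [ContinuousLinearMap.lsmul_apply, one_smul]
        rw [hY₀, integrable_indicator_iff measurableSet_ball]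
        exact hYi)
      (fun _ _ => hasFDerivAt_const _ _) (fun ζ _ => hder ζ)
    simp only [ContinuousLinearMap.lsmul_apply, one_smul] at this
    rw [e, integral_indicator measurableSet_ball] at this
    refine (integral_add (hαi.smul v) (hβi.smul (conj v))).symm.trans ?_
    simpa using this
  have h1 := hv 1
  have hI := hv I
  simp only [integral_smul, map_one, one_smul, conj_I, neg_smul, integral_neg] at h1 hI
  have hI' : I • ((∫ ζ in ball (0 : ℂ) 1, α ζ) - ∫ ζ in ball (0 : ℂ) 1, β ζ) = 0 := by
    rw [smul_sub, sub_eq_add_neg]; exact hI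
  rw [smul_eq_zero_iff_right I_ne_zero, sub_eq_zero] at hI'
  have h2 : (2 : ℂ) • ∫ ζ in ball (0 : ℂ) 1, β ζ = 0 := by
    rw [two_smul]; rwa [hI'] at h1
  rw [smul_eq_zero_iff_right two_ne_zero] at h2
  exact ⟨hI'.trans h2, h2⟩

end Tame

lemma norm_one_sub_conj_mul_comm (z ζ : ℂ) : ‖1 - conj z * ζ‖ = ‖1 - conj ζ * z‖ := by
  rw [← norm_conj (1 - conj z * ζ)]
  simp [mul_comm]

lemma one_sub_norm_le_norm_one_sub_conj_mul {z ζ : ℂ} (hz : z ∈ ball (0 : ℂ) 1) :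
    1 - ‖ζ‖ ≤ ‖1 - conj ζ * z‖ := by
  have h1 := norm_sub_norm_le (1 : ℂ) (conj ζ * z)
  have h2 := mem_ball_zero_iff.1 hz
  rw [norm_one, norm_mul, norm_conj] at h1
  nlinarith [norm_nonneg ζ, norm_nonneg z]

lemma norm_one_sub_conj_mul_pos {z ζ : ℂ} (hz : z ∈ ball (0 : ℂ) 1) (hζ : ζ ∈ ball (0 : ℂ) 1) :
    0 < ‖1 - conj ζ * z‖ := by
  have := one_sub_norm_le_norm_one_sub_conj_mul (ζ := ζ) hz
  have := mem_ball_zero_iff.1 hζ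
  linarith

lemma one_sub_conj_mul_ne_zero {z ζ : ℂ} (hz : z ∈ ball (0 : ℂ) 1) (hζ : ζ ∈ ball (0 : ℂ) 1) :
    1 - conj ζ * z ≠ 0 :=
  norm_pos_iff.1 (norm_one_sub_conj_mul_pos hz hζ)

lemma one_sub_sq_le_norm_one_sub_conj_mul {z ζ : ℂ} (hz : z ∈ ball (0 : ℂ) 1)
    (hζ : ζ ∈ ball (0 : ℂ) 1) : 1 - ‖ζ‖ ^ 2 ≤ 2 * ‖1 - conj ζ * z‖ := by
  have := one_sub_norm_le_norm_one_sub_conj_mul (ζ := ζ) hz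
  have := mem_ball_zero_iff.1 hζ
  nlinarith [norm_nonneg ζ]

section SchwarzPick

variable {V : Type*} [NormedAddCommGroup V] [NormedSpace ℂ V]

lemma moebius_mem_ball {z w : ℂ} (hz : z ∈ ball (0 : ℂ) 1) (hw : w ∈ ball (0 : ℂ) 1) :
    (w + z) / (1 + conj z * w) ∈ ball (0 : ℂ) 1 := by
  have hne : 1 + conj z * w ≠ 0 := by
    have := one_sub_conj_mul_ne_zero (z := -w) (ζ := z) (by simpa using hw) hz
    simpa using this
  have key : ‖1 + conj z * w‖ ^ 2 - ‖w + z‖ ^ 2 = (1 - ‖z‖ ^ 2) * (1 - ‖w‖ ^ 2) := by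
    simp only [← normSq_eq_norm_sq, normSq_apply]
    simp
    ring
  have h := mul_pos (one_sub_sq_pos hz) (one_sub_sq_pos hw)
  rw [mem_ball_zero_iff, norm_div, div_lt_one (norm_pos_iff.2 hne)]
  refine lt_of_pow_lt_pow_left₀ 2 (norm_nonneg _) (by linarith)

/-- First and second order Schwarz–Pick estimates. -/
lemma schwarz_pick {F : ℂ → V} (hF : DifferentiableOn ℂ F (ball 0 1)) {M : ℝ}
    (hM : ∀ z ∈ ball (0 : ℂ) 1, ‖F z‖ ≤ M) {z ζ : ℂ} (hz : z ∈ ball (0 : ℂ) 1)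
    (hζ : ζ ∈ ball (0 : ℂ) 1) :
    ‖F ζ - F z‖ ≤ 2 * M * (‖ζ - z‖ / ‖1 - conj ζ * z‖) ∧
    (1 - ‖z‖ ^ 2) * ‖deriv F z‖ ≤ 2 * M ∧
    ‖F ζ - F z - ((1 - ‖z‖ ^ 2 : ℝ) * ((ζ - z) / (1 - conj z * ζ)) : ℂ) • deriv F z‖ ≤
      4 * M * (‖ζ - z‖ / ‖1 - conj ζ * z‖) ^ 2 := by
  set m : ℂ → ℂ := fun w => (w + z) / (1 + conj z * w) with hm
  have hmd : ∀ w ∈ ball (0 : ℂ) 1, HasDerivAt m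
      ((1 * (1 + conj z * w) - (w + z) * (conj z)) / (1 + conj z * w) ^ 2) w := by
    intro w hw
    have hne : 1 + conj z * w ≠ 0 := by
      have := one_sub_conj_mul_ne_zero (z := -w) (ζ := z) (by simpa using hw) hz
      simpa using this
    refine ((hasDerivAt_id w).add_const z).div ?_ hne
    simpa using ((hasDerivAt_id w).const_mul (conj z)).const_add 1
  have hmm : Set.MapsTo m (ball 0 1) (ball 0 1) := fun w hw => moebius_mem_ball hz hw
  have hm0 : m 0 = z := by simp [hm]
  have hFd : ∀ w ∈ ball (0 : ℂ) 1, HasDerivAt F (deriv F w) w := fun w hw =>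
    ((hF w hw).differentiableAt (isOpen_ball.mem_nhds hw)).hasDerivAt
  have h0 : (0 : ℂ) ∈ ball (0 : ℂ) 1 := by simp
  set f : ℂ → V := F ∘ m with hf
  have hfd : DifferentiableOn ℂ f (ball 0 1) :=
    hF.comp (fun w hw => (hmd w hw).differentiableAt.differentiableWithinAt) hmm
  have hf0 : f 0 = F z := by simp [hf, hm0]
  have hf' : HasDerivAt f (((1 - ‖z‖ ^ 2 : ℝ) : ℂ) • deriv F z) 0 := by
    have h1 := hmd 0 h0
    have h2 := hFd (m 0) (hmm h0)
    have := h2.scomp 0 h1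
    rw [hm0] at this
    convert! this using 2
    simp [mul_conj']
  have hfb : ∀ w ∈ ball (0 : ℂ) 1, ‖f w - f 0‖ ≤ 2 * M := fun w hw => by
    have h1 := hM _ (hmm hw)
    have h2 := hM _ (hmm h0)
    exact (norm_sub_le _ _).trans (by simp only [hf, Function.comp]; linarith)
  have hmaps : Set.MapsTo f (ball 0 1) (closedBall (f 0) (2 * M)) := fun w hw => by
    rw [mem_closedBall, dist_eq_norm_sub]; exact hfb w hw
  have hd0 : ‖deriv f 0‖ ≤ 2 * M := by
    simpa using norm_deriv_le_div_of_mapsTo_ball hfd hmaps one_pos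
  set b : ℂ := (ζ - z) / (1 - conj z * ζ) with hb
  have hbn : ‖b‖ = ‖ζ - z‖ / ‖1 - conj ζ * z‖ := by
    rw [hb, norm_div, norm_one_sub_conj_mul_comm]
  have hbm : b ∈ ball (0 : ℂ) 1 := by
    have := moebius_mem_ball (z := -z) (by simpa using hz) hζ
    simpa [hb, sub_eq_add_neg] using this
  have hmb : m b = ζ := by
    have h1 : 1 - conj z * ζ ≠ 0 := one_sub_conj_mul_ne_zero hζ hz
    have h2 : 1 - conj z * z ≠ 0 := one_sub_conj_mul_ne_zero hz hz
    have h3 : (1 - conj z * ζ) * (1 + conj z * b) = 1 - conj z * z := by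
      rw [hb]; field_simp; ring
    have h4 : 1 + conj z * b ≠ 0 := fun h => h2 (by rw [← h3, h, mul_zero])
    simp only [hm]
    rw [div_eq_iff h4]
    have h5 : b * (1 - conj z * ζ) = ζ - z := by rw [hb, div_mul_cancel₀ _ h1]
    linear_combination h5
  have hfb' : f b = F ζ := by simp [hf, hmb]
  refine ⟨?_, ?_, ?_⟩
  · have := dist_le_div_mul_dist_of_mapsTo_ball hfd hmaps hbm
    rw [dist_eq_norm_sub, dist_eq_norm_sub, hfb', hf0, sub_zero, div_one, hbn] at this
    exact this
  · rw [hf'.deriv, norm_smul, norm_real, Real.norm_of_nonneg (one_sub_sq_pos hz).le] at hd0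
    exact hd0
  · set g : ℂ → V := fun w => f w - w • deriv f 0 with hg
    have hgd : DifferentiableOn ℂ g (ball 0 1) := by fun_prop
    have hg0 : g 0 = f 0 := by simp [hg]
    have hgm : Set.MapsTo g (ball 0 1) (closedBall (g 0) (4 * M)) := fun w hw => by
      rw [mem_closedBall, dist_eq_norm_sub, hg0, hg]
      have h1 := hfb w hw
      have h2 : ‖w • deriv f 0‖ ≤ 1 * (2 * M) := by
        rw [norm_smul]
        gcongr
        exact (mem_ball_zero_iff.1 hw).le
      calc ‖f w - w • deriv f 0 - f 0‖ = ‖(f w - f 0) - w • deriv f 0‖ := by congr 1; abel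
        _ ≤ _ := (norm_sub_le _ _).trans (by linarith)
    have hgo : (g · - g 0) =o[𝓝 0] (fun w : ℂ => ‖w - 0‖ ^ 1) := by
      have h1 := hf'.isLittleO
      rw [← hf'.deriv] at h1
      simp only [pow_one]
      rw [Asymptotics.isLittleO_norm_right]
      refine h1.congr_left fun w => ?_
      simp only [hg, sub_zero, zero_smul]
      abel
    have := dist_le_mul_div_pow_of_mapsTo_ball_of_isLittleO hgd hgm hgo hbm
    rw [dist_eq_norm_sub, dist_eq_norm_sub, sub_zero, div_one, hg0, hg, hbn] at this
    simp only [hf'.deriv, hfb', hf0] at this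
    refine le_trans (le_of_eq ?_) this
    congr 1
    rw [smul_smul, mul_comm]
    abel

lemma norm_dslope_le {F : ℂ → V} (hF : DifferentiableOn ℂ F (ball 0 1)) {M : ℝ}
    (hM : ∀ z ∈ ball (0 : ℂ) 1, ‖F z‖ ≤ M) {z ζ : ℂ} (hz : z ∈ ball (0 : ℂ) 1)
    (hζ : ζ ∈ ball (0 : ℂ) 1) : ‖dslope F z ζ‖ ≤ 2 * M / ‖1 - conj ζ * z‖ := by
  obtain ⟨h1, h2, -⟩ := schwarz_pick hF hM hz hζ
  rcases eq_or_ne ζ z with rfl | hne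
  · rw [dslope_same, le_div_iff₀ (norm_one_sub_conj_mul_pos hz hz)]
    have : ‖1 - conj ζ * ζ‖ = 1 - ‖ζ‖ ^ 2 := by
      rw [← norm_diskWeight hζ, diskWeight, mul_comm]
    rw [this, mul_comm]
    exact h2
  · rw [dslope_of_ne _ hne, slope_def_module, norm_smul, norm_inv, ← div_eq_inv_mul,
      div_le_iff₀ (norm_pos_iff.2 (sub_ne_zero.2 hne))]
    refine h1.trans (le_of_eq ?_)
    ring

lemma dslope_comm (F : ℂ → V) (z ζ : ℂ) : dslope F z ζ = dslope F ζ z := by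
  rcases eq_or_ne ζ z with rfl | hne
  · rfl
  · rw [dslope_of_ne _ hne, dslope_of_ne _ hne.symm, slope_comm]

lemma deriv_dslope_of_ne {F : ℂ → V} (hF : DifferentiableOn ℂ F (ball 0 1)) {z ζ : ℂ}
    (hz : z ∈ ball (0 : ℂ) 1) (hne : z ≠ ζ) :
    deriv (dslope F ζ) z = (z - ζ)⁻¹ • (deriv F z - dslope F ζ z) := by
  have h0 : z - ζ ≠ 0 := sub_ne_zero.2 hne
  have h1 : dslope F ζ =ᶠ[𝓝 z] fun w => (w - ζ)⁻¹ • (F w - F ζ) := by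
    filter_upwards [isOpen_ne.mem_nhds hne] with w hw
    rw [dslope_of_ne _ hw, slope_def_module]
  have hFz := ((hF z hz).differentiableAt (isOpen_ball.mem_nhds hz)).hasDerivAt
  have h2 : HasDerivAt (fun w => (w - ζ)⁻¹ • (F w - F ζ))
      ((z - ζ)⁻¹ • deriv F z + (-1 / (z - ζ) ^ 2) • (F z - F ζ)) z := by
    refine HasDerivAt.smul ?_ (hFz.sub_const _)
    have := ((hasDerivAt_id' z).sub_const ζ).fun_inv h0
    exact this
  have e : -1 / (z - ζ) ^ 2 = -((z - ζ)⁻¹ * (z - ζ)⁻¹) := by field_simp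
  rw [h1.deriv_eq, h2.deriv, dslope_of_ne _ hne, slope_def_module, e]
  module

lemma differentiableOn_dslope_ball [CompleteSpace V] {F : ℂ → V}
    (hF : DifferentiableOn ℂ F (ball 0 1)) {ζ : ℂ} (hζ : ζ ∈ ball (0 : ℂ) 1) :
    DifferentiableOn ℂ (dslope F ζ) (ball 0 1) :=
  (differentiableOn_dslope (isOpen_ball.mem_nhds hζ)).2 hF

lemma norm_deriv_dslope_le [CompleteSpace V] {F : ℂ → V} (hF : DifferentiableOn ℂ F (ball 0 1))
    {M : ℝ} (hM : ∀ z ∈ ball (0 : ℂ) 1, ‖F z‖ ≤ M) {z ζ : ℂ} (hz : z ∈ ball (0 : ℂ) 1)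
    (hζ : ζ ∈ ball (0 : ℂ) 1) : ‖deriv (dslope F ζ) z‖ ≤
      ‖deriv F z‖ / ‖1 - conj ζ * z‖ + 4 * M / ‖1 - conj ζ * z‖ ^ 2 := by
  have main : ∀ z ∈ ball (0 : ℂ) 1, z ≠ ζ → ‖deriv (dslope F ζ) z‖ ≤
      ‖deriv F z‖ / ‖1 - conj ζ * z‖ + 4 * M / ‖1 - conj ζ * z‖ ^ 2 := by
    intro z hz hne
    obtain ⟨-, -, h⟩ := schwarz_pick hF hM hz hζ
    have h0 : z - ζ ≠ 0 := sub_ne_zero.2 hne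
    have h0' : ζ - z ≠ 0 := sub_ne_zero.2 hne.symm
    have hw : 1 - conj z * ζ ≠ 0 := one_sub_conj_mul_ne_zero hζ hz
    have hw' : 1 - ζ * conj z ≠ 0 := by rwa [mul_comm]
    have hp := norm_one_sub_conj_mul_pos hz hζ
    have hn : 0 < ‖ζ - z‖ := norm_pos_iff.2 h0'
    have e : deriv (dslope F ζ) z = (conj z / (1 - conj z * ζ)) • deriv F z +
        ((ζ - z) ^ 2)⁻¹ • (F ζ - F z -
          ((1 - ‖z‖ ^ 2 : ℝ) * ((ζ - z) / (1 - conj z * ζ)) : ℂ) • deriv F z) := by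
      rw [deriv_dslope_of_ne hF hz hne, dslope_of_ne _ hne, slope_def_module, ← diskWeight_eq,
        diskWeight]
      have e1 : ((ζ - z) ^ 2)⁻¹ = -((z - ζ)⁻¹ * (ζ - z)⁻¹) := by field_simp; ring
      rw [smul_sub ((ζ - z) ^ 2)⁻¹ (F ζ - F z), smul_smul,
        smul_sub (z - ζ)⁻¹ (deriv F z), smul_smul,
        ← neg_sub (F z) (F ζ), smul_neg]
      have e2 : -(((ζ - z) ^ 2)⁻¹ • (F z - F ζ)) = -(((z - ζ)⁻¹ * (z - ζ)⁻¹) • (F z - F ζ)) := by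
        congr 2; field_simp; ring
      rw [e2, sub_eq_add_neg, add_sub, add_comm (_ • deriv F z) (-_), add_comm (_ • deriv F z) (-_),
        add_sub_assoc, ← sub_smul]
      congr 2
      field_simp
      ring
    rw [e]
    refine (norm_add_le _ _).trans (add_le_add ?_ ?_)
    · rw [norm_smul, norm_div, norm_conj, norm_one_sub_conj_mul_comm, div_mul_eq_mul_div]
      gcongr
      have := (mem_ball_zero_iff.1 hz).le
      exact mul_le_of_le_one_left (norm_nonneg _) this
    · rw [norm_smul, norm_inv, norm_pow, ← div_eq_inv_mul, div_le_iff₀ (by positivity)]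
      refine h.trans (le_of_eq ?_)
      ring
  rcases ne_or_eq z ζ with hne | rfl
  · exact main z hz hne
  have hc : ContinuousOn (deriv (dslope F z)) (ball 0 1) :=
    ((differentiableOn_dslope_ball hF hz).deriv isOpen_ball).continuousOn
  have hc1 : ContinuousOn (fun w => ‖deriv F w‖ / ‖1 - conj z * w‖ + 4 * M / ‖1 - conj z * w‖ ^ 2)
      (ball 0 1) := by
    have hF' := (hF.deriv isOpen_ball).continuousOn
    have hne : ∀ w ∈ ball (0 : ℂ) 1, ‖1 - conj z * w‖ ≠ 0 := fun w hw =>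
      (norm_one_sub_conj_mul_pos hw hz).ne'
    have hne2 : ∀ w ∈ ball (0 : ℂ) 1, ‖1 - conj z * w‖ ^ 2 ≠ 0 := fun w hw =>
      pow_ne_zero _ (hne w hw)
    fun_prop (disch := assumption)
  have hn := isOpen_ball.mem_nhds hz
  refine le_of_tendsto_of_tendsto (b := 𝓝[≠] z)
    ((hc.continuousAt hn).norm.tendsto.mono_left nhdsWithin_le_nhds)
    ((hc1.continuousAt hn).tendsto.mono_left nhdsWithin_le_nhds) ?_
  filter_upwards [self_mem_nhdsWithin, mem_nhdsWithin_of_mem_nhds hn] with w hw hw1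
  exact main w hw1 hw

end SchwarzPick

lemma lintegral_mul_sq_le {α : Type*} [MeasurableSpace α] {μ : Measure α} {f g : α → ℝ≥0∞}
    (hf : AEMeasurable f μ) (hg : AEMeasurable g μ) :
    (∫⁻ x, f x * g x ∂μ) ^ 2 ≤ (∫⁻ x, f x ^ 2 ∂μ) * ∫⁻ x, g x ^ 2 ∂μ := by
  have h := ENNReal.lintegral_mul_le_Lp_mul_Lq μ Real.HolderConjugate.two_two hf hg
  calc (∫⁻ x, f x * g x ∂μ) ^ 2 ≤ ((∫⁻ x, f x ^ (2 : ℝ) ∂μ) ^ (1 / (2 : ℝ)) *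
        (∫⁻ x, g x ^ (2 : ℝ) ∂μ) ^ (1 / (2 : ℝ))) ^ 2 := by gcongr; exact h
    _ = _ := by
      rw [mul_pow, ← ENNReal.rpow_natCast, ← ENNReal.rpow_natCast, ← ENNReal.rpow_mul,
        ← ENNReal.rpow_mul]
      norm_num

/-- Schur's test. -/
lemma lintegral_sq_le_of_schur {α : Type*} [MeasurableSpace α] {μ : Measure α} [SFinite μ]
    {k : α → α → ℝ≥0∞} (hk : Measurable (Function.uncurry k)) {p l : α → ℝ≥0∞} (hp : Measurable p)
    (hl : Measurable l) {C : ℝ≥0∞} (hp0 : ∀ᵐ x ∂μ, p x ≠ 0) (hpt : ∀ᵐ x ∂μ, p x ≠ ∞)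
    (h1 : ∀ᵐ x ∂μ, ∫⁻ y, k x y * p y ∂μ ≤ C * p x)
    (h2 : ∀ᵐ y ∂μ, ∫⁻ x, k x y * p x ∂μ ≤ C * p y) :
    ∫⁻ x, (∫⁻ y, k x y * l y ∂μ) ^ 2 ∂μ ≤ C ^ 2 * ∫⁻ y, l y ^ 2 ∂μ := by
  have hk1 : ∀ x, Measurable (k x) := fun x => hk.of_uncurry_left
  have hk2 : ∀ y, Measurable (fun x => k x y) := fun y => hk.of_uncurry_right
  have hsq : ∀ t : ℝ≥0∞, (t ^ (1 / 2 : ℝ)) ^ 2 = t := fun t => by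
    rw [← ENNReal.rpow_natCast, ← ENNReal.rpow_mul]; norm_num
  have hcs : ∀ᵐ x ∂μ, (∫⁻ y, k x y * l y ∂μ) ^ 2 ≤
      ∫⁻ y, C * p x * (k x y * (p y)⁻¹ * l y ^ 2) ∂μ := by
    filter_upwards [h1] with x hx
    rw [lintegral_const_mul _ (by fun_prop)]
    have e : ∫⁻ y, k x y * l y ∂μ = ∫⁻ y, (k x y * p y) ^ (1 / 2 : ℝ) *
        ((k x y * (p y)⁻¹) ^ (1 / 2 : ℝ) * l y) ∂μ := by
      refine lintegral_congr_ae ?_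
      filter_upwards [hp0, hpt] with y h0 ht
      rw [← mul_assoc, ← ENNReal.mul_rpow_of_nonneg _ _ (by norm_num)]
      congr 1
      have : k x y * p y * (k x y * (p y)⁻¹) = k x y ^ 2 := by
        rw [mul_mul_mul_comm, ENNReal.mul_inv_cancel h0 ht, mul_one, sq]
      rw [this, ← ENNReal.rpow_natCast, ← ENNReal.rpow_mul]; norm_num
    rw [e]
    refine (lintegral_mul_sq_le (by fun_prop) (by fun_prop)).trans ?_
    simp only [mul_pow, hsq]
    gcongr
  calc ∫⁻ x, (∫⁻ y, k x y * l y ∂μ) ^ 2 ∂μ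
      ≤ ∫⁻ x, ∫⁻ y, C * p x * (k x y * (p y)⁻¹ * l y ^ 2) ∂μ ∂μ := lintegral_mono_ae hcs
    _ = ∫⁻ y, ∫⁻ x, C * p x * (k x y * (p y)⁻¹ * l y ^ 2) ∂μ ∂μ := by
      refine lintegral_lintegral_swap (Measurable.aemeasurable ?_)
      have : Measurable fun q : α × α => k q.1 q.2 := hk
      simp only [Function.uncurry_def]
      fun_prop
    _ ≤ ∫⁻ y, C ^ 2 * l y ^ 2 ∂μ := by
      refine lintegral_mono_ae ?_
      filter_upwards [h2, hp0, hpt] with y hy h0 ht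
      calc ∫⁻ x, C * p x * (k x y * (p y)⁻¹ * l y ^ 2) ∂μ
          = ∫⁻ x, (C * (p y)⁻¹ * l y ^ 2) * (k x y * p x) ∂μ := by
            congr 1; ext x; ring
        _ = (C * (p y)⁻¹ * l y ^ 2) * ∫⁻ x, (k x y * p x) ∂μ := by
            rw [lintegral_const_mul _ (by fun_prop)]
        _ ≤ (C * (p y)⁻¹ * l y ^ 2) * (C * p y) := by gcongr
        _ = C ^ 2 * l y ^ 2 * ((p y)⁻¹ * p y) := by ring
        _ = _ := by rw [ENNReal.inv_mul_cancel h0 ht, mul_one]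
    _ = _ := lintegral_const_mul _ (by fun_prop)

lemma lintegral_rpow_mul_max_rpow_le {b q : ℝ} (hb : -1 < b) (hbq : b - q < -1) {δ : ℝ}
    (hδ : 0 < δ) : ∫⁻ s in Set.Ioi (0 : ℝ), ENNReal.ofReal (s ^ b * max s δ ^ (-q)) ≤
      ENNReal.ofReal ((1 / (b + 1) + 1 / (q - b - 1)) * δ ^ (b + 1 - q)) := by
  have hb1 : 0 < b + 1 := by linarith
  have hq1 : 0 < q - b - 1 := by linarith
  rw [← Set.Ioc_union_Ioi_eq_Ioi hδ.le]
  refine (lintegral_union_le _ _ _).trans ?_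
  rw [add_mul, ENNReal.ofReal_add (by positivity) (by positivity)]
  refine add_le_add ?_ ?_
  · have e : ∫⁻ s in Set.Ioc (0 : ℝ) δ, ENNReal.ofReal (s ^ b * max s δ ^ (-q)) =
        ∫⁻ s in Set.Ioc (0 : ℝ) δ, ENNReal.ofReal (s ^ b * δ ^ (-q)) :=
      setLIntegral_congr_fun measurableSet_Ioc fun s hs => by simp only [max_eq_right hs.2]
    have hi : IntervalIntegrable (fun s : ℝ => s ^ b * δ ^ (-q)) volume 0 δ :=
      (intervalIntegral.intervalIntegrable_rpow' hb).mul_const _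
    rw [e, ← ofReal_integral_eq_lintegral_ofReal]
    · rw [← intervalIntegral.integral_of_le hδ.le, intervalIntegral.integral_mul_const,
        integral_rpow (Or.inl hb), Real.zero_rpow hb1.ne', sub_zero, sub_eq_add_neg (b + 1) q,
        Real.rpow_add hδ (b + 1)]
      exact le_of_eq (by congr 1; ring)
    · exact (intervalIntegrable_iff_integrableOn_Ioc_of_le hδ.le).1 hi
    · filter_upwards [ae_restrict_mem measurableSet_Ioc] with s hs
      have := hs.1
      positivity
  · have e : ∫⁻ s in Set.Ioi δ, ENNReal.ofReal (s ^ b * max s δ ^ (-q)) =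
        ∫⁻ s in Set.Ioi δ, ENNReal.ofReal (s ^ (b - q)) :=
      setLIntegral_congr_fun measurableSet_Ioi fun s hs => by
        have hs' : δ < s := hs
        simp only [max_eq_left hs'.le]
        rw [sub_eq_add_neg, Real.rpow_add (hδ.trans hs')]
    rw [e, ← ofReal_integral_eq_lintegral_ofReal]
    · rw [integral_Ioi_rpow_of_lt hbq hδ]
      refine le_of_eq ?_
      congr 1
      have h1 : b - q + 1 = -(q - b - 1) := by ring
      have h2 : b + 1 - q = -(q - b - 1) := by ring
      rw [h1, h2]
      field_simp
    · exact integrableOn_Ioi_rpow_of_lt hbq hδ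
    · filter_upwards [ae_restrict_mem measurableSet_Ioi] with s hs
      have hs' : δ < s := hs
      have := hδ.trans hs'
      positivity

lemma abs_le_mul_norm_one_sub_mul_exp {x θ : ℝ} (hx0 : 0 ≤ x) (hx1 : x < 1)
    (hθ : θ ∈ Set.Ioo (-Real.pi) Real.pi) : |θ| ≤ 2 * Real.pi * ‖1 - x * exp (θ * I)‖ := by
  have hn : ‖1 - x * exp (θ * I)‖ ^ 2 = (1 - x) ^ 2 + 4 * x * Real.sin (θ / 2) ^ 2 := by
    have h2 : Real.cos θ = 1 - 2 * Real.sin (θ / 2) ^ 2 := by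
      have h4 := Real.cos_two_mul (θ / 2)
      have h5 := Real.sin_sq_add_cos_sq (θ / 2)
      rw [mul_div_cancel₀ _ two_ne_zero] at h4
      linarith
    have h3 := Real.sin_sq_add_cos_sq θ
    rw [exp_mul_I, ← normSq_eq_norm_sq, normSq_apply]
    simp [← ofReal_cos, ← ofReal_sin]
    rw [← sub_eq_zero]
    linear_combination x ^ 2 * h3 - 2 * x * h2
  have hsin : |θ| ≤ Real.pi * |Real.sin (θ / 2)| := by
    have h1 : |θ / 2| ≤ Real.pi / 2 := by
      rw [abs_div, abs_two]
      have := (abs_lt.2 hθ).le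
      linarith
    have h2 := Real.mul_abs_le_abs_sin h1
    rw [abs_div, abs_two] at h2
    have hp := Real.pi_pos
    calc |θ| = Real.pi * (2 / Real.pi * (|θ| / 2)) := by field_simp
      _ ≤ _ := by gcongr
  refine hsin.trans ?_
  have hp := Real.pi_pos
  have : |Real.sin (θ / 2)| ≤ 2 * ‖1 - x * exp (θ * I)‖ := by
    refine abs_le_of_sq_le_sq ?_ (by positivity)
    rw [mul_pow, hn]
    have := Real.sin_sq_le_one (θ / 2)
    rcases le_total x (1 / 2) with h | h <;> nlinarith [sq_nonneg (Real.sin (θ / 2))]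
  calc Real.pi * |Real.sin (θ / 2)| ≤ Real.pi * (2 * ‖1 - x * exp (θ * I)‖) := by gcongr
    _ = _ := by ring

lemma max_rpow_bound {x θ A : ℝ} (hx0 : 0 ≤ x) (hx1 : x < 1) (hA0 : 0 < A) (hA : A ≤ 1 - x)
    (hθ : θ ∈ Set.Ioo (-Real.pi) Real.pi) {q : ℝ} (hq : 0 ≤ q) :
    ‖1 - x * exp (θ * I)‖ ^ (-q) ≤ (2 * Real.pi) ^ q * max |θ| A ^ (-q) := by
  have hp := Real.pi_gt_three
  have h1 := abs_le_mul_norm_one_sub_mul_exp hx0 hx1 hθ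
  have h2 : 1 - x ≤ ‖1 - x * exp (θ * I)‖ := by
    have := norm_sub_norm_le (1 : ℂ) (x * exp (θ * I))
    rwa [norm_one, norm_mul, norm_exp_ofReal_mul_I, norm_real, Real.norm_of_nonneg hx0,
      mul_one] at this
  have h3 : max |θ| A ≤ 2 * Real.pi * ‖1 - x * exp (θ * I)‖ := by
    refine max_le h1 ?_
    nlinarith
  have hm : 0 < max |θ| A := lt_max_of_lt_right hA0
  have hn : 0 < ‖1 - x * exp (θ * I)‖ := by linarith
  have h4 := Real.rpow_le_rpow_of_nonpos hm h3 (neg_nonpos.2 hq)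
  rw [Real.mul_rpow (by positivity) hn.le, Real.rpow_neg (by positivity : 0 ≤ 2 * Real.pi)] at h4
  rwa [inv_mul_le_iff₀ (by positivity)] at h4

lemma lintegral_abs_max_rpow_le {q : ℝ} (hq : 1 < q) {A : ℝ} (hA : 0 < A) :
    ∫⁻ θ in Set.Ioo (-Real.pi) Real.pi, ENNReal.ofReal (max |θ| A ^ (-q)) ≤
      ENNReal.ofReal (2 * (1 + 1 / (q - 1)) * A ^ (1 - q)) := by
  have h := lintegral_rpow_mul_max_rpow_le (b := 0) (q := q) (by norm_num) (by linarith) hA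
  simp only [Real.rpow_zero, one_mul, zero_add, div_one, sub_zero] at h
  have h1 : ∫⁻ θ in Set.Ioi (0 : ℝ), ENNReal.ofReal (max |θ| A ^ (-q)) ≤
      ENNReal.ofReal ((1 + 1 / (q - 1)) * A ^ (1 - q)) := by
    refine le_trans (le_of_eq (setLIntegral_congr_fun measurableSet_Ioi fun s hs => ?_)) h
    simp only [abs_of_pos (Set.mem_Ioi.1 hs)]
  have h2 : ∫⁻ θ in Set.Iio (0 : ℝ), ENNReal.ofReal (max |θ| A ^ (-q)) =
      ∫⁻ θ in Set.Ioi (0 : ℝ), ENNReal.ofReal (max |θ| A ^ (-q)) := by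
    have := (Measure.measurePreserving_neg (volume : Measure ℝ)).setLIntegral_comp_preimage_emb
      (MeasurableEquiv.neg ℝ).measurableEmbedding (fun θ => ENNReal.ofReal (max |θ| A ^ (-q)))
      (Set.Ioi 0)
    simpa using this
  calc _ ≤ ∫⁻ θ in Set.Iic (0 : ℝ) ∪ Set.Ioi 0, ENNReal.ofReal (max |θ| A ^ (-q)) := by
        refine lintegral_mono_set ?_
        simp
    _ ≤ _ := lintegral_union_le _ _ _
    _ = _ := by rw [setLIntegral_congr Iio_ae_eq_Iic.symm, h2]
    _ ≤ _ := add_le_add h1 h1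
    _ = _ := by
      have : 0 < q - 1 := by linarith
      rw [← ENNReal.ofReal_add (by positivity) (by positivity)]
      congr 1; ring

/-- A Forelli–Rudin estimate. -/
lemma exists_lintegral_weight_le {a : ℝ} (ha : -1 < a) (ha' : a < -1 / 4) :
    ∃ C : ℝ, 0 ≤ C ∧ ∀ z ∈ ball (0 : ℂ) 1, ∫⁻ ζ in ball (0 : ℂ) 1,
      ENNReal.ofReal ((1 - ‖ζ‖ ^ 2) ^ a * ‖1 - conj ζ * z‖ ^ (-(7 / 4) : ℝ)) ≤
      ENNReal.ofReal (C * (1 - ‖z‖ ^ 2) ^ (a + 1 / 4)) := by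
  have ha1 : 0 < a + 1 := by linarith
  have ha2 : 0 < 3 / 4 - a - 1 := by linarith
  set c : ℝ := (2 * Real.pi) ^ (7 / 4 : ℝ) * (2 * (1 + 1 / (7 / 4 - 1))) with hc
  have hpi := Real.pi_pos
  have hc0 : 0 ≤ c := by positivity
  set c' : ℝ := (1 / (a + 1) + 1 / (3 / 4 - a - 1)) with hc'
  have hc'0 : 0 ≤ c' := by positivity
  refine ⟨c * c' * 2⁻¹ ^ (a + 1 / 4), by positivity, fun z hz => ?_⟩
  set ρ : ℝ := ‖z‖ with hρ
  have hρ0 : 0 ≤ ρ := norm_nonneg z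
  have hρ1 : ρ < 1 := mem_ball_zero_iff.1 hz
  set δ : ℝ := 1 - ρ with hδ
  have hδ0 : 0 < δ := by linarith
  have hrot : ∫⁻ ζ in ball (0 : ℂ) 1,
      ENNReal.ofReal ((1 - ‖ζ‖ ^ 2) ^ a * ‖1 - conj ζ * z‖ ^ (-(7 / 4) : ℝ)) =
      ∫⁻ ζ in ball (0 : ℂ) 1,
        ENNReal.ofReal ((1 - ‖ζ‖ ^ 2) ^ a * ‖1 - ρ * ζ‖ ^ (-(7 / 4) : ℝ)) := by
    have h := (rotation (Circle.exp (arg z))).measurePreserving.setLIntegral_comp_preimage_emb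
      (rotation (Circle.exp (arg z))).toHomeomorph.measurableEmbedding
      (fun ζ => ENNReal.ofReal ((1 - ‖ζ‖ ^ 2) ^ a * ‖1 - conj ζ * z‖ ^ (-(7 / 4) : ℝ)))
      (ball (0 : ℂ) 1)
    rw [LinearIsometryEquiv.preimage_ball, map_zero] at h
    rw [← h]
    refine lintegral_congr fun ζ => ?_
    have e : conj (exp (arg z * I) * ζ) * z = ρ * conj ζ := by
      have h1 := norm_mul_exp_arg_mul_I z
      have h2 : conj (exp (arg z * I)) * exp (arg z * I) = 1 := by
        rw [conj_mul', norm_exp_ofReal_mul_I]; simp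
      rw [map_mul]
      calc conj (exp (arg z * I)) * conj ζ * z
          = conj (exp (arg z * I)) * conj ζ * (‖z‖ * exp (arg z * I)) := by rw [h1]
        _ = (conj (exp (arg z * I)) * exp (arg z * I)) * (ρ * conj ζ) := by rw [hρ]; ring
        _ = _ := by rw [h2, one_mul]
    have e2 : ‖1 - ρ * conj ζ‖ = ‖1 - ρ * ζ‖ := by
      rw [← norm_conj]; simp
    simp only [rotation_apply, Circle.coe_exp, e, e2, norm_mul, norm_exp_ofReal_mul_I, one_mul]
  rw [hrot, ← lintegral_indicator measurableSet_ball, ← Complex.lintegral_comp_polarCoord_symm,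
    polarCoord_target]
  set G : ℝ × ℝ → ℝ≥0∞ := fun p => ENNReal.ofReal ((1 - p.1) ^ a * (2 * Real.pi) ^ (7 / 4 : ℝ)) *
    ENNReal.ofReal (max |p.2| (max (1 - p.1) δ) ^ (-(7 / 4) : ℝ)) with hG
  have hGm : Measurable G := by fun_prop
  have hpt : ∀ p ∈ Set.Ioi (0 : ℝ) ×ˢ Set.Ioo (-Real.pi) Real.pi,
      ENNReal.ofReal p.1 • (ball (0 : ℂ) 1).indicator
        (fun ζ => ENNReal.ofReal ((1 - ‖ζ‖ ^ 2) ^ a * ‖1 - ρ * ζ‖ ^ (-(7 / 4) : ℝ)))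
        (Complex.polarCoord.symm p) ≤
      (Set.Ioo (0 : ℝ) 1 ×ˢ Set.Ioo (-Real.pi) Real.pi).indicator G p := by
    rintro ⟨r, θ⟩ ⟨hr, hθ⟩
    have hr0 : 0 < r := hr
    rw [Complex.polarCoord_symm_apply, ofReal_cos, ofReal_sin, ← exp_mul_I]
    have hn : ‖(r : ℂ) * exp (θ * I)‖ = r := by
      rw [norm_mul, norm_exp_ofReal_mul_I, norm_real, Real.norm_of_nonneg hr0.le, mul_one]
    by_cases hr1 : r < 1
    · have hm : (r : ℂ) * exp (θ * I) ∈ ball (0 : ℂ) 1 := by rwa [mem_ball_zero_iff, hn]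
      have hm' : (r, θ) ∈ Set.Ioo (0 : ℝ) 1 ×ˢ Set.Ioo (-Real.pi) Real.pi := ⟨⟨hr0, hr1⟩, hθ⟩
      rw [Set.indicator_of_mem hm, Set.indicator_of_mem hm', hn]
      simp only [hG, smul_eq_mul]
      have hr2 : 0 < 1 - r := by linarith
      have hx1 : ρ * r < 1 := by nlinarith
      have hA : max (1 - r) δ ≤ 1 - ρ * r := max_le (by nlinarith) (by nlinarith)
      have hb := max_rpow_bound (q := 7 / 4) (by positivity) hx1 (lt_max_of_lt_right hδ0) hA hθ
        (by norm_num)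
      have e : (ρ : ℂ) * (r * exp (θ * I)) = (ρ * r : ℝ) * exp (θ * I) := by push_cast; ring
      have hw : (1 - r ^ 2) ^ a ≤ (1 - r) ^ a :=
        Real.rpow_le_rpow_of_nonpos hr2 (by nlinarith) (by linarith)
      have hw0 : 0 ≤ (1 - r) ^ a := by positivity
      rw [e, ← ENNReal.ofReal_mul hr0.le, ← ENNReal.ofReal_mul (by positivity)]
      refine ENNReal.ofReal_le_ofReal ?_
      calc r * ((1 - r ^ 2) ^ a * ‖1 - (ρ * r : ℝ) * exp (θ * I)‖ ^ (-(7 / 4) : ℝ))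
          ≤ 1 * ((1 - r) ^ a * ((2 * Real.pi) ^ (7 / 4 : ℝ) *
            max |θ| (max (1 - r) δ) ^ (-(7 / 4) : ℝ))) := by
            have : 0 ≤ (1 - r ^ 2) ^ a := Real.rpow_nonneg (by nlinarith) _
            gcongr
        _ = _ := by ring
    · have hm : (r : ℂ) * exp (θ * I) ∉ ball (0 : ℂ) 1 := by rwa [mem_ball_zero_iff, hn]
      rw [Set.indicator_of_notMem hm, smul_zero]
      exact zero_le
  have hms : MeasurableSet (Set.Ioo (0 : ℝ) 1 ×ˢ Set.Ioo (-Real.pi) Real.pi) :=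
    measurableSet_Ioo.prod measurableSet_Ioo
  refine (setLIntegral_mono' (measurableSet_Ioi.prod measurableSet_Ioo) hpt).trans ?_
  refine (setLIntegral_le_lintegral _ _).trans ?_
  rw [lintegral_indicator hms, Measure.volume_eq_prod, ← Measure.prod_restrict,
    lintegral_prod _ hGm.aemeasurable]
  have hin : ∀ r ∈ Set.Ioo (0 : ℝ) 1, ∫⁻ θ in Set.Ioo (-Real.pi) Real.pi, G (r, θ) ≤
      ENNReal.ofReal (c * ((1 - r) ^ a * max (1 - r) δ ^ (-(3 / 4) : ℝ))) := by
    intro r hr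
    have hr2 : 0 < 1 - r := by linarith [hr.2]
    simp only [hG]
    rw [lintegral_const_mul _ (by fun_prop)]
    calc _ ≤ ENNReal.ofReal ((1 - r) ^ a * (2 * Real.pi) ^ (7 / 4 : ℝ)) *
          ENNReal.ofReal (2 * (1 + 1 / (7 / 4 - 1)) * max (1 - r) δ ^ (1 - 7 / 4 : ℝ)) := by
          gcongr
          exact lintegral_abs_max_rpow_le (by norm_num) (lt_max_of_lt_right hδ0)
      _ = _ := by
          rw [← ENNReal.ofReal_mul (by positivity), hc]
          congr 1
          norm_num
          ring
  refine (setLIntegral_mono' measurableSet_Ioo hin).trans ?_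
  have hflip := (Measure.measurePreserving_sub_left (volume : Measure ℝ)
    1).setLIntegral_comp_preimage_emb (MeasurableEquiv.subLeft (1 : ℝ)).measurableEmbedding
      (fun s => ENNReal.ofReal (c * (s ^ a * max s δ ^ (-(3 / 4) : ℝ)))) (Set.Ioo 0 1)
  have hpre : (fun x : ℝ => 1 - x) ⁻¹' Set.Ioo 0 1 = Set.Ioo 0 1 := by simp
  rw [hpre] at hflip
  rw [hflip]
  refine (lintegral_mono_set Set.Ioo_subset_Ioi_self).trans ?_
  simp only [ENNReal.ofReal_mul hc0]
  rw [lintegral_const_mul _ (by fun_prop)]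
  have hfin : δ ^ (a + 1 / 4) ≤ 2⁻¹ ^ (a + 1 / 4) * (1 - ρ ^ 2) ^ (a + 1 / 4) := by
    rw [← Real.mul_rpow (by norm_num) (by nlinarith)]
    exact Real.rpow_le_rpow_of_nonpos (by nlinarith) (by nlinarith) (by linarith)
  calc _ ≤ ENNReal.ofReal c * ENNReal.ofReal (c' * δ ^ (a + 1 - 3 / 4)) := by
        gcongr
        exact lintegral_rpow_mul_max_rpow_le ha (by linarith) hδ0
    _ ≤ _ := by
        rw [← ENNReal.ofReal_mul hc0]
        refine ENNReal.ofReal_le_ofReal ?_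
        have e : a + 1 - 3 / 4 = a + 1 / 4 := by ring
        rw [e]
        calc c * (c' * δ ^ (a + 1 / 4)) ≤ c * (c' * (2⁻¹ ^ (a + 1 / 4) *
              (1 - ρ ^ 2) ^ (a + 1 / 4))) := by gcongr
          _ = _ := by ring

/-- The positive kernel dominating the derivative of the solution operator. -/
noncomputable def schurKernel (z ζ : ℂ) : ℝ :=
  (1 - ‖ζ‖ ^ 2) ^ (-(1 / 4) : ℝ) * ‖1 - conj ζ * z‖ ^ (-(7 / 4) : ℝ)

lemma exists_schurKernel_bound : ∃ C : ℝ, 0 ≤ C ∧ ∀ l : ℂ → ℝ≥0∞,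
    AEMeasurable l (volume.restrict (ball 0 1)) →
    ∫⁻ z in ball (0 : ℂ) 1, (∫⁻ ζ in ball (0 : ℂ) 1, ENNReal.ofReal (schurKernel z ζ) * l ζ) ^ 2 ≤
      ENNReal.ofReal C * ∫⁻ ζ in ball (0 : ℂ) 1, l ζ ^ 2 := by
  obtain ⟨C₁, hC₁, h₁⟩ := exists_lintegral_weight_le (a := -(3 / 4)) (by norm_num) (by norm_num)
  obtain ⟨C₂, hC₂, h₂⟩ := exists_lintegral_weight_le (a := -(1 / 2)) (by norm_num) (by norm_num)
  refine ⟨(max C₁ C₂) ^ 2, by positivity, fun l hl => ?_⟩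
  set μ : Measure ℂ := volume.restrict (ball 0 1)
  set p : ℂ → ℝ≥0∞ := fun ζ => ENNReal.ofReal ((1 - ‖ζ‖ ^ 2) ^ (-(1 / 2) : ℝ)) with hp
  have hmem : ∀ᵐ ζ ∂μ, ζ ∈ ball (0 : ℂ) 1 := ae_restrict_mem measurableSet_ball
  have hk : Measurable (Function.uncurry fun z ζ => ENNReal.ofReal (schurKernel z ζ)) := by
    simp only [Function.uncurry_def, schurKernel]
    have : Measurable fun p : ℂ × ℂ => ‖1 - conj p.2 * p.1‖ :=
      Continuous.measurable (by fun_prop)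
    fun_prop
  have e : ∀ z, ∫⁻ ζ, ENNReal.ofReal (schurKernel z ζ) * l ζ ∂μ =
      ∫⁻ ζ, ENNReal.ofReal (schurKernel z ζ) * hl.mk l ζ ∂μ := fun z => by
    refine lintegral_congr_ae ?_
    filter_upwards [hl.ae_eq_mk] with ζ hζ
    rw [hζ]
  have e' : ∫⁻ ζ, l ζ ^ 2 ∂μ = ∫⁻ ζ, hl.mk l ζ ^ 2 ∂μ := by
    refine lintegral_congr_ae ?_
    filter_upwards [hl.ae_eq_mk] with ζ hζ
    rw [hζ]
  simp only [e, e']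
  rw [ENNReal.ofReal_pow (by positivity)]
  refine lintegral_sq_le_of_schur hk (p := p) (by fun_prop) hl.measurable_mk ?_ ?_ ?_ ?_
  · filter_upwards [hmem] with ζ hζ
    have := one_sub_sq_pos hζ
    simp only [hp, ne_eq, ENNReal.ofReal_eq_zero, not_le]
    positivity
  · exact .of_forall fun ζ => ENNReal.ofReal_ne_top
  · filter_upwards [hmem] with z hz
    calc ∫⁻ ζ, ENNReal.ofReal (schurKernel z ζ) * p ζ ∂μ
        = ∫⁻ ζ, ENNReal.ofReal ((1 - ‖ζ‖ ^ 2) ^ (-(3 / 4) : ℝ) *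
            ‖1 - conj ζ * z‖ ^ (-(7 / 4) : ℝ)) ∂μ := by
          refine lintegral_congr_ae ?_
          filter_upwards [hmem] with ζ hζ
          have hw := one_sub_sq_pos hζ
          simp only [hp, schurKernel]
          rw [← ENNReal.ofReal_mul (by positivity), mul_right_comm, ← Real.rpow_add hw]
          norm_num
      _ ≤ _ := h₁ z hz
      _ ≤ ENNReal.ofReal (max C₁ C₂ * (1 - ‖z‖ ^ 2) ^ (-(1 / 2) : ℝ)) := by
          have hw := one_sub_sq_pos hz
          refine ENNReal.ofReal_le_ofReal ?_
          norm_num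
          gcongr
          exact le_max_left _ _
      _ = _ := ENNReal.ofReal_mul (by positivity)
  · filter_upwards [hmem] with ζ hζ
    have hw := one_sub_sq_pos hζ
    calc ∫⁻ z, ENNReal.ofReal (schurKernel z ζ) * p z ∂μ
        = ∫⁻ z, ENNReal.ofReal ((1 - ‖ζ‖ ^ 2) ^ (-(1 / 4) : ℝ)) *
            ENNReal.ofReal ((1 - ‖z‖ ^ 2) ^ (-(1 / 2) : ℝ) *
            ‖1 - conj z * ζ‖ ^ (-(7 / 4) : ℝ)) ∂μ := by
          refine lintegral_congr_ae ?_
          filter_upwards [hmem] with z hz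
          have hw' := one_sub_sq_pos hz
          simp only [hp, schurKernel]
          rw [← ENNReal.ofReal_mul (by positivity), ← ENNReal.ofReal_mul (by positivity),
            norm_one_sub_conj_mul_comm ζ z]
          congr 1
          ring
      _ = ENNReal.ofReal ((1 - ‖ζ‖ ^ 2) ^ (-(1 / 4) : ℝ)) *
            ∫⁻ z, ENNReal.ofReal ((1 - ‖z‖ ^ 2) ^ (-(1 / 2) : ℝ) *
            ‖1 - conj z * ζ‖ ^ (-(7 / 4) : ℝ)) ∂μ := lintegral_const_mul' _ _ ENNReal.ofReal_ne_top
      _ ≤ ENNReal.ofReal ((1 - ‖ζ‖ ^ 2) ^ (-(1 / 4) : ℝ)) *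
            ENNReal.ofReal (C₂ * (1 - ‖ζ‖ ^ 2) ^ (-(1 / 2) + 1 / 4 : ℝ)) := by
          gcongr
          exact h₂ ζ hζ
      _ ≤ ENNReal.ofReal (max C₁ C₂ * (1 - ‖ζ‖ ^ 2) ^ (-(1 / 2) : ℝ)) := by
          rw [← ENNReal.ofReal_mul (by positivity), mul_left_comm, ← Real.rpow_add hw]
          refine ENNReal.ofReal_le_ofReal ?_
          norm_num
          gcongr
          exact le_max_right _ _
      _ = _ := ENNReal.ofReal_mul (by positivity)

lemma integral_exp_int_mul_I (n m : ℕ) : ∫ θ in (-Real.pi)..Real.pi,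
    exp (((n : ℂ) - m) * I * (θ : ℂ)) = if n = m then (2 * Real.pi : ℂ) else (0 : ℂ) := by
  split_ifs with h
  · subst h
    simp
    ring
  · have hc : ((n : ℂ) - m) * I ≠ 0 :=
      mul_ne_zero (sub_ne_zero.2 (by exact_mod_cast h)) I_ne_zero
    rw [integral_exp_mul_complex hc, div_eq_zero_iff]
    left
    rw [sub_eq_zero, exp_eq_exp_iff_exists_int]
    exact ⟨n - m, by push_cast; ring⟩

lemma integral_norm_sq_tsum_exp {b : ℕ → ℂ} (hb : Summable fun n => ‖b n‖) :
    HasSum (fun n => 2 * Real.pi * ‖b n‖ ^ 2)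
      (∫ θ in (-Real.pi)..Real.pi, ‖∑' n, b n * exp (θ * I) ^ n‖ ^ 2) := by
  have hpi := Real.pi_pos
  have hnorm : ∀ θ : ℝ, Summable fun n => ‖b n * exp (θ * I) ^ n‖ := fun θ => by
    simpa [norm_exp_ofReal_mul_I] using hb
  have hprod : ∀ θ : ℝ, HasSum (fun p : ℕ × ℕ => b p.1 * conj (b p.2) *
      exp (((p.1 : ℂ) - p.2) * I * θ)) ((‖∑' n, b n * exp (θ * I) ^ n‖ ^ 2 : ℝ) : ℂ) := by
    intro θ
    have h1 : Summable fun n => ‖conj (b n * exp (θ * I) ^ n)‖ := by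
      simpa only [norm_conj] using hnorm θ
    have h2 := tsum_mul_tsum_of_summable_norm (hnorm θ) h1
    rw [← conj_tsum, mul_conj'] at h2
    have h3 := (Summable.mul_norm (hnorm θ) h1).of_norm.hasSum
    rw [← h2] at h3
    push_cast
    convert! h3 using 2 with p
    rw [map_mul, map_pow, ← exp_conj]
    have e : exp (((p.1 : ℂ) - p.2) * I * θ) = exp (θ * I) ^ p.1 * exp (conj (θ * I)) ^ p.2 := by
      rw [← exp_nat_mul, ← exp_nat_mul, ← exp_add]
      congr 1
      simp
      ring
    rw [e]
    ring
  set μ : Measure ℝ := volume.restrict (Set.Ioc (-Real.pi) Real.pi) with hμ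
  have hint : ∀ p : ℕ × ℕ, Integrable (fun θ : ℝ => b p.1 * conj (b p.2) *
      exp (((p.1 : ℂ) - p.2) * I * θ)) μ := fun p =>
    (Continuous.integrableOn_Ioc (by fun_prop))
  have hn : ∀ (p : ℕ × ℕ) (θ : ℝ), ‖b p.1 * conj (b p.2) *
      exp (((p.1 : ℂ) - p.2) * I * θ)‖ = ‖b p.1‖ * ‖b p.2‖ := fun p θ => by
    have : ((p.1 : ℂ) - p.2) * I * θ = (((p.1 : ℝ) - p.2) * θ : ℝ) * I := by push_cast; ring
    rw [norm_mul, norm_mul, this, norm_exp_ofReal_mul_I, norm_conj, mul_one]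
  have hs := hasSum_integral_of_summable_integral_norm hint (by
    simp only [hn, integral_const]
    have := Summable.mul_norm (f := b) (g := b) hb hb
    simp only [norm_mul] at this
    exact this.const_smul _)
  rw [integral_congr_ae (.of_forall fun θ => (hprod θ).tsum_eq), integral_complex_ofReal] at hs
  simp only [hμ, ← intervalIntegral.integral_of_le (by linarith : -Real.pi ≤ Real.pi),
    intervalIntegral.integral_const_mul, integral_exp_int_mul_I] at hs
  have hinj : Function.Injective fun n : ℕ => (n, n) := fun a b h => (Prod.ext_iff.1 h).1
  rw [← hinj.hasSum_iff] at hs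
  · rw [← Complex.hasSum_ofReal]
    convert! hs using 2 with n
    simp [mul_conj']
    ring
  · rintro ⟨n, m⟩ h
    have : n ≠ m := fun h' => h ⟨n, by simp [h']⟩
    simp [this]

lemma hasSum_dirCoeff {f : ℂ → ℂ} (hf : DifferentiableOn ℂ f (ball 0 1)) {z : ℂ}
    (hz : z ∈ ball (0 : ℂ) 1) : HasSum (fun n => dirCoeff f n * z ^ n) (f z) := by
  convert! Complex.hasSum_taylorSeries_on_ball hf hz using 2 with n
  simp only [dirCoeff, sub_zero, smul_eq_mul]
  ring

lemma summable_norm_dirCoeff {f : ℂ → ℂ} (hf : DifferentiableOn ℂ f (ball 0 1)) {r : ℝ}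
    (hr0 : 0 ≤ r) (hr1 : r < 1) : Summable fun n => ‖dirCoeff f n * (r : ℂ) ^ n‖ := by
  have hz : (r : ℂ) ∈ ball (0 : ℂ) 1 := by
    rwa [mem_ball_zero_iff, norm_real, Real.norm_of_nonneg hr0]
  exact (hasSum_dirCoeff hf hz).summable.norm

lemma lintegral_circle_sq_eq_tsum {f : ℂ → ℂ} (hf : DifferentiableOn ℂ f (ball 0 1)) {r : ℝ}
    (hr : r ∈ Set.Ioo (0 : ℝ) 1) : ∫⁻ θ in Set.Ioo (-Real.pi) Real.pi,
      ENNReal.ofReal r * ‖f (r * exp (θ * I))‖ₑ ^ 2 =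
      ∑' n : ℕ, ENNReal.ofReal (2 * Real.pi * ‖dirCoeff f n‖ ^ 2 * r ^ (2 * n + 1)) := by
  have hpi := Real.pi_pos
  have hs := summable_norm_dirCoeff hf hr.1.le hr.2
  have hp := integral_norm_sq_tsum_exp hs
  have hz : ∀ θ : ℝ, (r : ℂ) * exp (θ * I) ∈ ball (0 : ℂ) 1 := fun θ => by
    rw [mem_ball_zero_iff, norm_mul, norm_exp_ofReal_mul_I, norm_real,
      Real.norm_of_nonneg hr.1.le, mul_one]
    exact hr.2
  have e : ∀ θ : ℝ, ∑' n, dirCoeff f n * (r : ℂ) ^ n * exp (θ * I) ^ n =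
      f (r * exp (θ * I)) := fun θ => by
    rw [← (hasSum_dirCoeff hf (hz θ)).tsum_eq]
    simp only [mul_pow, mul_assoc]
  simp only [e] at hp
  have hcθ : Continuous fun θ : ℝ => f (r * exp (θ * I)) := by
    refine hf.continuousOn.comp_continuous (by fun_prop) hz
  rw [intervalIntegral.integral_of_le (by linarith)] at hp
  have hp2 := hp.mul_left r
  rw [restrict_Ioo_eq_restrict_Ioc, lintegral_const_mul' _ _ ENNReal.ofReal_ne_top]
  have e2 : ∀ θ : ℝ, ‖f (r * exp (θ * I))‖ₑ ^ 2 =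
      ENNReal.ofReal (‖f (r * exp (θ * I))‖ ^ 2) := fun θ => by
    rw [ENNReal.ofReal_pow (norm_nonneg _), ofReal_norm]
  simp only [e2]
  have hci : Continuous fun θ : ℝ => ‖f (r * exp (θ * I))‖ ^ 2 :=
    hcθ.norm.pow 2
  rw [← ofReal_integral_eq_lintegral_ofReal hci.integrableOn_Ioc
    (.of_forall fun θ => by positivity), ← ENNReal.ofReal_mul hr.1.le, ← hp2.tsum_eq,
    ENNReal.ofReal_tsum_of_nonneg (fun n => by have := hr.1; positivity) hp2.summable]
  refine tsum_congr fun n => ?_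
  congr 1
  rw [norm_mul, norm_pow, norm_real, Real.norm_of_nonneg hr.1.le]
  ring

/-- The Bergman norm in terms of Taylor coefficients. -/
lemma lintegral_sq_eq_tsum {f : ℂ → ℂ} (hf : DifferentiableOn ℂ f (ball 0 1)) :
    ∫⁻ z in ball (0 : ℂ) 1, ‖f z‖ₑ ^ 2 =
      ∑' n : ℕ, ENNReal.ofReal (Real.pi / (n + 1) * ‖dirCoeff f n‖ ^ 2) := by
  have hpi := Real.pi_pos
  rw [← lintegral_indicator measurableSet_ball, ← Complex.lintegral_comp_polarCoord_symm,
    polarCoord_target]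
  have hpt : ∀ p ∈ Set.Ioi (0 : ℝ) ×ˢ Set.Ioo (-Real.pi) Real.pi,
      ENNReal.ofReal p.1 • (ball (0 : ℂ) 1).indicator (fun z => ‖f z‖ₑ ^ 2)
        (Complex.polarCoord.symm p) =
      (Set.Ioo (0 : ℝ) 1 ×ˢ Set.univ).indicator
        (fun p : ℝ × ℝ => ENNReal.ofReal p.1 * ‖f (p.1 * exp (p.2 * I))‖ₑ ^ 2) p := by
    rintro ⟨r, θ⟩ ⟨hr, hθ⟩
    have hr0 : 0 < r := hr
    rw [Complex.polarCoord_symm_apply, ofReal_cos, ofReal_sin, ← exp_mul_I]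
    have hn : ‖(r : ℂ) * exp (θ * I)‖ = r := by
      rw [norm_mul, norm_exp_ofReal_mul_I, norm_real, Real.norm_of_nonneg hr0.le, mul_one]
    by_cases hr1 : r < 1
    · have hm : (r : ℂ) * exp (θ * I) ∈ ball (0 : ℂ) 1 := by rwa [mem_ball_zero_iff, hn]
      have hm' : (r, θ) ∈ Set.Ioo (0 : ℝ) 1 ×ˢ (Set.univ : Set ℝ) := ⟨⟨hr0, hr1⟩, trivial⟩
      rw [Set.indicator_of_mem hm, Set.indicator_of_mem hm', smul_eq_mul]
    · have hm : (r : ℂ) * exp (θ * I) ∉ ball (0 : ℂ) 1 := by rwa [mem_ball_zero_iff, hn]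
      have hm' : (r, θ) ∉ Set.Ioo (0 : ℝ) 1 ×ˢ (Set.univ : Set ℝ) := fun h => hr1 h.1.2
      rw [Set.indicator_of_notMem hm, Set.indicator_of_notMem hm', smul_zero]
  have hms : MeasurableSet (Set.Ioo (0 : ℝ) 1 ×ˢ (Set.univ : Set ℝ)) :=
    measurableSet_Ioo.prod .univ
  rw [setLIntegral_congr_fun (measurableSet_Ioi.prod measurableSet_Ioo) hpt,
    setLIntegral_indicator hms, Set.prod_inter_prod, Set.univ_inter,
    Set.inter_eq_left.2 Set.Ioo_subset_Ioi_self, Measure.volume_eq_prod, ← Measure.prod_restrict]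
  have hc : ContinuousOn (fun p : ℝ × ℝ => f (p.1 * exp (p.2 * I)))
      (Set.Ioo 0 1 ×ˢ Set.Ioo (-Real.pi) Real.pi) := by
    refine hf.continuousOn.comp (by fun_prop) ?_
    rintro ⟨r, θ⟩ ⟨hr, hθ⟩
    rw [mem_ball_zero_iff, norm_mul, norm_exp_ofReal_mul_I, norm_real,
      Real.norm_of_nonneg hr.1.le, mul_one]
    exact hr.2
  have hmeas : AEMeasurable (fun p : ℝ × ℝ => ENNReal.ofReal p.1 *
      ‖f (p.1 * exp (p.2 * I))‖ₑ ^ 2) ((volume.restrict (Set.Ioo 0 1)).prod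
      (volume.restrict (Set.Ioo (-Real.pi) Real.pi))) := by
    rw [Measure.prod_restrict]
    have h1 : AEMeasurable (fun p : ℝ × ℝ => f (p.1 * exp (p.2 * I))) ((volume.prod volume).restrict
        (Set.Ioo 0 1 ×ˢ Set.Ioo (-Real.pi) Real.pi)) :=
      hc.aemeasurable (measurableSet_Ioo.prod measurableSet_Ioo)
    have h2 : AEMeasurable (fun p : ℝ × ℝ => ENNReal.ofReal p.1) ((volume.prod volume).restrict
        (Set.Ioo 0 1 ×ˢ Set.Ioo (-Real.pi) Real.pi)) :=
      (ENNReal.measurable_ofReal.comp measurable_fst).aemeasurable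
    exact h2.mul (h1.enorm.pow_const 2)
  rw [lintegral_prod _ hmeas]
  rw [setLIntegral_congr_fun measurableSet_Ioo fun r hr =>
    lintegral_circle_sq_eq_tsum hf hr, lintegral_tsum (by fun_prop)]
  refine tsum_congr fun n => ?_
  have hci : Continuous fun r : ℝ => 2 * Real.pi * ‖dirCoeff f n‖ ^ 2 * r ^ (2 * n + 1) := by
    fun_prop
  rw [restrict_Ioo_eq_restrict_Ioc, ← ofReal_integral_eq_lintegral_ofReal hci.integrableOn_Ioc]
  · congr 1
    rw [← intervalIntegral.integral_of_le zero_le_one, intervalIntegral.integral_const_mul,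
      integral_pow]
    push_cast
    field_simp
    ring
  · filter_upwards [ae_restrict_mem measurableSet_Ioc] with r hr
    have := hr.1
    positivity

lemma dirCoeff_zero (f : ℂ → ℂ) : dirCoeff f 0 = f 0 := by simp [dirCoeff]

lemma dirCoeff_deriv (f : ℂ → ℂ) (n : ℕ) :
    dirCoeff (deriv f) n = (n + 1) * dirCoeff f (n + 1) := by
  have : ((n : ℂ) + 1) ≠ 0 := by exact_mod_cast n.succ_ne_zero
  have h2 : ((n.factorial : ℕ) : ℂ) ≠ 0 := by exact_mod_cast n.factorial_ne_zero
  simp only [dirCoeff, iteratedDeriv_succ', Nat.factorial_succ]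
  push_cast
  field_simp

lemma lintegral_deriv_sq_eq_tsum {f : ℂ → ℂ} (hf : DifferentiableOn ℂ f (ball 0 1)) :
    ∫⁻ z in ball (0 : ℂ) 1, ‖deriv f z‖ₑ ^ 2 =
      ∑' n : ℕ, ENNReal.ofReal (Real.pi * ((n + 1) * ‖dirCoeff f (n + 1)‖ ^ 2)) := by
  rw [lintegral_sq_eq_tsum (hf.deriv isOpen_ball)]
  refine tsum_congr fun n => ?_
  have hn : (0 : ℝ) < n + 1 := by positivity
  have e : ‖(n + 1 : ℂ)‖ = n + 1 := by
    have : (n + 1 : ℂ) = ((n + 1 : ℝ) : ℂ) := by push_cast; ring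
    rw [this, norm_real, Real.norm_of_nonneg hn.le]
  rw [dirCoeff_deriv, norm_mul, e]
  congr 1
  field_simp

lemma lintegral_sq_le_dirNormSq {f : ℂ → ℂ} (hf : MemDirichlet f) :
    ∫⁻ z in ball (0 : ℂ) 1, ‖f z‖ₑ ^ 2 ≤ ENNReal.ofReal (Real.pi * dirNormSq f) := by
  have hpi := Real.pi_pos
  rw [lintegral_sq_eq_tsum hf.1, dirNormSq, ← tsum_mul_left,
    ENNReal.ofReal_tsum_of_nonneg (fun n => by positivity) (hf.2.mul_left _)]
  refine ENNReal.tsum_le_tsum fun n => ENNReal.ofReal_le_ofReal ?_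
  have h1 : Real.pi / (n + 1) ≤ Real.pi := div_le_self hpi.le (by linarith [n.cast_nonneg (α := ℝ)])
  calc Real.pi / (n + 1) * ‖dirCoeff f n‖ ^ 2 ≤ Real.pi * ‖dirCoeff f n‖ ^ 2 := by gcongr
    _ ≤ Real.pi * ((n + 1) * ‖dirCoeff f n‖ ^ 2) := by
      gcongr
      exact le_mul_of_one_le_left (by positivity) (by linarith [n.cast_nonneg (α := ℝ)])

lemma lintegral_deriv_sq_le_dirNormSq {f : ℂ → ℂ} (hf : MemDirichlet f) :
    ∫⁻ z in ball (0 : ℂ) 1, ‖deriv f z‖ₑ ^ 2 ≤ ENNReal.ofReal (Real.pi * dirNormSq f) := by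
  have hpi := Real.pi_pos
  rw [lintegral_deriv_sq_eq_tsum hf.1, dirNormSq, ← tsum_mul_left,
    ENNReal.ofReal_tsum_of_nonneg (fun n => by positivity) (hf.2.mul_left _)]
  refine le_trans (ENNReal.tsum_le_tsum fun n => ENNReal.ofReal_le_ofReal ?_)
    (ENNReal.tsum_comp_le_tsum_of_injective Nat.succ_injective
      fun n : ℕ => ENNReal.ofReal (Real.pi * ((n + 1) * ‖dirCoeff f n‖ ^ 2)))
  rw [Nat.succ_eq_add_one]
  push_cast
  gcongr
  linarith

lemma tsum_ofReal_dirCoeff_le {f : ℂ → ℂ} (hf : DifferentiableOn ℂ f (ball 0 1)) :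
    ∑' n : ℕ, ENNReal.ofReal ((n + 1) * ‖dirCoeff f n‖ ^ 2) ≤
      ‖f 0‖ₑ ^ 2 + ∫⁻ z in ball (0 : ℂ) 1, ‖deriv f z‖ₑ ^ 2 := by
  have hpi := Real.pi_gt_three
  rw [lintegral_deriv_sq_eq_tsum hf, tsum_eq_zero_add' ENNReal.summable]
  refine add_le_add ?_ (ENNReal.tsum_le_tsum fun n => ENNReal.ofReal_le_ofReal ?_)
  · simp [dirCoeff_zero, ENNReal.ofReal_pow]
  · rw [← mul_assoc]
    gcongr
    push_cast
    nlinarith [n.cast_nonneg (α := ℝ)]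

lemma tsum_ofReal_dirCoeff_eq {f : ℂ → ℂ} (hf : MemDirichlet f) :
    ∑' n : ℕ, ENNReal.ofReal ((n + 1) * ‖dirCoeff f n‖ ^ 2) = ENNReal.ofReal (dirNormSq f) := by
  rw [dirNormSq, ENNReal.ofReal_tsum_of_nonneg (fun n => by positivity) hf.2]

lemma dirNormSq_nonneg (f : ℂ → ℂ) : 0 ≤ dirNormSq f := tsum_nonneg fun n => by positivity

lemma memDirichlet_of_tsum_ne_top {f : ℂ → ℂ} (hf : DifferentiableOn ℂ f (ball 0 1))
    (h : ∑' n : ℕ, ENNReal.ofReal ((n + 1) * ‖dirCoeff f n‖ ^ 2) ≠ ∞) : MemDirichlet f := by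
  refine ⟨hf, ?_⟩
  have := ENNReal.summable_toReal h
  refine this.congr fun n => ENNReal.toReal_ofReal (by positivity)

lemma dirCoeff_eq_of_hasSum {f : ℂ → ℂ} (hf : DifferentiableOn ℂ f (ball 0 1)) {c : ℕ → ℂ}
    (hc : ∀ z ∈ ball (0 : ℂ) 1, HasSum (fun n => c n * z ^ n) (f z)) : dirCoeff f = c := by
  have key : ∀ c' : ℕ → ℂ, (∀ z ∈ ball (0 : ℂ) 1, HasSum (fun n => c' n * z ^ n) (f z)) →
      HasFPowerSeriesAt f (FormalMultilinearSeries.ofScalars ℂ c') 0 := fun c' h => by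
    rw [hasFPowerSeriesAt_iff]
    filter_upwards [ball_mem_nhds (0 : ℂ) one_pos] with z hz
    simpa [FormalMultilinearSeries.coeff_ofScalars, mul_comm] using h z hz
  have h := (key _ fun z hz => hasSum_dirCoeff hf hz).eq_formalMultilinearSeries (key c hc)
  ext n
  have := congrArg (fun p => FormalMultilinearSeries.coeff p n) h
  simpa [FormalMultilinearSeries.coeff_ofScalars] using this

lemma hasSum_of_bounded_coeff {c : ℕ → ℂ} {C : ℝ} (hc : ∀ n, ‖c n‖ ≤ C) {z : ℂ}
    (hz : z ∈ ball (0 : ℂ) 1) : HasSum (fun n => c n * z ^ n) (∑' n, c n * z ^ n) := by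
  refine Summable.hasSum (.of_norm_bounded (g := fun n => C * ‖z‖ ^ n)
    ((summable_geometric_of_lt_one (norm_nonneg z) (mem_ball_zero_iff.1 hz)).mul_left C)
    fun n => ?_)
  rw [norm_mul, norm_pow]
  gcongr
  exact hc n

lemma differentiableOn_of_bounded_coeff {c : ℕ → ℂ} {C : ℝ} (hc : ∀ n, ‖c n‖ ≤ C) :
    DifferentiableOn ℂ (fun z => ∑' n, c n * z ^ n) (ball 0 1) := by
  intro z hz
  obtain ⟨r, hzr, hr1⟩ := exists_between (mem_ball_zero_iff.1 hz)
  have hr0 : 0 ≤ r := (norm_nonneg z).trans hzr.le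
  have h : DifferentiableOn ℂ (fun z => ∑' n, c n * z ^ n) (ball 0 r) := by
    refine differentiableOn_tsum_of_summable_norm (u := fun n => C * r ^ n)
      ((summable_geometric_of_lt_one hr0 hr1).mul_left C) (fun n => by fun_prop) isOpen_ball ?_
    intro n w hw
    have hC : 0 ≤ C := (norm_nonneg _).trans (hc n)
    rw [norm_mul, norm_pow]
    gcongr
    · exact hc n
    · exact (mem_ball_zero_iff.1 hw).le
  have hz' : z ∈ ball (0 : ℂ) r := mem_ball_zero_iff.2 hzr
  exact ((h z hz').differentiableAt (isOpen_ball.mem_nhds hz')).differentiableWithinAt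

/-- The reciprocal `(1 - ζ̄ z)⁻¹`. -/
noncomputable def szego (z ζ : ℂ) : ℂ := (1 - conj ζ * z)⁻¹

lemma norm_szego (z ζ : ℂ) : ‖szego z ζ‖ = ‖1 - conj ζ * z‖⁻¹ := norm_inv _

lemma szego_mul {z ζ : ℂ} (hz : z ∈ ball (0 : ℂ) 1) (hζ : ζ ∈ ball (0 : ℂ) 1) :
    szego z ζ * (1 - conj ζ * z) = 1 :=
  inv_mul_cancel₀ (one_sub_conj_mul_ne_zero hz hζ)

lemma one_sub_norm_le_norm_one_sub {z ζ : ℂ} (hζ : ζ ∈ ball (0 : ℂ) 1) :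
    1 - ‖z‖ ≤ ‖1 - conj ζ * z‖ := by
  rw [← norm_one_sub_conj_mul_comm]
  exact one_sub_norm_le_norm_one_sub_conj_mul hζ

lemma norm_szego_le {z ζ : ℂ} (hz : z ∈ ball (0 : ℂ) 1) (hζ : ζ ∈ ball (0 : ℂ) 1) :
    ‖szego z ζ‖ ≤ (1 - ‖z‖)⁻¹ := by
  have := mem_ball_zero_iff.1 hz
  rw [norm_szego]
  exact inv_anti₀ (by linarith) (one_sub_norm_le_norm_one_sub hζ)

lemma tame_szego {z : ℂ} (hz : z ∈ ball (0 : ℂ) 1) :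
    Tame (szego z) (fun _ => 0) (fun ζ => z * szego z ζ ^ 2) := by
  have h1 := ((tame_const (-z)).smul tame_id.conj).add_const 1
  have hpos : 0 < 1 - ‖z‖ := by linarith [mem_ball_zero_iff.1 hz]
  have h2 := h1.inv hpos (fun ζ hζ => by
    have := one_sub_norm_le_norm_one_sub (z := z) hζ
    convert this using 2
    simp only [smul_eq_mul]
    ring)
  refine h2.congr (fun ζ => ?_) (fun ζ => ?_) (fun ζ => ?_) <;>
    simp only [szego, smul_eq_mul, map_zero, map_one]
  · congr 1; ring
  · simp
  · rw [inv_pow]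
    have e : (-z * conj ζ + 1) = 1 - conj ζ * z := by ring
    rw [e]
    ring

lemma tame_szego_pow {z : ℂ} (hz : z ∈ ball (0 : ℂ) 1) (n : ℕ) :
    Tame (fun ζ => szego z ζ ^ n) (fun _ => 0) (fun ζ => n * z * szego z ζ ^ (n + 1)) := by
  induction n with
  | zero => simpa using tame_const (1 : ℂ)
  | succ n ih =>
    refine (ih.smul (tame_szego hz)).congr (fun ζ => ?_) (fun ζ => ?_) (fun ζ => ?_) <;>
      simp only [smul_eq_mul]
    · ring
    · ring
    · push_cast; ring

lemma continuousOn_szego {z : ℂ} (hz : z ∈ ball (0 : ℂ) 1) : ContinuousOn (szego z) (ball 0 1) :=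
  (tame_szego hz).continuousOn

lemma continuous_diskWeight : Continuous diskWeight := by
  unfold diskWeight
  fun_prop

lemma norm_diskWeight_le {ζ : ℂ} (hζ : ζ ∈ ball (0 : ℂ) 1) : ‖diskWeight ζ‖ ≤ 1 := by
  rw [norm_diskWeight hζ]
  nlinarith [norm_nonneg ζ]

lemma szego_diskWeight_identity {z ζ : ℂ} (hz : z ∈ ball (0 : ℂ) 1) (hζ : ζ ∈ ball (0 : ℂ) 1) :
    diskWeight ζ ^ 2 * (2 * z * szego z ζ ^ 3) - 2 * diskWeight ζ * ζ * szego z ζ ^ 2 =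
      2 * diskWeight ζ * szego z ζ ^ 3 * (z - ζ) := by
  have h := szego_mul hz hζ
  have : szego z ζ ^ 2 = szego z ζ ^ 3 * (1 - conj ζ * z) := by
    linear_combination -szego z ζ ^ 2 * h
  rw [this, diskWeight]
  ring

section Reproducing

variable {V : Type*} [NormedAddCommGroup V] [NormedSpace ℂ V]

lemma sub_smul_dslope' (f : ℂ → V) (z ζ : ℂ) : (ζ - z) • dslope f z ζ = f ζ - f z :=
  sub_smul_dslope f z ζ

lemma continuousOn_dslope_ball [CompleteSpace V] {f : ℂ → V}
    (hf : DifferentiableOn ℂ f (ball 0 1)) {z : ℂ}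
    (hz : z ∈ ball (0 : ℂ) 1) : ContinuousOn (dslope f z) (ball 0 1) :=
  (differentiableOn_dslope_ball hf hz).continuousOn

lemma norm_dslope_le_of_bound {F : ℂ → V} (hF : DifferentiableOn ℂ F (ball 0 1)) {M : ℝ}
    (hM : ∀ z ∈ ball (0 : ℂ) 1, ‖F z‖ ≤ M) {z ζ : ℂ} (hz : z ∈ ball (0 : ℂ) 1)
    (hζ : ζ ∈ ball (0 : ℂ) 1) : ‖dslope F z ζ‖ ≤ 2 * M * ‖szego z ζ‖ := by
  rw [norm_szego, ← div_eq_mul_inv]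
  exact norm_dslope_le hF hM hz hζ

lemma tame_dslope [CompleteSpace V] {F : ℂ → V} (hF : DifferentiableOn ℂ F (ball 0 1)) {M : ℝ}
    (hM : ∀ z ∈ ball (0 : ℂ) 1, ‖F z‖ ≤ M) {z : ℂ} (hz : z ∈ ball (0 : ℂ) 1) :
    Tame (dslope F z) (deriv (dslope F z)) (fun _ => 0) :=
  tame_of_differentiableOn (differentiableOn_dslope_ball hF hz) fun ζ hζ =>
    (norm_dslope_le_of_bound hF hM hz hζ).trans
      (mul_le_mul_of_nonneg_left (norm_szego_le hz hζ)
        (by have := (norm_nonneg _).trans (hM z hz); positivity))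

lemma integral_bergman_sub {g : ℂ → ℂ} (hg : DifferentiableOn ℂ g (ball 0 1)) {M : ℝ}
    (hM : ∀ z ∈ ball (0 : ℂ) 1, ‖g z‖ ≤ M) {z : ℂ} (hz : z ∈ ball (0 : ℂ) 1) :
    ∫ ζ in ball (0 : ℂ) 1, 2 * diskWeight ζ * szego z ζ ^ 3 * (g ζ - g z) = 0 := by
  have h := ((tame_szego_pow hz 2).smul (tame_dslope hg hM hz)).integral_eq_zero.2
  rw [← neg_eq_zero, ← integral_neg]
  refine (setIntegral_congr_fun measurableSet_ball fun ζ hζ => ?_).trans h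
  have e := szego_diskWeight_identity hz hζ
  have e2 := sub_smul_dslope' g z ζ
  simp only [smul_eq_mul, mul_zero, zero_add] at e2 ⊢
  push_cast
  linear_combination (2 * diskWeight ζ * szego z ζ ^ 3) * e2 - dslope g z ζ * e

/-- The total mass of the weight `2 (1 - |ζ|²)` on the disk. -/
noncomputable def diskMass : ℝ := ∫ ζ in ball (0 : ℂ) 1, 2 * (1 - ‖ζ‖ ^ 2)

lemma diskMass_pos : 0 < diskMass := by
  unfold diskMass
  rw [integral_pos_iff_support_of_nonneg_ae]
  · refine lt_of_lt_of_le (measure_ball_pos volume (0 : ℂ) one_pos) ?_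
    rw [Measure.restrict_apply' measurableSet_ball]
    refine measure_mono fun ζ hζ => ⟨?_, hζ⟩
    have := one_sub_sq_pos hζ
    simp only [Function.mem_support]
    positivity
  · filter_upwards [ae_restrict_mem measurableSet_ball] with ζ hζ
    have := one_sub_sq_pos hζ
    simp only [Pi.zero_apply]
    positivity
  · refine integrableOn_ball_of_bounded (by fun_prop) (M := 2) fun ζ hζ => ?_
    have := one_sub_sq_pos hζ
    rw [Real.norm_of_nonneg (by positivity)]
    nlinarith [norm_nonneg ζ]

lemma integral_two_mul_diskWeight : ∫ ζ in ball (0 : ℂ) 1, 2 * diskWeight ζ = (diskMass : ℂ) := by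
  rw [diskMass, ← integral_complex_ofReal]
  refine integral_congr_ae (.of_forall fun ζ => ?_)
  simp only [diskWeight_eq]
  push_cast
  ring

lemma integrableOn_szego_mul {X : ℂ → V} (hX : ContinuousOn X (ball 0 1)) {M : ℝ}
    (hM : ∀ ζ ∈ ball (0 : ℂ) 1, ‖X ζ‖ ≤ M) {z : ℂ} (hz : z ∈ ball (0 : ℂ) 1) (n m : ℕ) :
    IntegrableOn (fun ζ => (2 * diskWeight ζ ^ m * szego z ζ ^ n) • X ζ) (ball 0 1) := by
  have h1 := continuousOn_szego hz
  have h2 := continuous_diskWeight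
  have hp : 0 < 1 - ‖z‖ := by linarith [mem_ball_zero_iff.1 hz]
  refine integrableOn_ball_of_bounded (by fun_prop) (M := 2 * (1 ^ m) * (1 - ‖z‖)⁻¹ ^ n * M)
    fun ζ hζ => ?_
  rw [norm_smul, norm_mul, norm_mul, norm_pow, norm_pow, RCLike.norm_ofNat]
  gcongr
  · exact norm_diskWeight_le hζ
  · exact norm_szego_le hz hζ
  · exact hM ζ hζ

lemma integral_bergman {z : ℂ} (hz : z ∈ ball (0 : ℂ) 1) :
    ∫ ζ in ball (0 : ℂ) 1, 2 * diskWeight ζ * szego z ζ ^ 3 = (diskMass : ℂ) := by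
  have h0 : (0 : ℂ) ∈ ball (0 : ℂ) 1 := by simp
  have hne : ∀ ζ ∈ ball (0 : ℂ) 1, (1 - conj z * ζ) ^ 3 ≠ 0 := fun ζ hζ =>
    pow_ne_zero _ (one_sub_conj_mul_ne_zero hζ hz)
  have hd : DifferentiableOn ℂ (fun ζ => ((1 - conj z * ζ) ^ 3)⁻¹) (ball 0 1) := by
    fun_prop (disch := assumption)
  have hb : ∀ ζ ∈ ball (0 : ℂ) 1, ‖((1 - conj z * ζ) ^ 3)⁻¹‖ ≤ (1 - ‖z‖)⁻¹ ^ 3 := fun ζ hζ => by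
    rw [norm_inv, norm_pow, norm_one_sub_conj_mul_comm, ← inv_pow, ← norm_szego]
    gcongr
    exact norm_szego_le hz hζ
  have h := integral_bergman_sub hd hb h0
  have hi1 := integrableOn_szego_mul hd.continuousOn hb h0 0 1
  have hi2 : IntegrableOn (fun ζ => 2 * diskWeight ζ) (ball 0 1) :=
    integrableOn_ball_of_bounded (continuous_const.mul continuous_diskWeight).continuousOn (M := 2)
      fun ζ hζ => by
        rw [norm_mul, RCLike.norm_ofNat]
        linarith [norm_diskWeight_le hζ]
  simp only [pow_one, pow_zero, mul_one, smul_eq_mul] at hi1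
  have e1 : ∫ ζ in ball (0 : ℂ) 1, 2 * diskWeight ζ * ((1 - conj z * ζ) ^ 3)⁻¹ = diskMass := by
    rw [← integral_two_mul_diskWeight, ← sub_eq_zero, ← integral_sub hi1 hi2]
    refine (integral_congr_ae (.of_forall fun ζ => ?_)).trans h
    simp [szego]
    ring
  have e2 := congrArg conj e1
  rw [conj_ofReal, ← integral_conj] at e2
  rw [← e2]
  refine integral_congr_ae (.of_forall fun ζ => ?_)
  simp only [szego, diskWeight, map_mul, map_sub, map_one, map_inv₀, map_pow, conj_conj, map_ofNat,
    inv_pow]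
  rw [mul_comm ζ, mul_comm z]

/-- The reproducing formula for the weighted Bergman kernel. -/
lemma integral_bergman_mul {g : ℂ → ℂ} (hg : DifferentiableOn ℂ g (ball 0 1)) {M : ℝ}
    (hM : ∀ z ∈ ball (0 : ℂ) 1, ‖g z‖ ≤ M) {z : ℂ} (hz : z ∈ ball (0 : ℂ) 1) :
    ∫ ζ in ball (0 : ℂ) 1, 2 * diskWeight ζ * szego z ζ ^ 3 * g ζ = diskMass * g z := by
  have h := integral_bergman_sub hg hM hz
  have hi1 := integrableOn_szego_mul hg.continuousOn hM hz 3 1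
  have hi2 := integrableOn_szego_mul (continuousOn_const (c := g z)) (fun _ _ => le_rfl) hz 3 1
  simp only [pow_one, smul_eq_mul] at hi1 hi2
  rw [← integral_bergman hz, ← integral_mul_const, ← sub_eq_zero, ← integral_sub hi1 hi2]
  refine (integral_congr_ae (.of_forall fun ζ => ?_)).trans h
  ring

end Reproducing

section Corona

set_option maxSynthPendingDepth 3

variable {E : Type*} [NormedAddCommGroup E] [InnerProductSpace ℂ E]

/-- The regularized squared norm `‖F‖² + ε²`. -/
noncomputable def regNormSq (F : ℂ → E) (ε : ℝ) (ζ : ℂ) : ℂ :=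
  innerSL ℂ (F ζ) (F ζ) + ((ε ^ 2 : ℝ) : ℂ)

/-- The smooth functional `g ⟪F, ·⟫ / (‖F‖² + ε²)`. -/
noncomputable def smoothSol (F : ℂ → E) (g : ℂ → ℂ) (ε : ℝ) (ζ : ℂ) : E →L[ℂ] ℂ :=
  (g ζ * (regNormSq F ε ζ)⁻¹) • innerSL ℂ (F ζ)

/-- The `∂`-derivative of `smoothSol`. -/
noncomputable def smoothSolDeriv (F : ℂ → E) (g : ℂ → ℂ) (ε : ℝ) (ζ : ℂ) : E →L[ℂ] ℂ :=
  (deriv g ζ * (regNormSq F ε ζ)⁻¹ -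
    g ζ * (innerSL ℂ (F ζ) (deriv F ζ) * ((regNormSq F ε ζ)⁻¹) ^ 2)) • innerSL ℂ (F ζ)

/-- The alternating Koszul correction. -/
noncomputable def koszul (F : ℂ → E) (g : ℂ → ℂ) (ε : ℝ) (ζ : ℂ) : E →L[ℂ] E →L[ℂ] ℂ :=
  (g ζ * ((regNormSq F ε ζ)⁻¹) ^ 2) •
    ((innerSL ℂ (deriv F ζ)).smulRight (innerSL ℂ (F ζ)) -
      (innerSL ℂ (F ζ)).smulRight (innerSL ℂ (deriv F ζ)))

lemma koszul_apply (F : ℂ → E) (g : ℂ → ℂ) (ε : ℝ) (ζ : ℂ) (x y : E) :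
    koszul F g ε ζ x y = g ζ * ((regNormSq F ε ζ)⁻¹) ^ 2 *
      (innerSL ℂ (deriv F ζ) x * innerSL ℂ (F ζ) y -
        innerSL ℂ (F ζ) x * innerSL ℂ (deriv F ζ) y) := by
  simp [koszul]

lemma regNormSq_eq (F : ℂ → E) (ε : ℝ) (ζ : ℂ) :
    regNormSq F ε ζ = ((‖F ζ‖ ^ 2 + ε ^ 2 : ℝ) : ℂ) := by
  rw [regNormSq, innerSL_apply_apply, inner_self_eq_norm_sq_to_K]
  push_cast
  rfl

lemma norm_regNormSq (F : ℂ → E) (ε : ℝ) (ζ : ℂ) :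
    ‖regNormSq F ε ζ‖ = ‖F ζ‖ ^ 2 + ε ^ 2 := by
  rw [regNormSq_eq, norm_real, Real.norm_of_nonneg (by positivity)]

lemma regNormSq_ne_zero (F : ℂ → E) {ε : ℝ} (hε : 0 < ε) (ζ : ℂ) : regNormSq F ε ζ ≠ 0 := by
  rw [← norm_pos_iff, norm_regNormSq]
  positivity

/-- The hypotheses on corona data `F`, right hand side `g` and controlling weight `l`. -/
structure Admissible (F : ℂ → E) (g : ℂ → ℂ) (l : ℂ → ℝ) : Prop where
  differentiableOn : DifferentiableOn ℂ F (ball 0 1)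
  norm_le : ∀ ζ ∈ ball (0 : ℂ) 1, ‖F ζ‖ ≤ 1
  differentiableOn_rhs : DifferentiableOn ℂ g (ball 0 1)
  rhs_bounded : ∃ M, ∀ ζ ∈ ball (0 : ℂ) 1, ‖g ζ‖ ≤ M
  nonneg : ∀ ζ ∈ ball (0 : ℂ) 1, 0 ≤ l ζ
  integrableOn : IntegrableOn l (ball 0 1)
  norm_rhs_le : ∀ ζ ∈ ball (0 : ℂ) 1, ‖g ζ‖ ≤ ‖F ζ‖ ^ 3 * l ζ
  norm_rhs_mul_le : ∀ ζ ∈ ball (0 : ℂ) 1, ‖g ζ‖ * ‖deriv F ζ‖ ≤ ‖F ζ‖ ^ 3 * l ζ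
  norm_deriv_rhs_le : ∀ ζ ∈ ball (0 : ℂ) 1, ‖deriv g ζ‖ ≤ 3 * ‖F ζ‖ ^ 2 * l ζ

variable {F : ℂ → E} {g : ℂ → ℂ} {l : ℂ → ℝ} {ε : ℝ}

lemma pow_mul_inv_le_one (t : ℝ) (hε : 0 < ε) : t ^ 2 * (t ^ 2 + ε ^ 2)⁻¹ ≤ 1 := by
  rw [← div_eq_mul_inv, div_le_one (by positivity)]
  nlinarith

lemma Admissible.norm_smoothSol_le (h : Admissible F g l) (hε : 0 < ε) {ζ : ℂ}
    (hζ : ζ ∈ ball (0 : ℂ) 1) : ‖smoothSol F g ε ζ‖ ≤ l ζ := by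
  have h1 := h.norm_rhs_le ζ hζ
  have h2 := h.norm_le ζ hζ
  have h3 := h.nonneg ζ hζ
  have h4 := pow_mul_inv_le_one ‖F ζ‖ hε
  rw [smoothSol, norm_smul, norm_mul, norm_inv, norm_regNormSq, innerSL_apply_norm]
  calc _ ≤ ‖F ζ‖ ^ 3 * l ζ * (‖F ζ‖ ^ 2 + ε ^ 2)⁻¹ * ‖F ζ‖ := by gcongr
    _ = ‖F ζ‖ ^ 2 * l ζ * (‖F ζ‖ ^ 2 * (‖F ζ‖ ^ 2 + ε ^ 2)⁻¹) := by ring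
    _ ≤ 1 ^ 2 * l ζ * 1 := by gcongr
    _ = l ζ := by ring

lemma Admissible.norm_smoothSolDeriv_le (h : Admissible F g l) (hε : 0 < ε) {ζ : ℂ}
    (hζ : ζ ∈ ball (0 : ℂ) 1) : ‖smoothSolDeriv F g ε ζ‖ ≤ 4 * l ζ := by
  have h1 := h.norm_rhs_mul_le ζ hζ
  have h1' := h.norm_deriv_rhs_le ζ hζ
  have h2 := h.norm_le ζ hζ
  have h3 := h.nonneg ζ hζ
  have h4 := pow_mul_inv_le_one ‖F ζ‖ hε
  have h5 : ‖innerSL ℂ (F ζ) (deriv F ζ)‖ ≤ ‖F ζ‖ * ‖deriv F ζ‖ := by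
    simpa using norm_inner_le_norm (𝕜 := ℂ) (F ζ) (deriv F ζ)
  rw [smoothSolDeriv, norm_smul, innerSL_apply_norm]
  set q := (‖F ζ‖ ^ 2 + ε ^ 2)⁻¹ with hq
  have hq0 : 0 ≤ q := by positivity
  have h6 : ‖deriv g ζ * (regNormSq F ε ζ)⁻¹ -
      g ζ * (innerSL ℂ (F ζ) (deriv F ζ) * ((regNormSq F ε ζ)⁻¹) ^ 2)‖ ≤
      3 * ‖F ζ‖ ^ 2 * l ζ * q + ‖F ζ‖ * (‖F ζ‖ ^ 3 * l ζ) * q ^ 2 := by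
    refine (norm_sub_le _ _).trans ?_
    rw [norm_mul, norm_mul, norm_mul, norm_pow, norm_inv, norm_regNormSq, ← hq]
    refine add_le_add (by gcongr) ?_
    calc _ ≤ ‖g ζ‖ * (‖F ζ‖ * ‖deriv F ζ‖ * q ^ 2) := by gcongr
      _ = ‖F ζ‖ * (‖g ζ‖ * ‖deriv F ζ‖) * q ^ 2 := by ring
      _ ≤ _ := by gcongr
  calc _ ≤ (3 * ‖F ζ‖ ^ 2 * l ζ * q + ‖F ζ‖ * (‖F ζ‖ ^ 3 * l ζ) * q ^ 2) * ‖F ζ‖ := by gcongr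
    _ = 3 * ‖F ζ‖ * l ζ * (‖F ζ‖ ^ 2 * q) + ‖F ζ‖ * l ζ * (‖F ζ‖ ^ 2 * q) ^ 2 := by ring
    _ ≤ 3 * 1 * l ζ * 1 + 1 * l ζ * 1 ^ 2 := by gcongr
    _ = 4 * l ζ := by ring

lemma Admissible.norm_koszul_le (h : Admissible F g l) (hε : 0 < ε) {ζ : ℂ}
    (hζ : ζ ∈ ball (0 : ℂ) 1) : ‖koszul F g ε ζ‖ ≤ 2 * l ζ := by
  have h1 := h.norm_rhs_mul_le ζ hζ
  have h3 := h.nonneg ζ hζ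
  have h4 := pow_mul_inv_le_one ‖F ζ‖ hε
  rw [koszul, norm_smul, norm_mul, norm_pow, norm_inv, norm_regNormSq]
  set q := (‖F ζ‖ ^ 2 + ε ^ 2)⁻¹ with hq
  have hq0 : 0 ≤ q := by positivity
  have h5 : ‖(innerSL ℂ (deriv F ζ)).smulRight (innerSL ℂ (F ζ)) -
      (innerSL ℂ (F ζ)).smulRight (innerSL ℂ (deriv F ζ))‖ ≤ 2 * ‖F ζ‖ * ‖deriv F ζ‖ := by
    refine (norm_sub_le _ _).trans ?_
    rw [ContinuousLinearMap.norm_smulRight_apply, ContinuousLinearMap.norm_smulRight_apply]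
    simp only [innerSL_apply_norm]
    linarith
  calc _ ≤ ‖g ζ‖ * q ^ 2 * (2 * ‖F ζ‖ * ‖deriv F ζ‖) := by gcongr
    _ = 2 * ‖F ζ‖ * q ^ 2 * (‖g ζ‖ * ‖deriv F ζ‖) := by ring
    _ ≤ 2 * ‖F ζ‖ * q ^ 2 * (‖F ζ‖ ^ 3 * l ζ) := by gcongr
    _ = 2 * l ζ * (‖F ζ‖ ^ 2 * q) ^ 2 := by ring
    _ ≤ 2 * l ζ * 1 ^ 2 := by gcongr
    _ = 2 * l ζ := by ring

/-- The pointwise identity behind the `∂̄`-Stokes argument. -/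
lemma stokes_integrand_eq (hε : 0 < ε) {z ζ : ℂ} (hz : z ∈ ball (0 : ℂ) 1)
    (hζ : ζ ∈ ball (0 : ℂ) 1) :
    diskWeight ζ ^ 2 * (szego z ζ ^ 2 * ((g ζ * (regNormSq F ε ζ)⁻¹) *
        innerSL ℂ (deriv F ζ) (dslope F z ζ) +
        -(g ζ * (innerSL ℂ (deriv F ζ) (F ζ) * ((regNormSq F ε ζ)⁻¹) ^ 2)) *
          innerSL ℂ (F ζ) (dslope F z ζ)) +
      2 * z * szego z ζ ^ 3 * ((g ζ * (regNormSq F ε ζ)⁻¹) * innerSL ℂ (F ζ) (dslope F z ζ))) -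
      2 * diskWeight ζ * ζ *
        (szego z ζ ^ 2 * ((g ζ * (regNormSq F ε ζ)⁻¹) * innerSL ℂ (F ζ) (dslope F z ζ))) =
    (2 * diskWeight ζ * szego z ζ ^ 3 * smoothSol F g ε ζ (F z) +
      diskWeight ζ ^ 2 * szego z ζ ^ 2 * koszul F g ε ζ (dslope F z ζ) (F z)) -
      2 * diskWeight ζ * szego z ζ ^ 3 * g ζ +
      ((ε ^ 2 : ℝ) : ℂ) * (2 * diskWeight ζ * szego z ζ ^ 3 * (g ζ * (regNormSq F ε ζ)⁻¹) +
        diskWeight ζ ^ 2 * szego z ζ ^ 2 * (g ζ * ((regNormSq F ε ζ)⁻¹) ^ 2 *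
          innerSL ℂ (deriv F ζ) (dslope F z ζ))) := by
  have e := szego_diskWeight_identity hz hζ
  have hF : F z = F ζ - (ζ - z) • dslope F z ζ := by rw [sub_smul_dslope']; abel
  have hn := regNormSq_ne_zero F hε ζ
  have hphi : innerSL ℂ (F ζ) (F ζ) = regNormSq F ε ζ - ((ε ^ 2 : ℝ) : ℂ) := by
    rw [regNormSq]; ring
  rw [koszul_apply, smoothSol, smul_apply]
  rw [hF]
  simp only [map_sub, map_smul, smul_eq_mul, hphi]
  set q := regNormSq F ε ζ
  have hq : q * q⁻¹ = 1 := mul_inv_cancel₀ hn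
  set A := innerSL ℂ (deriv F ζ) (dslope F z ζ)
  set B := innerSL ℂ (F ζ) (dslope F z ζ)
  set C := innerSL ℂ (deriv F ζ) (F ζ)
  generalize q⁻¹ = p at *
  generalize ((ε ^ 2 : ℝ) : ℂ) = s at *
  generalize diskWeight ζ = w at *
  generalize szego z ζ = k at *
  generalize g ζ = G at *
  linear_combination (G * p * B) * e + (-2 * w * k ^ 3 * G - w ^ 2 * k ^ 2 * G * p * A) * hq

variable [CompleteSpace E]

lemma Admissible.tame_regNormSq (h : Admissible F g l) :
    Tame (regNormSq F ε) (fun ζ => innerSL ℂ (F ζ) (deriv F ζ))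
      (fun ζ => innerSL ℂ (deriv F ζ) (F ζ)) := by
  have h1 := tame_innerSL h.differentiableOn h.norm_le
  have h2 := tame_of_differentiableOn h.differentiableOn h.norm_le
  refine ((h1.apply h2).add_const (((ε ^ 2 : ℝ) : ℂ))).congr (fun ζ => rfl) (fun ζ => ?_)
    (fun ζ => ?_) <;> simp

lemma Admissible.tame_inv_regNormSq (h : Admissible F g l) (hε : 0 < ε) :
    Tame (fun ζ => (regNormSq F ε ζ)⁻¹)
      (fun ζ => -(innerSL ℂ (F ζ) (deriv F ζ)) * ((regNormSq F ε ζ)⁻¹) ^ 2)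
      (fun ζ => -(innerSL ℂ (deriv F ζ) (F ζ)) * ((regNormSq F ε ζ)⁻¹) ^ 2) := by
  refine (h.tame_regNormSq.inv (δ := ε ^ 2) (by positivity) fun ζ _ => ?_).congr
    (fun ζ => rfl) (fun ζ => ?_) (fun ζ => ?_)
  · rw [norm_regNormSq]
    nlinarith [norm_nonneg (F ζ)]
  · rw [inv_pow, div_eq_mul_inv]
  · rw [inv_pow, div_eq_mul_inv]

lemma Admissible.tame_quot (h : Admissible F g l) (hε : 0 < ε) :
    Tame (fun ζ => g ζ * (regNormSq F ε ζ)⁻¹)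
      (fun ζ => deriv g ζ * (regNormSq F ε ζ)⁻¹ -
        g ζ * (innerSL ℂ (F ζ) (deriv F ζ) * ((regNormSq F ε ζ)⁻¹) ^ 2))
      (fun ζ => -(g ζ * (innerSL ℂ (deriv F ζ) (F ζ) * ((regNormSq F ε ζ)⁻¹) ^ 2))) := by
  obtain ⟨M, hM⟩ := h.rhs_bounded
  refine ((tame_of_differentiableOn h.differentiableOn_rhs hM).smul
    (h.tame_inv_regNormSq hε)).congr (fun ζ => rfl) (fun ζ => ?_) (fun ζ => ?_) <;>
    simp only [smul_eq_mul] <;> ring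

lemma Admissible.tame_smoothSol (h : Admissible F g l) (hε : 0 < ε) :
    Tame (smoothSol F g ε) (smoothSolDeriv F g ε)
      (fun ζ => (g ζ * (regNormSq F ε ζ)⁻¹) • innerSL ℂ (deriv F ζ) +
        (-(g ζ * (innerSL ℂ (deriv F ζ) (F ζ) * ((regNormSq F ε ζ)⁻¹) ^ 2))) •
          innerSL ℂ (F ζ)) := by
  refine ((h.tame_quot hε).smul (tame_innerSL h.differentiableOn h.norm_le)).congr
    (fun ζ => rfl) (fun ζ => ?_) (fun ζ => rfl)
  rw [smul_zero, zero_add, smoothSolDeriv]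

lemma Admissible.continuousOn_koszul (h : Admissible F g l) (hε : 0 < ε) :
    ContinuousOn (koszul F g ε) (ball 0 1) := by
  have h1 := h.differentiableOn.continuousOn
  have h2 := (h.differentiableOn.deriv isOpen_ball).continuousOn
  have h3 := (h.tame_inv_regNormSq hε).continuousOn
  have h4 := h.differentiableOn_rhs.continuousOn
  have h5 : ContinuousOn (fun ζ => innerSL ℂ (F ζ)) (ball 0 1) :=
    (innerSL ℂ).continuous.comp_continuousOn h1
  have h6 : ContinuousOn (fun ζ => innerSL ℂ (deriv F ζ)) (ball 0 1) :=
    (innerSL ℂ).continuous.comp_continuousOn h2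
  have key : ∀ {a b : ℂ → E →L[ℂ] ℂ}, ContinuousOn a (ball 0 1) → ContinuousOn b (ball 0 1) →
      ContinuousOn (fun ζ => (a ζ).smulRight (b ζ)) (ball 0 1) := fun ha hb =>
    ((ContinuousLinearMap.smulRightL ℂ E (E →L[ℂ] ℂ)).continuous.comp_continuousOn ha).clm_apply hb
  exact (h4.mul (h3.pow 2)).smul ((key h6 h5).sub (key h5 h6))

end Corona

section Solution

set_option maxSynthPendingDepth 3

variable {E : Type*} [NormedAddCommGroup E] [InnerProductSpace ℂ E]

lemma integrableOn_of_norm_le_mul {V : Type*} [NormedAddCommGroup V] {f : ℂ → V} {l : ℂ → ℝ}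
    (hf : AEStronglyMeasurable f (volume.restrict (ball 0 1))) (hl : IntegrableOn l (ball 0 1))
    (C : ℝ) (h : ∀ ζ ∈ ball (0 : ℂ) 1, ‖f ζ‖ ≤ C * l ζ) : IntegrableOn f (ball 0 1) := by
  refine (hl.const_mul C).mono' hf ?_
  filter_upwards [ae_restrict_mem measurableSet_ball] with ζ hζ using h ζ hζ

/-- The integrand defining the solution functional. -/
noncomputable def solInt (F : ℂ → E) (g : ℂ → ℂ) (ε : ℝ) (z ζ : ℂ) : E →L[ℂ] ℂ :=
  (2 * diskWeight ζ * szego z ζ ^ 3) • smoothSol F g ε ζ +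
    (diskWeight ζ ^ 2 * szego z ζ ^ 2) • koszul F g ε ζ (dslope F z ζ)

/-- The part of the `z`-derivative of `solInt` coming from the first summand. -/
noncomputable def solIntDerivMain (F : ℂ → E) (g : ℂ → ℂ) (ε : ℝ) (z ζ : ℂ) : E →L[ℂ] ℂ :=
  (6 * diskWeight ζ * conj ζ * szego z ζ ^ 4) • smoothSol F g ε ζ

/-- The part of the `z`-derivative of `solInt` coming from the Koszul summand. -/
noncomputable def solIntDerivKoszul (F : ℂ → E) (g : ℂ → ℂ) (ε : ℝ) (z ζ : ℂ) : E →L[ℂ] ℂ :=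
  (2 * diskWeight ζ ^ 2 * conj ζ * szego z ζ ^ 3) • koszul F g ε ζ (dslope F z ζ) +
    (diskWeight ζ ^ 2 * szego z ζ ^ 2) • koszul F g ε ζ (deriv (dslope F ζ) z)

/-- The solution functional. -/
noncomputable def sol (F : ℂ → E) (g : ℂ → ℂ) (ε : ℝ) (z : ℂ) : E →L[ℂ] ℂ :=
  ((diskMass⁻¹ : ℝ) : ℂ) • ∫ ζ in ball (0 : ℂ) 1, solInt F g ε z ζ

lemma hasDerivAt_szego {z ζ : ℂ} (hz : z ∈ ball (0 : ℂ) 1) (hζ : ζ ∈ ball (0 : ℂ) 1) :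
    HasDerivAt (fun x => szego x ζ) (conj ζ * szego z ζ ^ 2) z := by
  have h := (((hasDerivAt_id z).const_mul (conj ζ)).const_sub 1).inv
    (by simpa using one_sub_conj_mul_ne_zero hz hζ)
  refine h.congr_deriv ?_
  simp [szego, div_eq_mul_inv]

lemma measurable_inv_sub (z : ℂ) : Measurable fun ζ : ℂ => (z - ζ)⁻¹ := by fun_prop

variable {F : ℂ → E} {g : ℂ → ℂ} {l : ℂ → ℝ} {ε : ℝ}

lemma Admissible.norm_koszul_dslope_le (h : Admissible F g l) (hε : 0 < ε) {z ζ : ℂ}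
    (hz : z ∈ ball (0 : ℂ) 1) (hζ : ζ ∈ ball (0 : ℂ) 1) :
    ‖koszul F g ε ζ (dslope F z ζ)‖ ≤ 4 * ‖szego z ζ‖ * l ζ := by
  have h1 := h.norm_koszul_le hε hζ
  have h2 := norm_dslope_le_of_bound h.differentiableOn h.norm_le hz hζ
  have h3 := h.nonneg ζ hζ
  calc _ ≤ ‖koszul F g ε ζ‖ * ‖dslope F z ζ‖ := ContinuousLinearMap.le_opNorm _ _
    _ ≤ (2 * l ζ) * (2 * 1 * ‖szego z ζ‖) := by gcongr
    _ = _ := by ring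

lemma Admissible.norm_solInt_le (h : Admissible F g l) (hε : 0 < ε) {z ζ : ℂ}
    (hz : z ∈ ball (0 : ℂ) 1) (hζ : ζ ∈ ball (0 : ℂ) 1) :
    ‖solInt F g ε z ζ‖ ≤ 6 * ‖szego z ζ‖ ^ 3 * l ζ := by
  have h1 := h.norm_smoothSol_le hε hζ
  have h2 := h.norm_koszul_dslope_le hε hz hζ
  have h3 := h.nonneg ζ hζ
  have hw := norm_diskWeight_le hζ
  refine (norm_add_le _ _).trans ?_
  rw [norm_smul, norm_smul, norm_mul, norm_mul, norm_mul, norm_pow, norm_pow, norm_pow,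
    RCLike.norm_ofNat]
  calc _ ≤ 2 * 1 * ‖szego z ζ‖ ^ 3 * l ζ +
        1 ^ 2 * ‖szego z ζ‖ ^ 2 * (4 * ‖szego z ζ‖ * l ζ) := by gcongr
    _ = _ := by ring

lemma Admissible.norm_solIntDerivMain_le (h : Admissible F g l) (hε : 0 < ε) {z ζ : ℂ}
    (hζ : ζ ∈ ball (0 : ℂ) 1) :
    ‖solIntDerivMain F g ε z ζ‖ ≤ 6 * ‖szego z ζ‖ ^ 4 * l ζ := by
  have h1 := h.norm_smoothSol_le hε hζ
  have hw := norm_diskWeight_le hζ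
  have hn := (mem_ball_zero_iff.1 hζ).le
  rw [solIntDerivMain, norm_smul, norm_mul, norm_mul, norm_mul, norm_pow, RCLike.norm_ofNat,
    RCLike.norm_conj]
  calc _ ≤ 6 * 1 * 1 * ‖szego z ζ‖ ^ 4 * l ζ := by gcongr
    _ = _ := by ring

lemma Admissible.integrableOn_weight (h : Admissible F g l) {z : ℂ} (hz : z ∈ ball (0 : ℂ) 1)
    (n : ℕ) : IntegrableOn (fun ζ => ‖diskWeight ζ‖ ^ 2 * ‖szego z ζ‖ ^ n * l ζ) (ball 0 1) := by
  have h1 := continuousOn_szego hz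
  have h2 := continuous_diskWeight
  have c : ContinuousOn (fun ζ => ‖diskWeight ζ‖ ^ 2 * ‖szego z ζ‖ ^ n) (ball 0 1) := by fun_prop
  refine integrableOn_of_norm_le_mul ((c.aestronglyMeasurable measurableSet_ball).mul
    h.integrableOn.aestronglyMeasurable) h.integrableOn (1 ^ 2 * (1 - ‖z‖)⁻¹ ^ n) fun ζ hζ => ?_
  have := h.nonneg ζ hζ
  rw [Real.norm_of_nonneg (by positivity)]
  gcongr
  · exact norm_diskWeight_le hζ
  · exact norm_szego_le hz hζ

lemma Admissible.norm_sol_zero_le (h : Admissible F g l) (hε : 0 < ε) :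
    ‖sol F g ε 0‖ ≤ diskMass⁻¹ * (6 * ∫ ζ in ball (0 : ℂ) 1, l ζ) := by
  rw [sol, norm_smul, norm_real, Real.norm_of_nonneg (inv_nonneg.2 diskMass_pos.le)]
  refine mul_le_mul_of_nonneg_left ?_ (inv_nonneg.2 diskMass_pos.le)
  rw [← integral_const_mul]
  refine norm_integral_le_of_norm_le (h.integrableOn.const_mul 6) ?_
  filter_upwards [ae_restrict_mem measurableSet_ball] with ζ hζ
  simpa [szego] using h.norm_solInt_le hε (z := 0) (by simp) hζ

variable [CompleteSpace E]

lemma hasDerivAt_solInt (h : Admissible F g l) {z ζ : ℂ} (hz : z ∈ ball (0 : ℂ) 1)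
    (hζ : ζ ∈ ball (0 : ℂ) 1) : HasDerivAt (fun x => solInt F g ε x ζ)
      (solIntDerivMain F g ε z ζ + solIntDerivKoszul F g ε z ζ) z := by
  have hk := hasDerivAt_szego hz hζ
  have hD : HasDerivAt (fun x => dslope F x ζ) (deriv (dslope F ζ) z) z := by
    have := ((differentiableOn_dslope_ball h.differentiableOn hζ).differentiableAt
      (isOpen_ball.mem_nhds hz)).hasDerivAt
    refine this.congr_of_eventuallyEq (.of_forall fun x => ?_)
    exact dslope_comm F x ζ
  have h1 := ((hk.pow 3).const_mul (2 * diskWeight ζ)).smul_const (smoothSol F g ε ζ)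
  have hT : HasDerivAt (fun x => koszul F g ε ζ (dslope F x ζ))
      (koszul F g ε ζ (deriv (dslope F ζ) z)) z :=
    (koszul F g ε ζ).hasFDerivAt.comp_hasDerivAt z hD
  have h2 := ((hk.pow 2).const_mul (diskWeight ζ ^ 2)).smul hT
  refine (h1.add h2).congr_deriv ?_
  rw [solIntDerivMain, solIntDerivKoszul, add_comm (_ • koszul F g ε ζ (dslope F z ζ))]
  refine congrArg₂ (· + ·) (congrArg (· • _) ?_) (congrArg₂ (· + ·) rfl (congrArg (· • _) ?_))
  · push_cast
    ring
  · push_cast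
    ring

lemma Admissible.aestronglyMeasurable_solInt (h : Admissible F g l) (hε : 0 < ε) {z : ℂ}
    (hz : z ∈ ball (0 : ℂ) 1) :
    AEStronglyMeasurable (solInt F g ε z) (volume.restrict (ball 0 1)) := by
  have h1 := continuousOn_szego hz
  have h2 := continuous_diskWeight
  have h3 := (h.tame_smoothSol hε).continuousOn
  have h4 := (h.continuousOn_koszul hε).clm_apply (continuousOn_dslope_ball h.differentiableOn hz)
  refine ContinuousOn.aestronglyMeasurable ?_ measurableSet_ball
  unfold solInt
  fun_prop

lemma Admissible.aestronglyMeasurable_solIntDerivMain (h : Admissible F g l) (hε : 0 < ε) {z : ℂ}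
    (hz : z ∈ ball (0 : ℂ) 1) :
    AEStronglyMeasurable (solIntDerivMain F g ε z) (volume.restrict (ball 0 1)) := by
  have h1 := continuousOn_szego hz
  have h2 := continuous_diskWeight
  have h3 := (h.tame_smoothSol hε).continuousOn
  refine ContinuousOn.aestronglyMeasurable ?_ measurableSet_ball
  unfold solIntDerivMain
  fun_prop

lemma aestronglyMeasurable_deriv_dslope (hF : DifferentiableOn ℂ F (ball 0 1)) {z : ℂ}
    (hz : z ∈ ball (0 : ℂ) 1) :
    AEStronglyMeasurable (fun ζ => deriv (dslope F ζ) z) (volume.restrict (ball 0 1)) := by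
  have h1 : AEStronglyMeasurable (fun ζ => (z - ζ)⁻¹ • (deriv F z - dslope F z ζ))
      (volume.restrict (ball 0 1)) :=
    (measurable_inv_sub z).aestronglyMeasurable.smul
      ((continuousOn_const.sub (continuousOn_dslope_ball hF hz)).aestronglyMeasurable
        measurableSet_ball)
  refine h1.congr ?_
  have : ∀ᵐ ζ ∂(volume.restrict (ball (0 : ℂ) 1)), ζ ≠ z :=
    ae_restrict_of_ae (by simp [ae_iff])
  filter_upwards [this] with ζ hζ
  rw [deriv_dslope_of_ne hF hz hζ.symm, dslope_comm F ζ z]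

lemma Admissible.aestronglyMeasurable_solIntDerivKoszul (h : Admissible F g l) (hε : 0 < ε)
    {z : ℂ} (hz : z ∈ ball (0 : ℂ) 1) :
    AEStronglyMeasurable (solIntDerivKoszul F g ε z) (volume.restrict (ball 0 1)) := by
  have h1 := continuousOn_szego hz
  have h2 := continuous_diskWeight
  have h3 := h.continuousOn_koszul hε
  have h4 := h3.clm_apply (continuousOn_dslope_ball h.differentiableOn hz)
  have c1 : ContinuousOn (fun ζ => 2 * diskWeight ζ ^ 2 * conj ζ * szego z ζ ^ 3) (ball 0 1) := by
    fun_prop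
  have c2 : ContinuousOn (fun ζ => diskWeight ζ ^ 2 * szego z ζ ^ 2) (ball 0 1) := by fun_prop
  have h5 : AEStronglyMeasurable (fun ζ => koszul F g ε ζ (deriv (dslope F ζ) z))
      (volume.restrict (ball 0 1)) :=
    (ContinuousLinearMap.id ℂ (E →L[ℂ] E →L[ℂ] ℂ)).aestronglyMeasurable_comp₂
      (h3.aestronglyMeasurable measurableSet_ball)
      (aestronglyMeasurable_deriv_dslope h.differentiableOn hz)
  exact ((c1.smul h4).aestronglyMeasurable measurableSet_ball).add
    ((c2.aestronglyMeasurable measurableSet_ball).smul h5)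

lemma Admissible.norm_koszul_deriv_dslope_le (h : Admissible F g l) (hε : 0 < ε) {z ζ : ℂ}
    (hz : z ∈ ball (0 : ℂ) 1) (hζ : ζ ∈ ball (0 : ℂ) 1) :
    ‖koszul F g ε ζ (deriv (dslope F ζ) z)‖ ≤
      (2 * ‖deriv F z‖ * ‖szego z ζ‖ + 8 * ‖szego z ζ‖ ^ 2) * l ζ := by
  have h1 := h.norm_koszul_le hε hζ
  have h2 := norm_deriv_dslope_le h.differentiableOn h.norm_le hz hζ
  have h3 := h.nonneg ζ hζ
  rw [div_eq_mul_inv, div_eq_mul_inv, ← inv_pow, ← norm_szego] at h2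
  calc _ ≤ ‖koszul F g ε ζ‖ * ‖deriv (dslope F ζ) z‖ := ContinuousLinearMap.le_opNorm _ _
    _ ≤ (2 * l ζ) * (‖deriv F z‖ * ‖szego z ζ‖ + 4 * 1 * ‖szego z ζ‖ ^ 2) := by gcongr
    _ = _ := by ring

lemma Admissible.norm_solIntDerivKoszul_le (h : Admissible F g l) (hε : 0 < ε) {z ζ : ℂ}
    (hz : z ∈ ball (0 : ℂ) 1) (hζ : ζ ∈ ball (0 : ℂ) 1) :
    ‖solIntDerivKoszul F g ε z ζ‖ ≤ 16 * (‖diskWeight ζ‖ ^ 2 * ‖szego z ζ‖ ^ 4 * l ζ) +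
      2 * ‖deriv F z‖ * (‖diskWeight ζ‖ ^ 2 * ‖szego z ζ‖ ^ 3 * l ζ) := by
  have h1 := h.norm_koszul_deriv_dslope_le hε hz hζ
  have h2 := h.norm_koszul_dslope_le hε hz hζ
  have h3 := h.nonneg ζ hζ
  have hn := (mem_ball_zero_iff.1 hζ).le
  refine (norm_add_le _ _).trans ?_
  rw [norm_smul, norm_smul, norm_mul, norm_mul, norm_mul, norm_mul, norm_pow, norm_pow, norm_pow,
    RCLike.norm_ofNat, RCLike.norm_conj]
  calc _ ≤ 2 * ‖diskWeight ζ‖ ^ 2 * 1 * ‖szego z ζ‖ ^ 3 * (4 * ‖szego z ζ‖ * l ζ) +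
        ‖diskWeight ζ‖ ^ 2 * ‖szego z ζ‖ ^ 2 *
          ((2 * ‖deriv F z‖ * ‖szego z ζ‖ + 8 * ‖szego z ζ‖ ^ 2) * l ζ) := by gcongr
    _ = _ := by ring

lemma Admissible.integrableOn_solInt (h : Admissible F g l) (hε : 0 < ε) {z : ℂ}
    (hz : z ∈ ball (0 : ℂ) 1) : IntegrableOn (solInt F g ε z) (ball 0 1) := by
  refine integrableOn_of_norm_le_mul (h.aestronglyMeasurable_solInt hε hz) h.integrableOn
    (6 * (1 - ‖z‖)⁻¹ ^ 3) fun ζ hζ => (h.norm_solInt_le hε hz hζ).trans ?_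
  have := h.nonneg ζ hζ
  gcongr
  exact norm_szego_le hz hζ

lemma Admissible.hasDerivAt_integral_solInt (h : Admissible F g l) (hε : 0 < ε) {z : ℂ}
    (hz : z ∈ ball (0 : ℂ) 1) :
    HasDerivAt (fun x => ∫ ζ in ball (0 : ℂ) 1, solInt F g ε x ζ)
      (∫ ζ in ball (0 : ℂ) 1, (solIntDerivMain F g ε z ζ + solIntDerivKoszul F g ε z ζ)) z := by
  have hz1 := mem_ball_zero_iff.1 hz
  set r := (1 - ‖z‖) / 2 with hr
  have hr0 : 0 < r := by rw [hr]; linarith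
  have hx : ∀ x ∈ ball z r, x ∈ ball (0 : ℂ) 1 ∧ r ≤ 1 - ‖x‖ := fun x hx => by
    have h1 : ‖x - z‖ < r := by simpa [dist_eq_norm] using hx
    have h2 : ‖x‖ ≤ ‖x - z‖ + ‖z‖ := by simpa using norm_add_le (x - z) z
    rw [mem_ball_zero_iff]
    constructor <;> linarith
  refine (hasDerivAt_integral_of_dominated_loc_of_deriv_le
    (bound := fun ζ => (22 * r⁻¹ ^ 4 + 2 * (4 * r⁻¹) * r⁻¹ ^ 3) * l ζ)
    (F' := fun z ζ => solIntDerivMain F g ε z ζ + solIntDerivKoszul F g ε z ζ)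
    (ball_mem_nhds z hr0) ?_ (h.integrableOn_solInt hε hz) ?_ ?_
    (h.integrableOn.const_mul _) ?_).2
  · filter_upwards [ball_mem_nhds z hr0] with x hxr
    exact h.aestronglyMeasurable_solInt hε (hx x hxr).1
  · exact (h.aestronglyMeasurable_solIntDerivMain hε hz).add
      (h.aestronglyMeasurable_solIntDerivKoszul hε hz)
  · filter_upwards [ae_restrict_mem measurableSet_ball] with ζ hζ x hxr
    obtain ⟨hxb, hxd⟩ := hx x hxr
    have h1 := h.norm_solIntDerivMain_le (z := x) hε hζ
    have h2 := h.norm_solIntDerivKoszul_le hε hxb hζ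
    have h3 := h.nonneg ζ hζ
    have hk : ‖szego x ζ‖ ≤ r⁻¹ := (norm_szego_le hxb hζ).trans (inv_anti₀ hr0 hxd)
    have hw := norm_diskWeight_le hζ
    have hF : ‖deriv F x‖ ≤ 4 * r⁻¹ := by
      have h4 := norm_deriv_le_of_bounded h.differentiableOn h.norm_le hxb
      rw [← div_eq_mul_inv, le_div_iff₀ hr0]
      have h5 : r ≤ 1 - ‖x‖ ^ 2 := by nlinarith [norm_nonneg x, mem_ball_zero_iff.1 hxb]
      nlinarith [norm_nonneg (deriv F x)]
    refine (norm_add_le _ _).trans ((add_le_add h1 h2).trans ?_)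
    calc _ ≤ 6 * r⁻¹ ^ 4 * l ζ + (16 * (1 ^ 2 * r⁻¹ ^ 4 * l ζ) +
          2 * (4 * r⁻¹) * (1 ^ 2 * r⁻¹ ^ 3 * l ζ)) := by gcongr
      _ = _ := by ring
  · filter_upwards [ae_restrict_mem measurableSet_ball] with ζ hζ x hxr
    exact hasDerivAt_solInt h (hx x hxr).1 hζ

lemma Admissible.integrableOn_solIntDerivMain (h : Admissible F g l) (hε : 0 < ε) {z : ℂ}
    (hz : z ∈ ball (0 : ℂ) 1) : IntegrableOn (solIntDerivMain F g ε z) (ball 0 1) := by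
  refine integrableOn_of_norm_le_mul (h.aestronglyMeasurable_solIntDerivMain hε hz)
    h.integrableOn (6 * (1 - ‖z‖)⁻¹ ^ 4) fun ζ hζ => (h.norm_solIntDerivMain_le hε hζ).trans ?_
  have := h.nonneg ζ hζ
  gcongr
  exact norm_szego_le hz hζ

lemma Admissible.integrableOn_solIntDerivKoszul (h : Admissible F g l) (hε : 0 < ε) {z : ℂ}
    (hz : z ∈ ball (0 : ℂ) 1) : IntegrableOn (solIntDerivKoszul F g ε z) (ball 0 1) := by
  have := ((h.integrableOn_weight hz 4).const_mul 16).add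
    ((h.integrableOn_weight hz 3).const_mul (2 * ‖deriv F z‖))
  refine this.mono' (h.aestronglyMeasurable_solIntDerivKoszul hε hz) ?_
  filter_upwards [ae_restrict_mem measurableSet_ball] with ζ hζ
  exact h.norm_solIntDerivKoszul_le hε hz hζ

/-- Integration by parts improves the weight in the first summand. -/
lemma Admissible.integral_solIntDerivMain (h : Admissible F g l) (hε : 0 < ε) {z : ℂ}
    (hz : z ∈ ball (0 : ℂ) 1) :
    ∫ ζ in ball (0 : ℂ) 1, solIntDerivMain F g ε z ζ =
      ∫ ζ in ball (0 : ℂ) 1, (3 * diskWeight ζ ^ 2 * szego z ζ ^ 4) • smoothSolDeriv F g ε ζ := by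
  have key := ((tame_szego_pow hz 4).smul (h.tame_smoothSol hε)).integral_eq_zero.1
  have hi1 := h.integrableOn_solIntDerivMain hε hz
  have hi2 : IntegrableOn (fun ζ => (3 * diskWeight ζ ^ 2 * szego z ζ ^ 4) •
      smoothSolDeriv F g ε ζ) (ball 0 1) := by
    have h1 := continuousOn_szego hz
    have h2 := continuous_diskWeight
    have h3 : ContinuousOn (smoothSolDeriv F g ε) (ball 0 1) := (h.tame_smoothSol hε).1
    refine integrableOn_of_norm_le_mul (ContinuousOn.aestronglyMeasurable (by fun_prop)
      measurableSet_ball) h.integrableOn (3 * 1 ^ 2 * (1 - ‖z‖)⁻¹ ^ 4 * 4) fun ζ hζ => ?_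
    have h4 := h.nonneg ζ hζ
    have h5 := h.norm_smoothSolDeriv_le hε hζ
    have h6 := norm_diskWeight_le hζ
    have h7 := norm_szego_le hz hζ
    rw [norm_smul, norm_mul, norm_mul, norm_pow, norm_pow, RCLike.norm_ofNat]
    calc _ ≤ 3 * 1 ^ 2 * (1 - ‖z‖)⁻¹ ^ 4 * (4 * l ζ) := by gcongr
      _ = _ := by ring
  rw [← sub_eq_zero, ← integral_sub hi1 hi2]
  have : ∫ ζ in ball (0 : ℂ) 1, (-3 : ℂ) • (diskWeight ζ ^ 2 • (szego z ζ ^ 4 •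
      smoothSolDeriv F g ε ζ + (0 : ℂ) • smoothSol F g ε ζ) -
        (2 * diskWeight ζ * conj ζ) • (szego z ζ ^ 4 • smoothSol F g ε ζ)) = 0 := by
    rw [integral_smul, key, smul_zero]
  refine (setIntegral_congr_fun measurableSet_ball fun ζ _ => ?_).trans this
  simp only [solIntDerivMain]
  module

lemma Admissible.norm_deriv_sol_le (h : Admissible F g l) (hε : 0 < ε) {z : ℂ}
    (hz : z ∈ ball (0 : ℂ) 1) :
    ‖deriv (sol F g ε) z‖ ≤ diskMass⁻¹ *
      (28 * (∫ ζ in ball (0 : ℂ) 1, ‖diskWeight ζ‖ ^ 2 * ‖szego z ζ‖ ^ 4 * l ζ) +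
      2 * ‖deriv F z‖ * ∫ ζ in ball (0 : ℂ) 1, ‖diskWeight ζ‖ ^ 2 * ‖szego z ζ‖ ^ 3 * l ζ) := by
  have hd := (h.hasDerivAt_integral_solInt hε hz).const_smul ((diskMass⁻¹ : ℝ) : ℂ)
  have hd' : HasDerivAt (sol F g ε) _ z := hd
  have hi4 := h.integrableOn_weight hz 4
  have hi3 := h.integrableOn_weight hz 3
  rw [hd'.deriv, norm_smul, norm_real, Real.norm_of_nonneg (inv_nonneg.2 diskMass_pos.le)]
  refine mul_le_mul_of_nonneg_left ?_ (inv_nonneg.2 diskMass_pos.le)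
  rw [integral_add (h.integrableOn_solIntDerivMain hε hz)
    (h.integrableOn_solIntDerivKoszul hε hz), h.integral_solIntDerivMain hε hz]
  refine (norm_add_le _ _).trans ?_
  have e1 : ‖∫ ζ in ball (0 : ℂ) 1, (3 * diskWeight ζ ^ 2 * szego z ζ ^ 4) •
      smoothSolDeriv F g ε ζ‖ ≤
      12 * ∫ ζ in ball (0 : ℂ) 1, ‖diskWeight ζ‖ ^ 2 * ‖szego z ζ‖ ^ 4 * l ζ := by
    rw [← integral_const_mul]
    refine norm_integral_le_of_norm_le (hi4.const_mul 12) ?_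
    filter_upwards [ae_restrict_mem measurableSet_ball] with ζ hζ
    have h5 := h.norm_smoothSolDeriv_le hε hζ
    rw [norm_smul, norm_mul, norm_mul, norm_pow, norm_pow, RCLike.norm_ofNat]
    calc _ ≤ 3 * ‖diskWeight ζ‖ ^ 2 * ‖szego z ζ‖ ^ 4 * (4 * l ζ) := by gcongr
      _ = _ := by ring
  have e2 : ‖∫ ζ in ball (0 : ℂ) 1, solIntDerivKoszul F g ε z ζ‖ ≤
      16 * (∫ ζ in ball (0 : ℂ) 1, ‖diskWeight ζ‖ ^ 2 * ‖szego z ζ‖ ^ 4 * l ζ) +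
      2 * ‖deriv F z‖ * ∫ ζ in ball (0 : ℂ) 1, ‖diskWeight ζ‖ ^ 2 * ‖szego z ζ‖ ^ 3 * l ζ := by
    rw [← integral_const_mul, ← integral_const_mul,
      ← integral_add (hi4.const_mul _) (hi3.const_mul _)]
    refine norm_integral_le_of_norm_le ((hi4.const_mul _).add (hi3.const_mul _)) ?_
    filter_upwards [ae_restrict_mem measurableSet_ball] with ζ hζ
    exact h.norm_solIntDerivKoszul_le hε hz hζ
  linarith

lemma Admissible.differentiableOn_sol (h : Admissible F g l) (hε : 0 < ε) :
    DifferentiableOn ℂ (sol F g ε) (ball 0 1) := fun _ hz =>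
  ((h.hasDerivAt_integral_solInt hε hz).const_smul
    ((diskMass⁻¹ : ℝ) : ℂ)).differentiableAt.differentiableWithinAt

lemma mul_eps_le {t : ℝ} (ht : 0 ≤ t) (ht1 : t ≤ 1) (hε : 0 < ε) :
    ε ^ 2 * (t ^ 3 * (t ^ 2 + ε ^ 2)⁻¹) ≤ ε ∧ ε ^ 2 * (t ^ 3 * ((t ^ 2 + ε ^ 2)⁻¹) ^ 2) ≤ ε := by
  have hp : 0 < t ^ 2 + ε ^ 2 := by positivity
  have h1 : ε * t * (t ^ 2 + ε ^ 2)⁻¹ ≤ 1 := by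
    rw [← div_eq_mul_inv, div_le_one hp]
    nlinarith [sq_nonneg (t - ε), mul_nonneg ht hε.le]
  have h2 := pow_mul_inv_le_one t hε
  set q := (t ^ 2 + ε ^ 2)⁻¹ with hq
  have hq0 : 0 < q := by positivity
  constructor
  · calc _ = ε * t ^ 2 * (ε * t * q) := by ring
      _ ≤ ε * 1 ^ 2 * 1 := by gcongr
      _ = ε := by ring
  · calc _ = ε * ((ε * t * q) * (t ^ 2 * q)) := by ring
      _ ≤ ε * (1 * 1) := by gcongr
      _ = ε := by ring

lemma Admissible.norm_sol_apply_sub_le (h : Admissible F g l) (hε : 0 < ε) {z : ℂ}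
    (hz : z ∈ ball (0 : ℂ) 1) : ‖sol F g ε z (F z) - g z‖ ≤
      diskMass⁻¹ * (4 * ε * (1 - ‖z‖)⁻¹ ^ 3 * ∫ ζ in ball (0 : ℂ) 1, l ζ) := by
  obtain ⟨M, hM⟩ := h.rhs_bounded
  have hm := diskMass_pos
  have hm' : (diskMass : ℂ) ≠ 0 := by exact_mod_cast hm.ne'
  have hiA := h.integrableOn_solInt hε hz
  have hiB := integrableOn_szego_mul h.differentiableOn_rhs.continuousOn hM hz 3 1
  simp only [pow_one, smul_eq_mul] at hiB
  have hiA' : IntegrableOn (fun ζ => solInt F g ε z ζ (F z)) (ball 0 1) :=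
    (ContinuousLinearMap.apply ℂ ℂ (F z)).integrable_comp hiA
  set Q : ℂ → ℂ := fun ζ => ((ε ^ 2 : ℝ) : ℂ) * (2 * diskWeight ζ * szego z ζ ^ 3 *
    (g ζ * (regNormSq F ε ζ)⁻¹) + diskWeight ζ ^ 2 * szego z ζ ^ 2 *
      (g ζ * ((regNormSq F ε ζ)⁻¹) ^ 2 * innerSL ℂ (deriv F ζ) (dslope F z ζ))) with hQ
  have hQle : ∀ ζ ∈ ball (0 : ℂ) 1, ‖Q ζ‖ ≤ 4 * ε * (1 - ‖z‖)⁻¹ ^ 3 * l ζ := fun ζ hζ => by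
    have h1 := norm_diskWeight_le hζ
    have h2 := norm_szego_le hz hζ
    have h3 := h.nonneg ζ hζ
    have h4 := norm_dslope_le_of_bound h.differentiableOn h.norm_le hz hζ
    have h5 := h.norm_rhs_le ζ hζ
    have h6 := h.norm_rhs_mul_le ζ hζ
    obtain ⟨h7, h8⟩ := mul_eps_le (norm_nonneg _) (h.norm_le ζ hζ) hε
    have h9 : ‖innerSL ℂ (deriv F ζ) (dslope F z ζ)‖ ≤ ‖deriv F ζ‖ * ‖dslope F z ζ‖ := by
      simpa using norm_inner_le_norm (𝕜 := ℂ) (deriv F ζ) (dslope F z ζ)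
    rw [hQ, norm_mul, norm_real, Real.norm_of_nonneg (by positivity)]
    set q := (‖F ζ‖ ^ 2 + ε ^ 2)⁻¹ with hq
    have hq0 : 0 ≤ q := by positivity
    set k := ‖szego z ζ‖ with hk
    have hk0 : 0 ≤ k := norm_nonneg _
    have hz0 : 0 ≤ (1 - ‖z‖)⁻¹ := hk0.trans h2
    calc _ ≤ ε ^ 2 * (2 * 1 * k ^ 3 * (‖F ζ‖ ^ 3 * l ζ * q) +
          1 ^ 2 * k ^ 2 * (‖F ζ‖ ^ 3 * l ζ * q ^ 2 * (2 * 1 * k))) := by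
          refine mul_le_mul_of_nonneg_left ((norm_add_le _ _).trans (add_le_add ?_ ?_))
            (by positivity)
          · rw [norm_mul, norm_mul, norm_mul, norm_mul, norm_pow, norm_inv, norm_regNormSq,
              RCLike.norm_ofNat, ← hq, ← hk]
            gcongr
          · rw [norm_mul, norm_mul, norm_mul, norm_mul, norm_pow, norm_pow, norm_pow, norm_inv,
              norm_regNormSq, ← hq, ← hk]
            have h10 := h9.trans (mul_le_mul_of_nonneg_left h4 (norm_nonneg _))
            calc _ ≤ 1 ^ 2 * k ^ 2 * (‖g ζ‖ * q ^ 2 * (‖deriv F ζ‖ * (2 * 1 * k))) := by gcongr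
              _ = 1 ^ 2 * k ^ 2 * ((‖g ζ‖ * ‖deriv F ζ‖) * q ^ 2 * (2 * 1 * k)) := by ring
              _ ≤ _ := by gcongr
      _ = 2 * k ^ 3 * l ζ * (ε ^ 2 * (‖F ζ‖ ^ 3 * q)) +
          2 * k ^ 3 * l ζ * (ε ^ 2 * (‖F ζ‖ ^ 3 * q ^ 2)) := by ring
      _ ≤ 2 * (1 - ‖z‖)⁻¹ ^ 3 * l ζ * ε + 2 * (1 - ‖z‖)⁻¹ ^ 3 * l ζ * ε := by gcongr
      _ = _ := by ring
  have hQi : IntegrableOn Q (ball 0 1) := by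
    have h1 := continuousOn_szego hz
    have h2 := continuous_diskWeight
    have h3 := (h.tame_inv_regNormSq hε).continuousOn
    have h4 := h.differentiableOn_rhs.continuousOn
    have h6 : ContinuousOn (fun ζ => innerSL ℂ (deriv F ζ)) (ball 0 1) :=
      (innerSL ℂ).continuous.comp_continuousOn (h.differentiableOn.deriv isOpen_ball).continuousOn
    have h7 := h6.clm_apply (continuousOn_dslope_ball h.differentiableOn hz)
    refine integrableOn_of_norm_le_mul (ContinuousOn.aestronglyMeasurable ?_ measurableSet_ball)
      h.integrableOn _ hQle
    rw [hQ]
    fun_prop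
  have stokes := ((tame_szego_pow hz 2).smul ((h.tame_quot hε).smul
    ((tame_innerSL h.differentiableOn h.norm_le).apply
      (tame_dslope h.differentiableOn h.norm_le hz)))).integral_eq_zero.2
  have hzero : ∫ ζ in ball (0 : ℂ) 1, (solInt F g ε z ζ (F z) -
      2 * diskWeight ζ * szego z ζ ^ 3 * g ζ + Q ζ) = 0 := by
    refine (setIntegral_congr_fun measurableSet_ball fun ζ hζ => ?_).trans stokes
    have e := stokes_integrand_eq (F := F) (g := g) hε hz hζ
    simp only [smul_eq_mul, map_zero, zero_add, solInt, add_apply, smul_apply, hQ]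
    rw [← e]
    push_cast
    ring
  have hiAB : IntegrableOn (fun ζ => solInt F g ε z ζ (F z) -
      2 * diskWeight ζ * szego z ζ ^ 3 * g ζ) (ball 0 1) := hiA'.sub hiB
  rw [integral_add hiAB hQi, integral_sub hiA' hiB,
    integral_bergman_mul h.differentiableOn_rhs hM hz,
    ← ContinuousLinearMap.integral_apply hiA] at hzero
  have e : sol F g ε z (F z) - g z = ((diskMass⁻¹ : ℝ) : ℂ) * -∫ ζ in ball (0 : ℂ) 1, Q ζ := by
    rw [sol, smul_apply, smul_eq_mul]
    push_cast
    field_simp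
    linear_combination hzero
  rw [e, norm_mul, norm_real, Real.norm_of_nonneg (inv_nonneg.2 hm.le), norm_neg]
  refine mul_le_mul_of_nonneg_left ?_ (inv_nonneg.2 hm.le)
  rw [← integral_const_mul]
  refine norm_integral_le_of_norm_le (h.integrableOn.const_mul _) ?_
  filter_upwards [ae_restrict_mem measurableSet_ball] with ζ hζ using hQle ζ hζ

end Solution

/-- A milder companion of `schurKernel`. -/
noncomputable def mildKernel (z ζ : ℂ) : ℝ :=
  (1 - ‖ζ‖ ^ 2) ^ (-(1 / 4) : ℝ) * ‖1 - conj ζ * z‖ ^ (-(3 / 4) : ℝ)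

lemma weight_mul_le {w d : ℝ} (hw : 0 < w) (hd : 0 < d) (h : w ≤ 2 * d) (n : ℕ) :
    w ^ 2 * d⁻¹ ^ n ≤ 8 * (w ^ (-(1 / 4) : ℝ) * d ^ ((9 / 4 : ℝ) - n)) := by
  have e1 : w ^ 2 = w ^ (-(1 / 4) : ℝ) * w ^ (9 / 4 : ℝ) := by
    rw [← Real.rpow_add hw, ← Real.rpow_natCast]
    norm_num
  have e2 : d ^ ((9 / 4 : ℝ) - n) = d ^ (9 / 4 : ℝ) * d⁻¹ ^ n := by
    rw [Real.rpow_sub hd, Real.rpow_natCast, inv_pow, div_eq_mul_inv]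
  have e3 : (2 : ℝ) ^ (9 / 4 : ℝ) ≤ 8 := by
    calc (2 : ℝ) ^ (9 / 4 : ℝ) ≤ 2 ^ (3 : ℝ) :=
          Real.rpow_le_rpow_of_exponent_le (by norm_num) (by norm_num)
      _ = 8 := by norm_num
  have e4 : w ^ (9 / 4 : ℝ) ≤ 8 * d ^ (9 / 4 : ℝ) := by
    calc w ^ (9 / 4 : ℝ) ≤ (2 * d) ^ (9 / 4 : ℝ) := by gcongr
      _ = 2 ^ (9 / 4 : ℝ) * d ^ (9 / 4 : ℝ) := Real.mul_rpow (by norm_num) hd.le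
      _ ≤ _ := by gcongr
  rw [e1, e2]
  calc _ ≤ w ^ (-(1 / 4) : ℝ) * (8 * d ^ (9 / 4 : ℝ)) * d⁻¹ ^ n := by gcongr
    _ = _ := by ring

lemma diskWeight_szego_le {z ζ : ℂ} (hz : z ∈ ball (0 : ℂ) 1) (hζ : ζ ∈ ball (0 : ℂ) 1) :
    ‖diskWeight ζ‖ ^ 2 * ‖szego z ζ‖ ^ 4 ≤ 8 * schurKernel z ζ ∧
      ‖diskWeight ζ‖ ^ 2 * ‖szego z ζ‖ ^ 3 ≤ 8 * mildKernel z ζ := by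
  have h := weight_mul_le (one_sub_sq_pos hζ) (norm_one_sub_conj_mul_pos hz hζ)
    (one_sub_sq_le_norm_one_sub_conj_mul hz hζ)
  rw [norm_diskWeight hζ, norm_szego, schurKernel, mildKernel]
  constructor
  · convert h 4 using 4; norm_num
  · convert h 3 using 4; norm_num

section

variable {E : Type*} [NormedAddCommGroup E] [InnerProductSpace ℂ E]
  {F : ℂ → E} {g : ℂ → ℂ} {l : ℂ → ℝ} {ε : ℝ}

lemma ofReal_integral_le_lintegral (hl : ∀ ζ ∈ ball (0 : ℂ) 1, 0 ≤ l ζ) {p q : ℂ → ℝ}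
    (hp : ∀ ζ ∈ ball (0 : ℂ) 1, 0 ≤ p ζ) (hpq : ∀ ζ ∈ ball (0 : ℂ) 1, p ζ ≤ 8 * q ζ)
    (hi : IntegrableOn (fun ζ => p ζ * l ζ) (ball 0 1)) :
    ENNReal.ofReal (∫ ζ in ball (0 : ℂ) 1, p ζ * l ζ) ≤
      8 * ∫⁻ ζ in ball (0 : ℂ) 1, ENNReal.ofReal (q ζ) * ENNReal.ofReal (l ζ) := by
  rw [ofReal_integral_eq_lintegral_ofReal hi, ← lintegral_const_mul' _ _ (by norm_num)]
  · refine setLIntegral_mono' measurableSet_ball fun ζ hζ => ?_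
    have h1 := hl ζ hζ
    have h2 := hp ζ hζ
    have h3 := hpq ζ hζ
    rw [← mul_assoc, ← ENNReal.ofReal_ofNat, ← ENNReal.ofReal_mul (by norm_num),
      ← ENNReal.ofReal_mul (h2.trans h3)]
    exact ENNReal.ofReal_le_ofReal (by gcongr)
  · filter_upwards [ae_restrict_mem measurableSet_ball] with ζ hζ
    exact mul_nonneg (hp ζ hζ) (hl ζ hζ)

variable [CompleteSpace E]

lemma Admissible.enorm_deriv_sol_le (h : Admissible F g l) (hε : 0 < ε) {z : ℂ}
    (hz : z ∈ ball (0 : ℂ) 1) :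
    ‖deriv (sol F g ε) z‖ₑ ≤ ENNReal.ofReal (224 * diskMass⁻¹) *
      ((∫⁻ ζ in ball (0 : ℂ) 1, ENNReal.ofReal (schurKernel z ζ) * ENNReal.ofReal (l ζ)) +
      ‖deriv F z‖ₑ *
        ∫⁻ ζ in ball (0 : ℂ) 1, ENNReal.ofReal (mildKernel z ζ) * ENNReal.ofReal (l ζ)) := by
  have h1 := h.norm_deriv_sol_le hε hz
  have hm := inv_nonneg.2 diskMass_pos.le
  have h4 := ofReal_integral_le_lintegral h.nonneg (fun ζ _ => by positivity)
    (fun ζ hζ => (diskWeight_szego_le hz hζ).1) (h.integrableOn_weight hz 4)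
  have h3 := ofReal_integral_le_lintegral h.nonneg (fun ζ _ => by positivity)
    (fun ζ hζ => (diskWeight_szego_le hz hζ).2) (h.integrableOn_weight hz 3)
  have hn : ∀ n : ℕ, 0 ≤ ∫ ζ in ball (0 : ℂ) 1, ‖diskWeight ζ‖ ^ 2 * ‖szego z ζ‖ ^ n * l ζ :=
    fun n => setIntegral_nonneg measurableSet_ball fun ζ hζ =>
      mul_nonneg (by positivity) (h.nonneg ζ hζ)
  have hn4 := hn 4
  have hn3 := hn 3
  set I4 := ∫ ζ in ball (0 : ℂ) 1, ‖diskWeight ζ‖ ^ 2 * ‖szego z ζ‖ ^ 4 * l ζ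
  set I3 := ∫ ζ in ball (0 : ℂ) 1, ‖diskWeight ζ‖ ^ 2 * ‖szego z ζ‖ ^ 3 * l ζ
  have h5 : ‖deriv (sol F g ε) z‖ ≤ (28 * diskMass⁻¹) * (I4 + ‖deriv F z‖ * I3) := by
    refine h1.trans ?_
    have : 0 ≤ diskMass⁻¹ * (26 * (‖deriv F z‖ * I3)) := by positivity
    linarith
  rw [← ofReal_norm]
  refine (ENNReal.ofReal_le_ofReal h5).trans ?_
  rw [ENNReal.ofReal_mul (by positivity), ENNReal.ofReal_add hn4 (by positivity),
    ENNReal.ofReal_mul (norm_nonneg _), ofReal_norm]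
  refine (mul_le_mul_right (add_le_add h4 (mul_le_mul_right h3 _)) _).trans (le_of_eq ?_)
  have e : ENNReal.ofReal (224 * diskMass⁻¹) = ENNReal.ofReal (28 * diskMass⁻¹) * 8 := by
    rw [show 224 * diskMass⁻¹ = (28 * diskMass⁻¹) * 8 by ring, ENNReal.ofReal_mul (by positivity),
      ENNReal.ofReal_ofNat]
  rw [e]
  ring

end

lemma norm_conj_mul_lt_one {z ζ : ℂ} (hz : z ∈ ball (0 : ℂ) 1) (hζ : ζ ∈ ball (0 : ℂ) 1) :
    ‖conj ζ * z‖ < 1 := by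
  rw [mem_ball_zero_iff] at hz hζ
  rw [norm_mul, RCLike.norm_conj]
  exact mul_lt_one_of_nonneg_of_lt_one_left (norm_nonneg _) hζ hz.le

lemma re_one_sub_conj_mul_pos {z ζ : ℂ} (hz : z ∈ ball (0 : ℂ) 1) (hζ : ζ ∈ ball (0 : ℂ) 1) :
    0 < (1 - conj ζ * z).re := by
  have h1 := (re_le_norm (conj ζ * z)).trans_lt (norm_conj_mul_lt_one hz hζ)
  rw [sub_re, one_re]
  linarith

lemma cos_mul_rpow_le_re_cpow {x : ℂ} (hx : 0 < x.re) :
    Real.cos (3 * Real.pi / 8) * ‖x‖ ^ (-(3 / 4) : ℝ) ≤ (x ^ ((-(3 / 4) : ℝ) : ℂ)).re := by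
  rw [cpow_ofReal_re, mul_comm]
  have h := abs_le.1 (abs_arg_lt_pi_div_two_iff.2 (.inl hx)).le
  have hpi := Real.pi_pos
  gcongr
  rw [← Real.cos_abs (x.arg * _)]
  refine Real.cos_le_cos_of_nonneg_of_le_pi (abs_nonneg _) (by linarith) ?_
  rw [abs_mul]
  have := abs_le.2 h
  norm_num
  linarith

lemma cos_three_pi_div_eight_pos : 0 < Real.cos (3 * Real.pi / 8) :=
  Real.cos_pos_of_mem_Ioo ⟨by linarith [Real.pi_pos], by linarith [Real.pi_pos]⟩

/-- The holomorphic majorant of the integral operator with kernel `mildKernel`. -/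
noncomputable def mildTransform (p : ℂ → ℝ) (z : ℂ) : ℂ :=
  ∫ ζ in ball (0 : ℂ) 1, (1 - conj ζ * z) ^ ((-(3 / 4) : ℝ) : ℂ) * (p ζ : ℂ)

lemma continuousOn_cpow_szego {z : ℂ} (hz : z ∈ ball (0 : ℂ) 1) (c : ℂ) :
    ContinuousOn (fun ζ => (1 - conj ζ * z) ^ c) (ball 0 1) := by
  refine ContinuousOn.cpow_const (Continuous.continuousOn (by fun_prop)) fun ζ hζ => ?_
  exact .inl (re_one_sub_conj_mul_pos hz hζ)

lemma norm_cpow_szego_le {z ζ : ℂ} {r a : ℝ} (hr : r < 1) (ha : a ≤ 0) (hz : z ∈ ball (0 : ℂ) r)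
    (hζ : ζ ∈ ball (0 : ℂ) 1) : ‖(1 - conj ζ * z) ^ (a : ℂ)‖ ≤ (1 - r) ^ a := by
  rw [norm_cpow_real]
  refine Real.rpow_le_rpow_of_nonpos (by linarith) ?_ ha
  rw [mem_ball_zero_iff] at hz hζ
  have h1 : ‖conj ζ * z‖ ≤ r := by
    rw [norm_mul, RCLike.norm_conj]
    nlinarith [norm_nonneg ζ, norm_nonneg z]
  have h2 := norm_sub_norm_le (1 : ℂ) (conj ζ * z)
  rw [norm_one] at h2
  linarith

lemma integrableOn_cpow_szego_mul {p : ℂ → ℝ} (hp : IntegrableOn p (ball 0 1)) {z : ℂ} {a : ℝ}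
    (ha : a ≤ 0) (hz : z ∈ ball (0 : ℂ) 1) :
    IntegrableOn (fun ζ => (1 - conj ζ * z) ^ (a : ℂ) * (p ζ : ℂ)) (ball 0 1) := by
  obtain ⟨r, hzr, hr1⟩ := exists_between (mem_ball_zero_iff.1 hz)
  refine Integrable.bdd_mul (c := (1 - r) ^ a) hp.ofReal
    ((continuousOn_cpow_szego hz _).aestronglyMeasurable measurableSet_ball) ?_
  filter_upwards [ae_restrict_mem measurableSet_ball] with ζ hζ
  exact norm_cpow_szego_le hr1 ha (mem_ball_zero_iff.2 hzr) hζ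

lemma hasDerivAt_mildTransform {p : ℂ → ℝ} (hp : IntegrableOn p (ball 0 1)) {z : ℂ}
    (hz : z ∈ ball (0 : ℂ) 1) : HasDerivAt (mildTransform p)
      (∫ ζ in ball (0 : ℂ) 1, (3 / 4 * conj ζ) * (1 - conj ζ * z) ^ ((-(7 / 4) : ℝ) : ℂ) *
        (p ζ : ℂ)) z := by
  obtain ⟨r, hzr, hr1⟩ := exists_between (mem_ball_zero_iff.1 hz)
  have hsub : ball (0 : ℂ) r ⊆ ball 0 1 := ball_subset_ball hr1.le
  refine (hasDerivAt_integral_of_dominated_loc_of_deriv_le (μ := volume.restrict (ball 0 1))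
    (F := fun z ζ => (1 - conj ζ * z) ^ ((-(3 / 4) : ℝ) : ℂ) * (p ζ : ℂ))
    (F' := fun z ζ => (3 / 4 * conj ζ) * (1 - conj ζ * z) ^ ((-(7 / 4) : ℝ) : ℂ) * (p ζ : ℂ))
    (bound := fun ζ => (1 - r) ^ (-(7 / 4) : ℝ) * ‖p ζ‖)
    (isOpen_ball.mem_nhds (mem_ball_zero_iff.2 hzr)) ?_ ?_ ?_ ?_ ?_ ?_).2
  · filter_upwards [isOpen_ball.mem_nhds hz] with x hx
    exact (integrableOn_cpow_szego_mul hp (by norm_num) hx).aestronglyMeasurable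
  · exact integrableOn_cpow_szego_mul hp (by norm_num) hz
  · simp only [mul_assoc]
    refine AEStronglyMeasurable.const_mul (.mul ?_ ?_) _
    · exact (by fun_prop : Continuous fun ζ : ℂ => conj ζ).aestronglyMeasurable
    · exact (integrableOn_cpow_szego_mul hp (by norm_num) hz).aestronglyMeasurable
  · filter_upwards [ae_restrict_mem measurableSet_ball] with ζ hζ x hx
    have h1 := norm_cpow_szego_le hr1 (a := -(7 / 4)) (by norm_num) hx hζ
    have h2 : ‖3 / 4 * conj ζ‖ ≤ 1 := by
      rw [norm_mul, RCLike.norm_conj]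
      have := (mem_ball_zero_iff.1 hζ).le
      norm_num
      linarith
    rw [norm_mul, norm_mul, norm_real]
    gcongr
    calc _ ≤ 1 * (1 - r) ^ (-(7 / 4) : ℝ) := by gcongr
      _ = _ := one_mul _
  · exact hp.norm.const_mul _
  · filter_upwards [ae_restrict_mem measurableSet_ball] with ζ hζ x hx
    have h1 : HasDerivAt (fun x => 1 - conj ζ * x) (-(conj ζ * 1)) x :=
      ((hasDerivAt_id' x).const_mul _).const_sub 1
    have h2 := (h1.cpow_const (c := ((-(3 / 4) : ℝ) : ℂ))
      (.inl (re_one_sub_conj_mul_pos (hsub hx) hζ))).mul_const (p ζ : ℂ)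
    have e : ((-(3 / 4) : ℝ) : ℂ) - 1 = ((-(7 / 4) : ℝ) : ℂ) := by push_cast; ring
    rw [e] at h2
    convert! h2 using 1
    generalize (1 - conj ζ * x) ^ ((-(7 / 4) : ℝ) : ℂ) = q
    push_cast
    ring

lemma ofReal_lintegral_mildKernel_le {κ : ℂ → ℝ} (hκ : ∀ ζ ∈ ball (0 : ℂ) 1, 0 ≤ κ ζ)
    (hp : IntegrableOn (fun ζ => (1 - ‖ζ‖ ^ 2) ^ (-(1 / 4) : ℝ) * κ ζ) (ball 0 1)) {z : ℂ}
    (hz : z ∈ ball (0 : ℂ) 1) :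
    ∫⁻ ζ in ball (0 : ℂ) 1, ENNReal.ofReal (mildKernel z ζ) * ENNReal.ofReal (κ ζ) ≤
      ENNReal.ofReal (Real.cos (3 * Real.pi / 8))⁻¹ *
        ‖mildTransform (fun ζ => (1 - ‖ζ‖ ^ 2) ^ (-(1 / 4) : ℝ) * κ ζ) z‖ₑ := by
  set p : ℂ → ℝ := fun ζ => (1 - ‖ζ‖ ^ 2) ^ (-(1 / 4) : ℝ) * κ ζ with hpdef
  have hp0 : ∀ ζ ∈ ball (0 : ℂ) 1, 0 ≤ p ζ := fun ζ hζ => by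
    have := one_sub_sq_pos hζ
    have := hκ ζ hζ
    positivity
  set c := Real.cos (3 * Real.pi / 8) with hc
  have hc0 : 0 < c := cos_three_pi_div_eight_pos
  have hint := integrableOn_cpow_szego_mul hp (a := -(3 / 4)) (by norm_num) hz
  have hre : ∫ ζ in ball (0 : ℂ) 1, ((1 - conj ζ * z) ^ ((-(3 / 4) : ℝ) : ℂ) * (p ζ : ℂ)).re =
      (mildTransform p z).re := integral_re hint
  have hle : ∀ ζ ∈ ball (0 : ℂ) 1, mildKernel z ζ * κ ζ ≤
      c⁻¹ * ((1 - conj ζ * z) ^ ((-(3 / 4) : ℝ) : ℂ) * (p ζ : ℂ)).re := fun ζ hζ => by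
    have h1 := cos_mul_rpow_le_re_cpow (re_one_sub_conj_mul_pos hz hζ)
    have h2 := hp0 ζ hζ
    rw [re_mul_ofReal, le_inv_mul_iff₀ hc0, mildKernel]
    calc _ = (c * ‖1 - conj ζ * z‖ ^ (-(3 / 4) : ℝ)) * p ζ := by rw [hpdef]; ring
      _ ≤ _ := by gcongr
  have hm0 : ∀ ζ ∈ ball (0 : ℂ) 1, 0 ≤ mildKernel z ζ := fun ζ hζ => by
    have := one_sub_sq_pos hζ
    unfold mildKernel
    positivity
  calc _ ≤ ∫⁻ ζ in ball (0 : ℂ) 1, ENNReal.ofReal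
        (c⁻¹ * ((1 - conj ζ * z) ^ ((-(3 / 4) : ℝ) : ℂ) * (p ζ : ℂ)).re) := by
        refine setLIntegral_mono' measurableSet_ball fun ζ hζ => ?_
        rw [← ENNReal.ofReal_mul (hm0 ζ hζ)]
        exact ENNReal.ofReal_le_ofReal (hle ζ hζ)
    _ = ENNReal.ofReal (c⁻¹ * (mildTransform p z).re) := by
        rw [← hre, ← integral_const_mul, ofReal_integral_eq_lintegral_ofReal]
        · exact hint.re.const_mul _
        · filter_upwards [ae_restrict_mem measurableSet_ball] with ζ hζ
          exact (mul_nonneg (hm0 ζ hζ) (hκ ζ hζ)).trans (hle ζ hζ)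
    _ ≤ ENNReal.ofReal (c⁻¹ * ‖mildTransform p z‖) := by
        gcongr
        exact re_le_norm _
    _ = _ := by rw [ENNReal.ofReal_mul (by positivity), ofReal_norm]

lemma enorm_deriv_mildTransform_le {κ : ℂ → ℝ} (hκ : ∀ ζ ∈ ball (0 : ℂ) 1, 0 ≤ κ ζ)
    (hp : IntegrableOn (fun ζ => (1 - ‖ζ‖ ^ 2) ^ (-(1 / 4) : ℝ) * κ ζ) (ball 0 1)) {z : ℂ}
    (hz : z ∈ ball (0 : ℂ) 1) :
    ‖deriv (mildTransform (fun ζ => (1 - ‖ζ‖ ^ 2) ^ (-(1 / 4) : ℝ) * κ ζ)) z‖ₑ ≤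
      ∫⁻ ζ in ball (0 : ℂ) 1, ENNReal.ofReal (schurKernel z ζ) * ENNReal.ofReal (κ ζ) := by
  rw [(hasDerivAt_mildTransform hp hz).deriv]
  refine (enorm_integral_le_lintegral_enorm _).trans ?_
  refine setLIntegral_mono' measurableSet_ball fun ζ hζ => ?_
  have h0 := one_sub_sq_pos hζ
  have h1 := hκ ζ hζ
  have h2 : ‖3 / 4 * conj ζ‖ ≤ 1 := by
    rw [norm_mul, RCLike.norm_conj]
    have := (mem_ball_zero_iff.1 hζ).le
    norm_num
    linarith
  have h3 : 0 ≤ schurKernel z ζ := by unfold schurKernel; positivity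
  rw [← ENNReal.ofReal_mul h3, ← ofReal_norm]
  refine ENNReal.ofReal_le_ofReal ?_
  rw [norm_mul, norm_mul, norm_real, norm_cpow_real, Real.norm_of_nonneg (by positivity),
    schurKernel]
  calc _ ≤ 1 * ‖1 - conj ζ * z‖ ^ (-(7 / 4) : ℝ) * ((1 - ‖ζ‖ ^ 2) ^ (-(1 / 4) : ℝ) * κ ζ) := by
        gcongr
    _ = _ := by ring

/-- Positive square-integrable densities have `mildKernel` potentials dominated by functions
in the Dirichlet space. -/
lemma exists_mildKernel_majorant : ∃ C : ℝ, 0 ≤ C ∧ ∀ κ : ℂ → ℝ,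
    (∀ ζ ∈ ball (0 : ℂ) 1, 0 ≤ κ ζ) → AEMeasurable κ (volume.restrict (ball 0 1)) →
    ∫⁻ ζ in ball (0 : ℂ) 1, ENNReal.ofReal (κ ζ) ^ 2 ≠ ∞ →
    ∃ V : ℂ → ℂ, MemDirichlet V ∧
      ENNReal.ofReal (dirNormSq V) ≤
        ENNReal.ofReal C * ∫⁻ ζ in ball (0 : ℂ) 1, ENNReal.ofReal (κ ζ) ^ 2 ∧
      ∀ z ∈ ball (0 : ℂ) 1,
        ∫⁻ ζ in ball (0 : ℂ) 1, ENNReal.ofReal (mildKernel z ζ) * ENNReal.ofReal (κ ζ) ≤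
          ENNReal.ofReal C * ‖V z‖ₑ := by
  obtain ⟨C₁, hC₁, h₁⟩ := exists_lintegral_weight_le (a := -(1 / 2)) (by norm_num) (by norm_num)
  obtain ⟨C₂, hC₂, h₂⟩ := exists_schurKernel_bound
  have hc0 := cos_three_pi_div_eight_pos
  set c := Real.cos (3 * Real.pi / 8) with hc
  have h₁' : ∫⁻ ζ in ball (0 : ℂ) 1, ENNReal.ofReal ((1 - ‖ζ‖ ^ 2) ^ (-(1 / 4) : ℝ)) ^ 2 ≤
      ENNReal.ofReal C₁ := by
    have := h₁ 0 (by simp)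
    simp only [mul_zero, sub_zero, norm_one, Real.one_rpow, mul_one, norm_zero, ne_eq,
      OfNat.ofNat_ne_zero, not_false_eq_true, zero_pow] at this
    refine (setLIntegral_mono' measurableSet_ball fun ζ hζ => ?_).trans this
    have h0 := one_sub_sq_pos hζ
    rw [← ENNReal.ofReal_pow (by positivity), ← Real.rpow_mul_natCast h0.le]
    norm_num
  have hwm : AEMeasurable (fun ζ : ℂ => (1 - ‖ζ‖ ^ 2) ^ (-(1 / 4) : ℝ))
      (volume.restrict (ball 0 1)) := by fun_prop
  refine ⟨max (C₁ + C₂) c⁻¹, by positivity, fun κ hκ hκm hκ2 => ?_⟩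
  have hcs := lintegral_mul_sq_le hwm.ennreal_ofReal hκm.ennreal_ofReal
  have hcs' := hcs.trans (mul_le_mul_left h₁' _)
  have hp : IntegrableOn (fun ζ => (1 - ‖ζ‖ ^ 2) ^ (-(1 / 4) : ℝ) * κ ζ) (ball 0 1) := by
    refine ⟨(hwm.mul hκm).aestronglyMeasurable, ?_⟩
    have e : ∫⁻ ζ in ball (0 : ℂ) 1, ‖(1 - ‖ζ‖ ^ 2) ^ (-(1 / 4) : ℝ) * κ ζ‖ₑ =
        ∫⁻ ζ in ball (0 : ℂ) 1, ENNReal.ofReal ((1 - ‖ζ‖ ^ 2) ^ (-(1 / 4) : ℝ)) *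
          ENNReal.ofReal (κ ζ) := by
      refine setLIntegral_congr_fun measurableSet_ball fun ζ hζ => ?_
      have h0 := one_sub_sq_pos hζ
      have h1 := hκ ζ hζ
      rw [Real.enorm_of_nonneg (by positivity), ENNReal.ofReal_mul (by positivity)]
    rw [HasFiniteIntegral, e]
    by_contra! htop
    rw [top_le_iff.1 htop] at hcs'
    exact ENNReal.mul_ne_top ENNReal.ofReal_ne_top hκ2 (top_le_iff.1 (by simpa using hcs'))
  set p : ℂ → ℝ := fun ζ => (1 - ‖ζ‖ ^ 2) ^ (-(1 / 4) : ℝ) * κ ζ with hpdef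
  have hdiff : DifferentiableOn ℂ (mildTransform p) (ball 0 1) := fun z hz =>
    (hasDerivAt_mildTransform hp hz).differentiableAt.differentiableWithinAt
  have hzero : ‖mildTransform p 0‖ₑ ^ 2 ≤
      ENNReal.ofReal C₁ * ∫⁻ ζ in ball (0 : ℂ) 1, ENNReal.ofReal (κ ζ) ^ 2 := by
    refine le_trans (pow_le_pow_left' ?_ 2) hcs'
    refine (enorm_integral_le_lintegral_enorm _).trans ?_
    refine setLIntegral_mono' measurableSet_ball fun ζ hζ => ?_
    have h0 := one_sub_sq_pos hζ
    have h1 := hκ ζ hζ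
    simp only [mul_zero, sub_zero, one_cpow, one_mul]
    rw [← ENNReal.ofReal_mul (by positivity), ← ofReal_norm, norm_real,
      Real.norm_of_nonneg (by positivity)]
  have hderiv : ∫⁻ z in ball (0 : ℂ) 1, ‖deriv (mildTransform p) z‖ₑ ^ 2 ≤
      ENNReal.ofReal C₂ * ∫⁻ ζ in ball (0 : ℂ) 1, ENNReal.ofReal (κ ζ) ^ 2 := by
    refine le_trans (setLIntegral_mono' measurableSet_ball fun ζ hζ => ?_)
      (h₂ _ hκm.ennreal_ofReal)
    exact pow_le_pow_left' (enorm_deriv_mildTransform_le hκ hp hζ) 2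
  have htot := (tsum_ofReal_dirCoeff_le hdiff).trans (add_le_add hzero hderiv)
  rw [← add_mul, ← ENNReal.ofReal_add hC₁ hC₂] at htot
  have hmem : MemDirichlet (mildTransform p) := memDirichlet_of_tsum_ne_top hdiff
    (ne_top_of_le_ne_top (ENNReal.mul_ne_top ENNReal.ofReal_ne_top hκ2) htot)
  rw [tsum_ofReal_dirCoeff_eq hmem] at htot
  refine ⟨mildTransform p, hmem, htot.trans ?_, fun z hz => ?_⟩
  · gcongr
    exact le_max_left _ _
  · refine (ofReal_lintegral_mildKernel_le hκ hp hz).trans ?_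
    gcongr
    exact le_max_right _ _

section

variable {E : Type*} [NormedAddCommGroup E] [InnerProductSpace ℂ E] [CompleteSpace E]
  {F : ℂ → E}

lemma ENNReal_add_sq_le (a b : ℝ≥0∞) : (a + b) ^ 2 ≤ 2 * (a ^ 2 + b ^ 2) := by
  have h := ENNReal.rpow_add_le_mul_rpow_add_rpow a b (p := 2) (by norm_num)
  norm_num at h
  exact_mod_cast h

/-- `‖F'‖² dA` is a Carleson measure for the Dirichlet space, with constant `C`. -/
def IsCarleson (F : ℂ → E) (C : ℝ) : Prop :=
  ∀ h, MemDirichlet h → ∫⁻ z in ball (0 : ℂ) 1, ‖deriv F z‖ₑ ^ 2 * ‖h z‖ₑ ^ 2 ≤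
    ENNReal.ofReal C * ENNReal.ofReal (dirNormSq h)

lemma IsCarleson.exists_sol_bound (hF : DifferentiableOn ℂ F (ball 0 1)) {C₀ : ℝ}
    (hC : IsCarleson F C₀) : ∃ C : ℝ, 0 ≤ C ∧ ∀ (g : ℂ → ℂ) (l : ℂ → ℝ) (ε : ℝ),
      Admissible F g l → 0 < ε → ∫⁻ ζ in ball (0 : ℂ) 1, ENNReal.ofReal (l ζ) ^ 2 ≠ ∞ →
      ‖sol F g ε 0‖ₑ ^ 2 + ∫⁻ z in ball (0 : ℂ) 1, ‖deriv (sol F g ε) z‖ₑ ^ 2 ≤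
        ENNReal.ofReal C * ∫⁻ ζ in ball (0 : ℂ) 1, ENNReal.ofReal (l ζ) ^ 2 := by
  obtain ⟨C₁, hC₁, h₁⟩ := exists_schurKernel_bound
  obtain ⟨C₂, hC₂, h₂⟩ := exists_mildKernel_majorant
  set m : ℝ≥0∞ := ENNReal.ofReal (diskMass⁻¹ * 6) ^ 2 * volume (ball (0 : ℂ) 1) +
    ENNReal.ofReal (224 * diskMass⁻¹) ^ 2 * (2 * (ENNReal.ofReal C₁ +
      ENNReal.ofReal C₂ ^ 2 * (ENNReal.ofReal C₀ * ENNReal.ofReal C₂))) with hm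
  have hm_top : m ≠ ∞ := by
    have : volume (ball (0 : ℂ) 1) ≠ ∞ := measure_ball_lt_top.ne
    finiteness
  refine ⟨m.toReal, ENNReal.toReal_nonneg, fun g l ε h hε hl => ?_⟩
  rw [ENNReal.ofReal_toReal hm_top]
  set L := ∫⁻ ζ in ball (0 : ℂ) 1, ENNReal.ofReal (l ζ) ^ 2
  have hlm : AEMeasurable l (volume.restrict (ball 0 1)) := h.integrableOn.aemeasurable
  have hzero : ‖sol F g ε 0‖ₑ ^ 2 ≤
      ENNReal.ofReal (diskMass⁻¹ * 6) ^ 2 * volume (ball (0 : ℂ) 1) * L := by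
    have h3 := ENNReal.ofReal_le_ofReal (h.norm_sol_zero_le hε)
    have hd := inv_nonneg.2 diskMass_pos.le
    rw [ofReal_norm, ← mul_assoc, ENNReal.ofReal_mul (by positivity),
      ofReal_integral_eq_lintegral_ofReal h.integrableOn
        ((ae_restrict_mem measurableSet_ball).mono h.nonneg)] at h3
    have h4 := lintegral_mul_sq_le (μ := volume.restrict (ball (0 : ℂ) 1))
      (f := fun _ => 1) aemeasurable_const hlm.ennreal_ofReal
    simp only [one_mul, one_pow, lintegral_const, Measure.restrict_apply_univ] at h4
    calc _ ≤ _ := pow_le_pow_left' h3 2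
      _ ≤ _ := by
        rw [mul_pow, mul_assoc]
        gcongr
  obtain ⟨V, hV, hVn, hVl⟩ := h₂ l h.nonneg hlm hl
  have hF' : ContinuousOn (deriv F) (ball 0 1) := (hF.deriv isOpen_ball).continuousOn
  have hbound : ∀ z ∈ ball (0 : ℂ) 1, ‖deriv (sol F g ε) z‖ₑ ^ 2 ≤
      ENNReal.ofReal (224 * diskMass⁻¹) ^ 2 * (2 * (
        (∫⁻ ζ in ball (0 : ℂ) 1, ENNReal.ofReal (schurKernel z ζ) * ENNReal.ofReal (l ζ)) ^ 2 +
        ENNReal.ofReal C₂ ^ 2 * (‖deriv F z‖ₑ ^ 2 * ‖V z‖ₑ ^ 2))) := fun z hz => by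
    refine (pow_le_pow_left' (h.enorm_deriv_sol_le hε hz) 2).trans ?_
    rw [mul_pow]
    refine mul_le_mul_right ((ENNReal_add_sq_le _ _).trans ?_) _
    gcongr
    calc _ ≤ (‖deriv F z‖ₑ * (ENNReal.ofReal C₂ * ‖V z‖ₑ)) ^ 2 := by
          gcongr
          exact hVl z hz
      _ = _ := by ring
  have hderiv : ∫⁻ z in ball (0 : ℂ) 1, ‖deriv (sol F g ε) z‖ₑ ^ 2 ≤
      ENNReal.ofReal (224 * diskMass⁻¹) ^ 2 * (2 * (ENNReal.ofReal C₁ * L +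
        ENNReal.ofReal C₂ ^ 2 * (ENNReal.ofReal C₀ * (ENNReal.ofReal C₂ * L)))) := by
    refine (setLIntegral_mono' measurableSet_ball hbound).trans ?_
    rw [lintegral_const_mul' _ _ (by finiteness), lintegral_const_mul' _ _ (by finiteness),
      lintegral_add_right', lintegral_const_mul' _ _ (by finiteness)]
    · gcongr
      · exact h₁ _ hlm.ennreal_ofReal
      · refine (hC V hV).trans ?_
        gcongr
    · have m1 : AEMeasurable (fun z => ‖deriv F z‖ₑ) (volume.restrict (ball 0 1)) :=
        hF'.enorm.aemeasurable measurableSet_ball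
      have m2 : AEMeasurable (fun z => ‖V z‖ₑ) (volume.restrict (ball 0 1)) :=
        hV.1.continuousOn.enorm.aemeasurable measurableSet_ball
      exact ((m1.pow_const 2).mul (m2.pow_const 2)).const_mul _
  refine (add_le_add hzero hderiv).trans (le_of_eq ?_)
  rw [hm]
  ring

end

/-- Square-summable complex families. -/
abbrev Ell2 (ι : Type*) : Type _ := lp (fun _ : ι => ℂ) 2

section

variable {ι : Type*}

lemma enorm_sq_eq_ofReal (x : ℂ) : ‖x‖ₑ ^ 2 = ENNReal.ofReal (‖x‖ ^ 2) := by
  rw [ENNReal.ofReal_pow (norm_nonneg _), ofReal_norm]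

lemma summable_norm_sq_of_tsum_ne_top {x : ι → ℂ} (hx : ∑' i, ‖x i‖ₑ ^ 2 ≠ ∞) :
    Summable fun i => ‖x i‖ ^ 2 := by
  simp only [enorm_sq_eq_ofReal] at hx
  exact (ENNReal.summable_toReal hx).congr fun i => ENNReal.toReal_ofReal (by positivity)

lemma memEll2_of_tsum_ne_top {x : ι → ℂ} (hx : ∑' i, ‖x i‖ₑ ^ 2 ≠ ∞) :
    Memℓp x 2 := by
  refine memℓp_gen ?_
  simpa using summable_norm_sq_of_tsum_ne_top hx

lemma Ell2.enorm_sq (x : Ell2 ι) : ‖x‖ₑ ^ 2 = ∑' i, ‖x i‖ₑ ^ 2 := by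
  have h1 := lp.norm_rpow_eq_tsum (p := 2) (by norm_num) x
  have h2 : Summable fun i => ‖x i‖ ^ 2 := by
    simpa using (memℓp_gen_iff (p := 2) (by norm_num)).1 (lp.memℓp x)
  simp only [ENNReal.toReal_ofNat, Real.rpow_ofNat] at h1
  rw [← ofReal_norm, ← ENNReal.ofReal_pow (norm_nonneg _), h1,
    ENNReal.ofReal_tsum_of_nonneg (fun i => by positivity) h2]
  simp only [enorm_sq_eq_ofReal]

lemma Ell2.enorm_sq_ne_top (x : Ell2 ι) : ∑' i, ‖x i‖ₑ ^ 2 ≠ ∞ := by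
  rw [← Ell2.enorm_sq]
  finiteness

variable [DecidableEq ι]

/-- The unit coordinate vectors. -/
noncomputable def Ell2.basis (i : ι) : Ell2 ι := lp.single 2 i 1

lemma Ell2.hasSum_apply (φ : Ell2 ι →L[ℂ] ℂ) (x : Ell2 ι) :
    HasSum (fun i => x i * φ (Ell2.basis i)) (φ x) := by
  have h := φ.hasSum (lp.hasSum_single (p := 2) (by norm_num) x)
  convert! h using 2 with i
  rw [Ell2.basis, ← smul_eq_mul, ← map_smul, ← lp.single_smul, smul_eq_mul, mul_one]

lemma Ell2.tsum_apply_basis_le (φ : Ell2 ι →L[ℂ] ℂ) :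
    ∑' i, ‖φ (Ell2.basis i)‖ₑ ^ 2 ≤ ‖φ‖ₑ ^ 2 := by
  set v := (InnerProductSpace.toDual ℂ (Ell2 ι)).symm φ with hv
  have h : ∀ i, φ (Ell2.basis i) = conj (v i) := fun i => by
    rw [← InnerProductSpace.toDual_symm_apply (𝕜 := ℂ), Ell2.basis, lp.inner_single_right]
    simp [hv]
  have hn : ‖v‖ₑ = ‖φ‖ₑ := by
    rw [← ofReal_norm, hv, LinearIsometryEquiv.norm_map, ofReal_norm]
  rw [← hn, Ell2.enorm_sq]
  refine le_of_eq (tsum_congr fun i => ?_)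
  rw [h, ← ofReal_norm, RCLike.norm_conj, ofReal_norm]

end

/-- Cauchy–Schwarz for series. -/
lemma ENNReal_tsum_mul_sq_le (f g : ℕ → ℝ≥0∞) :
    (∑' n, f n * g n) ^ 2 ≤ (∑' n, f n ^ 2) * ∑' n, g n ^ 2 := by
  simp only [← lintegral_count]
  exact lintegral_mul_sq_le (Measurable.of_discrete).aemeasurable
    (Measurable.of_discrete).aemeasurable

lemma memDirichlet_tsum {c : ℕ → ℂ} (hc : Summable fun n : ℕ => ((n : ℝ) + 1) * ‖c n‖ ^ 2) :
    MemDirichlet (fun z => ∑' n, c n * z ^ n) ∧ dirCoeff (fun z => ∑' n, c n * z ^ n) = c ∧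
      ∀ z ∈ ball (0 : ℂ) 1, HasSum (fun n => c n * z ^ n) (∑' n, c n * z ^ n) := by
  have hb : ∀ n, ‖c n‖ ≤ √(∑' n : ℕ, ((n : ℝ) + 1) * ‖c n‖ ^ 2) := fun n => by
    refine Real.le_sqrt_of_sq_le (le_trans ?_ (hc.le_tsum n fun m _ => by positivity))
    exact le_mul_of_one_le_left (by positivity) (by linarith [n.cast_nonneg (α := ℝ)])
  have hd := differentiableOn_of_bounded_coeff hb
  have he := dirCoeff_eq_of_hasSum hd fun z hz => hasSum_of_bounded_coeff hb hz
  refine ⟨⟨hd, ?_⟩, he, fun z hz => hasSum_of_bounded_coeff hb hz⟩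
  rw [he]
  exact hc

/-- The reproducing kernel of the Dirichlet space. -/
noncomputable def dirKernel (w z : ℂ) : ℂ := ∑' n : ℕ, (conj w ^ n / ((n : ℂ) + 1)) * z ^ n

lemma dirKernel_coeff (w : ℂ) (n : ℕ) :
    ((n : ℝ) + 1) * ‖conj w ^ n / ((n : ℂ) + 1)‖ ^ 2 = (‖w‖ ^ 2) ^ n / ((n : ℝ) + 1) := by
  have e : ‖(n + 1 : ℂ)‖ = n + 1 := by
    have : (n + 1 : ℂ) = ((n + 1 : ℝ) : ℂ) := by push_cast; ring
    rw [this, norm_real, Real.norm_of_nonneg (by positivity)]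
  have : (0 : ℝ) < n + 1 := by positivity
  rw [norm_div, e, norm_pow, RCLike.norm_conj]
  field_simp
  ring

lemma summable_dirKernel {w : ℂ} (hw : w ∈ ball (0 : ℂ) 1) :
    Summable fun n : ℕ => (‖w‖ ^ 2) ^ n / ((n : ℝ) + 1) := by
  have h0 := one_sub_sq_pos hw
  refine .of_nonneg_of_le (fun n => by positivity) (fun n => ?_)
    (summable_geometric_of_lt_one (r := ‖w‖ ^ 2) (by positivity) (by linarith))
  exact div_le_self (by positivity) (by linarith [n.cast_nonneg (α := ℝ)])

lemma memDirichlet_dirKernel {w : ℂ} (hw : w ∈ ball (0 : ℂ) 1) :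
    MemDirichlet (dirKernel w) ∧
      dirNormSq (dirKernel w) = ∑' n : ℕ, (‖w‖ ^ 2) ^ n / ((n : ℝ) + 1) ∧
      dirKernel w w = dirNormSq (dirKernel w) := by
  have hs : Summable fun n : ℕ => ((n : ℝ) + 1) * ‖conj w ^ n / ((n : ℂ) + 1)‖ ^ 2 := by
    simpa only [dirKernel_coeff] using summable_dirKernel hw
  obtain ⟨h1, h2, -⟩ := memDirichlet_tsum hs
  have h3 : dirNormSq (dirKernel w) = ∑' n : ℕ, (‖w‖ ^ 2) ^ n / ((n : ℝ) + 1) := by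
    unfold dirNormSq dirKernel
    rw [h2]
    simp only [dirKernel_coeff]
  refine ⟨h1, h3, ?_⟩
  rw [h3, Complex.ofReal_tsum]
  refine tsum_congr fun n => ?_
  push_cast
  rw [← conj_mul', mul_pow]
  ring

lemma enorm_sq_le_dirNormSq_mul {f : ℂ → ℂ} (hf : MemDirichlet f) {z : ℂ}
    (hz : z ∈ ball (0 : ℂ) 1) :
    ‖f z‖ₑ ^ 2 ≤ ENNReal.ofReal (dirNormSq f) * ENNReal.ofReal (dirNormSq (dirKernel z)) := by
  have h1 := ENNReal_tsum_mul_sq_le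
    (fun n : ℕ => ENNReal.ofReal (√((n : ℝ) + 1) * ‖dirCoeff f n‖))
    (fun n : ℕ => ENNReal.ofReal (‖z‖ ^ n / √((n : ℝ) + 1)))
  have e1 : ∀ n : ℕ, ENNReal.ofReal (√((n : ℝ) + 1) * ‖dirCoeff f n‖) ^ 2 =
      ENNReal.ofReal (((n : ℝ) + 1) * ‖dirCoeff f n‖ ^ 2) := fun n => by
    rw [← ENNReal.ofReal_pow (by positivity), mul_pow, Real.sq_sqrt (by positivity)]
  have e2 : ∀ n : ℕ, ENNReal.ofReal (‖z‖ ^ n / √((n : ℝ) + 1)) ^ 2 =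
      ENNReal.ofReal ((‖z‖ ^ 2) ^ n / ((n : ℝ) + 1)) := fun n => by
    rw [← ENNReal.ofReal_pow (by positivity), div_pow, Real.sq_sqrt (by positivity)]
    ring_nf
  have e3 : ∀ n : ℕ, ENNReal.ofReal (√((n : ℝ) + 1) * ‖dirCoeff f n‖) *
      ENNReal.ofReal (‖z‖ ^ n / √((n : ℝ) + 1)) = ‖dirCoeff f n * z ^ n‖ₑ := fun n => by
    have : 0 < √((n : ℝ) + 1) := Real.sqrt_pos.2 (by positivity)
    rw [← ENNReal.ofReal_mul (by positivity), ← ofReal_norm, norm_mul, norm_pow]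
    congr 1
    field_simp
  simp only [e1, e2, e3] at h1
  rw [tsum_ofReal_dirCoeff_eq hf, ← ENNReal.ofReal_tsum_of_nonneg (fun n => by positivity)
    (summable_dirKernel hz), ← (memDirichlet_dirKernel hz).2.1] at h1
  refine le_trans (pow_le_pow_left' ?_ 2) h1
  rw [← (hasSum_dirCoeff hf.1 hz).tsum_eq]
  exact enorm_tsum_le_tsum_enorm

lemma memDirichlet_one : MemDirichlet (fun _ => 1) ∧ dirNormSq (fun _ => 1) = 1 := by
  have hd : DifferentiableOn ℂ (fun _ : ℂ => (1 : ℂ)) (ball 0 1) := by fun_prop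
  have h : dirCoeff (fun _ => 1) = fun n => if n = 0 then 1 else 0 :=
    dirCoeff_eq_of_hasSum hd fun z _ => by
      convert! hasSum_ite_eq (0 : ℕ) (1 : ℂ) using 2 with n
      split_ifs with hn <;> simp [hn]
  have e : ∀ n : ℕ, ((n : ℝ) + 1) * ‖(if n = 0 then 1 else 0 : ℂ)‖ ^ 2 = if n = 0 then 1 else 0 :=
    fun n => by split_ifs with hn <;> simp [hn]
  have hs := hasSum_ite_eq (0 : ℕ) (1 : ℝ)
  refine ⟨⟨hd, ?_⟩, ?_⟩
  · rw [h]
    simpa only [e] using hs.summable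
  · rw [dirNormSq, h]
    simpa only [e] using hs.tsum_eq

lemma differentiableOn_tsum_smul {E : Type*} [NormedAddCommGroup E] [NormedSpace ℂ E]
    [CompleteSpace E] {c : ℕ → E} {C : ℝ} (hc : ∀ n, ‖c n‖ ≤ C) :
    DifferentiableOn ℂ (fun z : ℂ => ∑' n, z ^ n • c n) (ball 0 1) := by
  intro z hz
  obtain ⟨r, hzr, hr1⟩ := exists_between (mem_ball_zero_iff.1 hz)
  have hr0 : 0 ≤ r := (norm_nonneg z).trans hzr.le
  have h : DifferentiableOn ℂ (fun z : ℂ => ∑' n, z ^ n • c n) (ball 0 r) := by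
    refine differentiableOn_tsum_of_summable_norm (u := fun n => r ^ n * C)
      ((summable_geometric_of_lt_one hr0 hr1).mul_right C) (fun n => by fun_prop) isOpen_ball ?_
    intro n w hw
    rw [norm_smul, norm_pow]
    gcongr
    · exact (mem_ball_zero_iff.1 hw).le
    · exact hc n
  have hz' : z ∈ ball (0 : ℂ) r := mem_ball_zero_iff.2 hzr
  exact ((h z hz').differentiableAt (isOpen_ball.mem_nhds hz')).differentiableWithinAt

lemma summable_smul_of_bounded {E : Type*} [NormedAddCommGroup E] [NormedSpace ℂ E]
    [CompleteSpace E] {c : ℕ → E} {C : ℝ} (hc : ∀ n, ‖c n‖ ≤ C) {z : ℂ}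
    (hz : z ∈ ball (0 : ℂ) 1) : Summable fun n => z ^ n • c n := by
  refine .of_norm_bounded (g := fun n => ‖z‖ ^ n * C)
    ((summable_geometric_of_lt_one (norm_nonneg z) (mem_ball_zero_iff.1 hz)).mul_right C)
    fun n => ?_
  rw [norm_smul, norm_pow]
  gcongr
  exact hc n

section

variable {F : ℕ → ℂ → ℂ}

lemma tsum_dirNormSq_mul_le (ha : ColNormLE F 1) {h : ℂ → ℂ} (hh : MemDirichlet h) :
    ∑' j, ENNReal.ofReal (dirNormSq fun z => F j z * h z) ≤ ENNReal.ofReal (dirNormSq h) := by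
  obtain ⟨h1, h2⟩ := ha h hh
  rw [← ENNReal.ofReal_tsum_of_nonneg (fun j => dirNormSq_nonneg _) h1]
  exact ENNReal.ofReal_le_ofReal (by linarith)

lemma tsum_enorm_sq_column_le (hF : ∀ j, IsMultiplier (F j)) (ha : ColNormLE F 1) {z : ℂ}
    (hz : z ∈ ball (0 : ℂ) 1) : ∑' j, ‖F j z‖ₑ ^ 2 ≤ 1 := by
  obtain ⟨hk, hk1, hk2⟩ := memDirichlet_dirKernel hz
  set D := dirNormSq (dirKernel z) with hD
  have hD0 : 0 < D := by
    have := (summable_dirKernel hz).le_tsum 0 fun n _ => by positivity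
    rw [← hk1] at this
    norm_num at this
    linarith
  have h1 : (∑' j, ‖F j z‖ₑ ^ 2) * ENNReal.ofReal D ^ 2 ≤ 1 * ENNReal.ofReal D ^ 2 := by
    rw [← ENNReal.tsum_mul_right]
    calc ∑' j, ‖F j z‖ₑ ^ 2 * ENNReal.ofReal D ^ 2
        ≤ ∑' j, ENNReal.ofReal (dirNormSq fun w => F j w * dirKernel z w) * ENNReal.ofReal D := by
          refine ENNReal.tsum_le_tsum fun j => ?_
          have := enorm_sq_le_dirNormSq_mul ((hF j).2 _ hk) hz
          rw [hk2, enorm_mul, mul_pow] at this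
          rwa [← ofReal_norm ((D : ℝ) : ℂ), norm_real, Real.norm_of_nonneg hD0.le] at this
      _ ≤ ENNReal.ofReal D * ENNReal.ofReal D := by
          rw [ENNReal.tsum_mul_right]
          gcongr
          exact tsum_dirNormSq_mul_le ha hk
      _ = _ := by ring
  rwa [ENNReal.mul_le_mul_iff_left] at h1
  · positivity
  · finiteness

/-- The column of functions as a holomorphic `ℓ²`-valued function. -/
lemma exists_column (hF : ∀ j, IsMultiplier (F j)) (ha : ColNormLE F 1) :
    ∃ Φ : ℂ → Ell2 ℕ, DifferentiableOn ℂ Φ (ball 0 1) ∧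
      ∀ z ∈ ball (0 : ℂ) 1, ∀ j, Φ z j = F j z := by
  have hmem : ∀ j, MemDirichlet (F j) := fun j => by
    simpa using (hF j).2 _ memDirichlet_one.1
  have hsum : ∑' j, ENNReal.ofReal (dirNormSq (F j)) ≤ 1 := by
    simpa [memDirichlet_one.2] using tsum_dirNormSq_mul_le ha memDirichlet_one.1
  have hco : ∀ n, ∑' j, ‖dirCoeff (F j) n‖ₑ ^ 2 ≤ 1 := fun n => by
    refine le_trans (ENNReal.tsum_le_tsum fun j => ?_) hsum
    rw [enorm_sq_eq_ofReal]
    refine ENNReal.ofReal_le_ofReal (le_trans ?_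
      ((hmem j).2.le_tsum n fun m _ => by positivity))
    exact le_mul_of_one_le_left (by positivity) (by linarith [n.cast_nonneg (α := ℝ)])
  let a : ℕ → Ell2 ℕ := fun n =>
    ⟨fun j => dirCoeff (F j) n, memEll2_of_tsum_ne_top ((hco n).trans_lt ENNReal.one_lt_top).ne⟩
  have hn : ∀ n, ‖a n‖ ≤ 1 := fun n => by
    have h1 : ‖a n‖ₑ ^ 2 ≤ 1 := (Ell2.enorm_sq (a n)).trans_le (hco n)
    rw [← ofReal_norm, ← ENNReal.ofReal_pow (norm_nonneg _), ENNReal.ofReal_le_one] at h1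
    exact (sq_le_one_iff₀ (norm_nonneg _)).1 h1
  refine ⟨fun z => ∑' n, z ^ n • a n, differentiableOn_tsum_smul hn, fun z hz j => ?_⟩
  have h1 := (lp.evalCLM ℂ (fun _ : ℕ => ℂ) 2 j).hasSum (summable_smul_of_bounded hn hz).hasSum
  have h2 := hasSum_dirCoeff (hF j).1 hz
  refine HasSum.unique ?_ h2
  convert! h1 using 2 with n
  rw [map_smul, smul_eq_mul, mul_comm]
  rfl

variable {Φ : ℂ → Ell2 ℕ}

lemma norm_column_le (hF : ∀ j, IsMultiplier (F j)) (ha : ColNormLE F 1)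
    (he : ∀ z ∈ ball (0 : ℂ) 1, ∀ j, Φ z j = F j z) {z : ℂ} (hz : z ∈ ball (0 : ℂ) 1) :
    ‖Φ z‖ ≤ 1 := by
  have h1 := tsum_enorm_sq_column_le hF ha hz
  simp only [← he z hz, ← Ell2.enorm_sq] at h1
  rw [← ofReal_norm, ← ENNReal.ofReal_pow (norm_nonneg _), ENNReal.ofReal_le_one] at h1
  exact (sq_le_one_iff₀ (norm_nonneg _)).1 h1

lemma deriv_column_apply (hΦ : DifferentiableOn ℂ Φ (ball 0 1))
    (he : ∀ z ∈ ball (0 : ℂ) 1, ∀ j, Φ z j = F j z) {z : ℂ} (hz : z ∈ ball (0 : ℂ) 1) (j : ℕ) :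
    deriv Φ z j = deriv (F j) z := by
  have h1 := (lp.evalCLM ℂ (fun _ : ℕ => ℂ) 2 j).hasFDerivAt.comp_hasDerivAt z
    (hΦ.differentiableAt (isOpen_ball.mem_nhds hz)).hasDerivAt
  have h2 : F j =ᶠ[𝓝 z] (lp.evalCLM ℂ (fun _ : ℕ => ℂ) 2 j) ∘ Φ := by
    filter_upwards [isOpen_ball.mem_nhds hz] with w hw
    exact (he w hw j).symm
  exact ((h1.congr_of_eventuallyEq h2).deriv).symm

lemma isCarleson_column (hF : ∀ j, IsMultiplier (F j)) (ha : ColNormLE F 1)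
    (hΦ : DifferentiableOn ℂ Φ (ball 0 1)) (he : ∀ z ∈ ball (0 : ℂ) 1, ∀ j, Φ z j = F j z) :
    IsCarleson Φ (4 * Real.pi) := by
  intro h hh
  have hpi := Real.pi_pos
  have hd : ∀ j, DifferentiableOn ℂ (fun w => F j w * h w) (ball 0 1) :=
    fun j => (hF j).1.mul hh.1
  have hm : ∀ j, AEMeasurable (fun z => ‖deriv (fun w => F j w * h w) z‖ₑ ^ 2)
      (volume.restrict (ball 0 1)) := fun j =>
    (((hd j).deriv isOpen_ball).continuousOn.enorm.aemeasurable measurableSet_ball).pow_const 2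
  have hm' : AEMeasurable (fun z => ‖deriv h z‖ₑ ^ 2) (volume.restrict (ball 0 1)) :=
    ((hh.1.deriv isOpen_ball).continuousOn.enorm.aemeasurable measurableSet_ball).pow_const 2
  have hpt : ∀ z ∈ ball (0 : ℂ) 1, ‖deriv Φ z‖ₑ ^ 2 * ‖h z‖ₑ ^ 2 ≤
      2 * ((∑' j, ‖deriv (fun w => F j w * h w) z‖ₑ ^ 2) + ‖deriv h z‖ₑ ^ 2) := fun z hz => by
    rw [Ell2.enorm_sq, ← ENNReal.tsum_mul_right]
    calc ∑' j, ‖deriv Φ z j‖ₑ ^ 2 * ‖h z‖ₑ ^ 2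
        ≤ ∑' j, 2 * (‖deriv (fun w => F j w * h w) z‖ₑ ^ 2 +
            ‖F j z‖ₑ ^ 2 * ‖deriv h z‖ₑ ^ 2) := by
          refine ENNReal.tsum_le_tsum fun j => ?_
          have h1 : deriv (fun w => F j w * h w) z = deriv (F j) z * h z + F j z * deriv h z :=
            deriv_fun_mul ((hF j).1.differentiableAt (isOpen_ball.mem_nhds hz))
              (hh.1.differentiableAt (isOpen_ball.mem_nhds hz))
          have h2 : deriv (F j) z * h z =
              deriv (fun w => F j w * h w) z - F j z * deriv h z := by rw [h1]; ring
          rw [deriv_column_apply hΦ he hz, ← mul_pow, ← enorm_mul, h2]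
          refine (pow_le_pow_left' enorm_sub_le 2).trans ((ENNReal_add_sq_le _ _).trans ?_)
          rw [enorm_mul, mul_pow]
      _ = 2 * ((∑' j, ‖deriv (fun w => F j w * h w) z‖ₑ ^ 2) +
            (∑' j, ‖F j z‖ₑ ^ 2) * ‖deriv h z‖ₑ ^ 2) := by
          rw [ENNReal.tsum_mul_left, ENNReal.tsum_add, ENNReal.tsum_mul_right]
      _ ≤ 2 * ((∑' j, ‖deriv (fun w => F j w * h w) z‖ₑ ^ 2) + 1 * ‖deriv h z‖ₑ ^ 2) := by
          gcongr
          exact tsum_enorm_sq_column_le hF ha hz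
      _ = _ := by rw [one_mul]
  calc _ ≤ _ := setLIntegral_mono' measurableSet_ball hpt
    _ = 2 * ((∑' j, ∫⁻ z in ball (0 : ℂ) 1, ‖deriv (fun w => F j w * h w) z‖ₑ ^ 2) +
          ∫⁻ z in ball (0 : ℂ) 1, ‖deriv h z‖ₑ ^ 2) := by
        rw [lintegral_const_mul' _ _ (by finiteness), lintegral_add_right' _ hm', lintegral_tsum hm]
    _ ≤ 2 * ((∑' j, ENNReal.ofReal Real.pi * ENNReal.ofReal (dirNormSq fun w => F j w * h w)) +
          ENNReal.ofReal Real.pi * ENNReal.ofReal (dirNormSq h)) := by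
        gcongr with j
        · rw [← ENNReal.ofReal_mul hpi.le]
          exact lintegral_deriv_sq_le_dirNormSq ((hF j).2 h hh)
        · rw [← ENNReal.ofReal_mul hpi.le]
          exact lintegral_deriv_sq_le_dirNormSq hh
    _ ≤ 2 * (ENNReal.ofReal Real.pi * ENNReal.ofReal (dirNormSq h) +
          ENNReal.ofReal Real.pi * ENNReal.ofReal (dirNormSq h)) := by
        rw [ENNReal.tsum_mul_left]
        gcongr
        exact tsum_dirNormSq_mul_le ha hh
    _ = _ := by
        rw [ENNReal.ofReal_mul (by norm_num), ENNReal.ofReal_ofNat]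
        ring

end

lemma dirCoeff_mul {f g : ℂ → ℂ} (hf : DifferentiableOn ℂ f (ball 0 1))
    (hg : DifferentiableOn ℂ g (ball 0 1)) : dirCoeff (fun z => f z * g z) =
      fun n => ∑ p ∈ Finset.HasAntidiagonal.antidiagonal n, dirCoeff f p.1 * dirCoeff g p.2 := by
  refine dirCoeff_eq_of_hasSum (hf.mul hg) fun z hz => ?_
  change HasSum _ (f z * g z)
  have h1 := hasSum_dirCoeff hf hz
  have h2 := hasSum_dirCoeff hg hz
  have h3 := (summable_norm_sum_mul_antidiagonal_of_summable_norm h1.summable.norm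
    h2.summable.norm).of_norm.hasSum
  rw [← tsum_mul_tsum_eq_tsum_sum_antidiagonal_of_summable_norm h1.summable.norm
    h2.summable.norm, h1.tsum_eq, h2.tsum_eq] at h3
  convert! h3 using 2 with n
  rw [Finset.sum_mul]
  refine Finset.sum_congr rfl fun p hp => ?_
  rw [← Finset.HasAntidiagonal.mem_antidiagonal.1 hp]
  ring

lemma ofReal_dirWeight_mul (n : ℕ) (c : ℂ) :
    ‖((√((n : ℝ) + 1) : ℝ) : ℂ) * c‖ₑ ^ 2 = ENNReal.ofReal (((n : ℝ) + 1) * ‖c‖ ^ 2) := by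
  rw [enorm_sq_eq_ofReal, norm_mul, norm_real, mul_pow, Real.norm_of_nonneg (Real.sqrt_nonneg _),
    Real.sq_sqrt (by positivity)]

lemma sqrt_succ_ne_zero (n : ℕ) : ((√((n : ℝ) + 1) : ℝ) : ℂ) ≠ 0 := by
  have : √((n : ℝ) + 1) ≠ 0 := (Real.sqrt_pos.2 (by positivity)).ne'
  exact_mod_cast this

lemma summable_dirWeight_of_ell2 {x : ℕ → ℂ} (hx : ∑' n, ‖x n‖ₑ ^ 2 ≠ ∞) :
    Summable fun n : ℕ => ((n : ℝ) + 1) * ‖((√((n : ℝ) + 1) : ℝ) : ℂ)⁻¹ * x n‖ ^ 2 := by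
  refine (summable_norm_sq_of_tsum_ne_top hx).congr fun n => ?_
  have h : (0 : ℝ) < (n : ℝ) + 1 := by positivity
  rw [norm_mul, norm_inv, norm_real, Real.norm_of_nonneg (Real.sqrt_nonneg _), mul_pow, inv_pow,
    Real.sq_sqrt h.le]
  field_simp

lemma tsum_dirWeight_ne_top {h : ℂ → ℂ} (hh : MemDirichlet h) :
    ∑' n : ℕ, ‖((√((n : ℝ) + 1) : ℝ) : ℂ) * dirCoeff h n‖ₑ ^ 2 ≠ ∞ := by
  simp only [ofReal_dirWeight_mul, tsum_ofReal_dirCoeff_eq hh]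
  finiteness

/-- The isometric image of a Dirichlet function in `ℓ²`. -/
noncomputable def dirVec (h : ℂ → ℂ) (hh : MemDirichlet h) : Ell2 ℕ :=
  ⟨_, memEll2_of_tsum_ne_top (tsum_dirWeight_ne_top hh)⟩

lemma enorm_dirVec_sq {h : ℂ → ℂ} (hh : MemDirichlet h) :
    ‖dirVec h hh‖ₑ ^ 2 = ENNReal.ofReal (dirNormSq h) := by
  rw [Ell2.enorm_sq, ← tsum_ofReal_dirCoeff_eq hh]
  exact tsum_congr fun n => ofReal_dirWeight_mul n _

/-- The function in the Dirichlet space represented by an `ℓ²` sequence. -/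
noncomputable def dirFun (x : ℕ → ℂ) (z : ℂ) : ℂ :=
  ∑' n : ℕ, ((√((n : ℝ) + 1) : ℝ) : ℂ)⁻¹ * x n * z ^ n

lemma dirFun_spec {x : ℕ → ℂ} (hx : ∑' n, ‖x n‖ₑ ^ 2 ≠ ∞) :
    MemDirichlet (dirFun x) ∧
      dirCoeff (dirFun x) = (fun n : ℕ => ((√((n : ℝ) + 1) : ℝ) : ℂ)⁻¹ * x n) ∧
      ∀ z ∈ ball (0 : ℂ) 1,
        HasSum (fun n : ℕ => ((√((n : ℝ) + 1) : ℝ) : ℂ)⁻¹ * x n * z ^ n) (dirFun x z) :=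
  memDirichlet_tsum (summable_dirWeight_of_ell2 hx)

lemma ofReal_dirNormSq_dirFun {x : ℕ → ℂ} (hx : ∑' n, ‖x n‖ₑ ^ 2 ≠ ∞) :
    ENNReal.ofReal (dirNormSq (dirFun x)) = ∑' n, ‖x n‖ₑ ^ 2 := by
  obtain ⟨h1, h2, -⟩ := dirFun_spec hx
  rw [← tsum_ofReal_dirCoeff_eq h1, h2]
  refine tsum_congr fun n => ?_
  rw [← ofReal_dirWeight_mul, mul_inv_cancel_left₀ (sqrt_succ_ne_zero n)]

section

variable {H : ℂ → ℂ}

lemma multiplier_coeff (hH : IsMultiplier H) {x : ℕ → ℂ} (hx : ∑' n, ‖x n‖ₑ ^ 2 ≠ ∞) :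
    dirCoeff (fun z => H z * dirFun x z) = fun n => ∑ p ∈ Finset.HasAntidiagonal.antidiagonal n,
      dirCoeff H p.1 * (((√((p.2 : ℝ) + 1) : ℝ) : ℂ)⁻¹ * x p.2) := by
  obtain ⟨h1, h2, -⟩ := dirFun_spec hx
  rw [dirCoeff_mul hH.1 h1.1, h2]

lemma memEll2_multiplier (hH : IsMultiplier H) {x : ℕ → ℂ} (hx : ∑' n, ‖x n‖ₑ ^ 2 ≠ ∞) :
    Memℓp (fun n : ℕ => ((√((n : ℝ) + 1) : ℝ) : ℂ) * ∑ p ∈ Finset.HasAntidiagonal.antidiagonal n,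
      dirCoeff H p.1 * (((√((p.2 : ℝ) + 1) : ℝ) : ℂ)⁻¹ * x p.2)) 2 := by
  refine memEll2_of_tsum_ne_top ?_
  have := tsum_dirWeight_ne_top (hH.2 _ (dirFun_spec hx).1)
  rwa [multiplier_coeff hH hx] at this

/-- Multiplication by `H`, transported to `ℓ²`. -/
noncomputable def multiplierMap (hH : IsMultiplier H) : Ell2 ℕ →ₗ[ℂ] Ell2 ℕ where
  toFun x := ⟨_, memEll2_multiplier hH (Ell2.enorm_sq_ne_top x)⟩
  map_add' x y := by
    ext n
    simp only [lp.coeFn_add, Pi.add_apply, mul_add, Finset.sum_add_distrib]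
  map_smul' c x := by
    ext n
    simp only [lp.coeFn_smul, Pi.smul_apply, smul_eq_mul, RingHom.id_apply, Finset.mul_sum]
    exact Finset.sum_congr rfl fun p _ => by ring

lemma multiplierMap_apply (hH : IsMultiplier H) (x : Ell2 ℕ) (n : ℕ) :
    multiplierMap hH x n = ((√((n : ℝ) + 1) : ℝ) : ℂ) * ∑ p ∈ Finset.HasAntidiagonal.antidiagonal n,
      dirCoeff H p.1 * (((√((p.2 : ℝ) + 1) : ℝ) : ℂ)⁻¹ * x p.2) := rfl

lemma continuous_multiplierMap (hH : IsMultiplier H) : Continuous (multiplierMap hH) := by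
  refine LinearMap.continuous_of_seq_closed_graph _ fun u x y hu hy => ?_
  ext n
  have hev : ∀ {v : ℕ → Ell2 ℕ} {w : Ell2 ℕ}, Filter.Tendsto v Filter.atTop (𝓝 w) → ∀ m,
      Filter.Tendsto (fun k => v k m) Filter.atTop (𝓝 (w m)) := fun {v w} h m =>
    ((lp.evalCLM ℂ (fun _ : ℕ => ℂ) 2 m).continuous.tendsto w).comp h
  refine tendsto_nhds_unique (hev hy n) ?_
  simp only [Function.comp_apply, multiplierMap_apply]
  exact (tendsto_finsetSum _ fun p _ => ((hev hu p.2).const_mul _).const_mul _).const_mul _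

/-- Multipliers act boundedly on the Dirichlet space. -/
lemma exists_multiplier_bound (hH : IsMultiplier H) : ∃ C : ℝ, 0 ≤ C ∧ ∀ h, MemDirichlet h →
    ENNReal.ofReal (dirNormSq fun z => H z * h z) ≤
      ENNReal.ofReal C * ENNReal.ofReal (dirNormSq h) := by
  let T : Ell2 ℕ →L[ℂ] Ell2 ℕ := ⟨multiplierMap hH, continuous_multiplierMap hH⟩
  refine ⟨‖T‖ ^ 2, by positivity, fun h hh => ?_⟩
  have e : T (dirVec h hh) = dirVec _ (hH.2 h hh) := by
    ext n
    change multiplierMap hH (dirVec h hh) n =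
      ((√((n : ℝ) + 1) : ℝ) : ℂ) * dirCoeff (fun z => H z * h z) n
    rw [multiplierMap_apply, dirCoeff_mul hH.1 hh.1]
    congr 1
    refine Finset.sum_congr rfl fun p _ => ?_
    change _ * (_ * (((√((p.2 : ℝ) + 1) : ℝ) : ℂ) * dirCoeff h p.2)) = _
    rw [inv_mul_cancel_left₀ (sqrt_succ_ne_zero _)]
  rw [← enorm_dirVec_sq hh, ← enorm_dirVec_sq (hH.2 h hh), ← e,
    ENNReal.ofReal_pow (norm_nonneg _), ofReal_norm, ← mul_pow]
  exact pow_le_pow_left' (T.le_opENorm _) 2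

lemma exists_multiplier_carleson (hH : IsMultiplier H)
    (hb : ∀ z ∈ ball (0 : ℂ) 1, ‖H z‖ ≤ 1) : ∃ C : ℝ, IsCarleson H C := by
  obtain ⟨C, hC, h⟩ := exists_multiplier_bound hH
  have hpi := Real.pi_pos
  refine ⟨2 * (Real.pi * C + Real.pi), fun f hf => ?_⟩
  have hm' : AEMeasurable (fun z => ‖deriv f z‖ₑ ^ 2) (volume.restrict (ball 0 1)) :=
    ((hf.1.deriv isOpen_ball).continuousOn.enorm.aemeasurable measurableSet_ball).pow_const 2
  have hpt : ∀ z ∈ ball (0 : ℂ) 1, ‖deriv H z‖ₑ ^ 2 * ‖f z‖ₑ ^ 2 ≤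
      2 * (‖deriv (fun w => H w * f w) z‖ₑ ^ 2 + ‖deriv f z‖ₑ ^ 2) := fun z hz => by
    have h1 : deriv (fun w => H w * f w) z = deriv H z * f z + H z * deriv f z :=
      deriv_fun_mul (hH.1.differentiableAt (isOpen_ball.mem_nhds hz))
        (hf.1.differentiableAt (isOpen_ball.mem_nhds hz))
    have h2 : deriv H z * f z = deriv (fun w => H w * f w) z - H z * deriv f z := by
      rw [h1]; ring
    have h3 : ‖H z * deriv f z‖ₑ ≤ ‖deriv f z‖ₑ := by
      rw [← ofReal_norm, ← ofReal_norm]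
      refine ENNReal.ofReal_le_ofReal ?_
      rw [norm_mul]
      exact mul_le_of_le_one_left (norm_nonneg _) (hb z hz)
    rw [← mul_pow, ← enorm_mul, h2]
    refine (pow_le_pow_left' enorm_sub_le 2).trans ((ENNReal_add_sq_le _ _).trans ?_)
    gcongr
  calc _ ≤ _ := setLIntegral_mono' measurableSet_ball hpt
    _ = 2 * ((∫⁻ z in ball (0 : ℂ) 1, ‖deriv (fun w => H w * f w) z‖ₑ ^ 2) +
          ∫⁻ z in ball (0 : ℂ) 1, ‖deriv f z‖ₑ ^ 2) := by
        rw [lintegral_const_mul' _ _ (by finiteness), lintegral_add_right' _ hm']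
    _ ≤ 2 * (ENNReal.ofReal Real.pi * (ENNReal.ofReal C * ENNReal.ofReal (dirNormSq f)) +
          ENNReal.ofReal Real.pi * ENNReal.ofReal (dirNormSq f)) := by
        gcongr
        · refine (lintegral_deriv_sq_le_dirNormSq (hH.2 f hf)).trans ?_
          rw [ENNReal.ofReal_mul hpi.le]
          gcongr
          exact h f hf
        · rw [← ENNReal.ofReal_mul hpi.le]
          exact lintegral_deriv_sq_le_dirNormSq hf
    _ = _ := by
        rw [ENNReal.ofReal_mul (by norm_num), ENNReal.ofReal_ofNat,
          ENNReal.ofReal_add (by positivity) hpi.le, ENNReal.ofReal_mul hpi.le]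
        ring

end

section

variable {E : Type*} [NormedAddCommGroup E] [InnerProductSpace ℂ E] {Φ : ℂ → E} {H h : ℂ → ℂ}

/-- The square-integrable majorant of the data of the corona problem with right-hand side
`H³ h`. -/
noncomputable def majorant (Φ : ℂ → E) (H h : ℂ → ℂ) (ζ : ℂ) : ℝ :=
  (‖deriv h ζ‖ + ‖deriv H ζ * h ζ‖) + (‖deriv Φ ζ‖ * ‖h ζ‖ + ‖h ζ‖)

lemma majorant_nonneg (ζ : ℂ) : 0 ≤ majorant Φ H h ζ := by
  unfold majorant
  positivity

lemma admissible_majorant (hΦ : DifferentiableOn ℂ Φ (ball 0 1))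
    (hΦ1 : ∀ z ∈ ball (0 : ℂ) 1, ‖Φ z‖ ≤ 1) (hH : DifferentiableOn ℂ H (ball 0 1))
    (hb : ∀ z ∈ ball (0 : ℂ) 1, ‖H z‖ ≤ ‖Φ z‖) (hh : DifferentiableOn ℂ h (ball 0 1))
    (hM : ∃ M, ∀ z ∈ ball (0 : ℂ) 1, ‖h z‖ ≤ M)
    (hi : IntegrableOn (majorant Φ H h) (ball 0 1)) :
    Admissible Φ (fun z => H z ^ 3 * h z) (majorant Φ H h) := by
  have hle : ∀ ζ, ‖h ζ‖ ≤ majorant Φ H h ζ ∧ ‖deriv Φ ζ‖ * ‖h ζ‖ ≤ majorant Φ H h ζ ∧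
      ‖deriv H ζ * h ζ‖ + ‖deriv h ζ‖ ≤ majorant Φ H h ζ := fun ζ => by
    have h1 := norm_nonneg (h ζ)
    have h2 := norm_nonneg (deriv H ζ * h ζ)
    have h3 := norm_nonneg (deriv h ζ)
    have h4 := mul_nonneg (norm_nonneg (deriv Φ ζ)) (norm_nonneg (h ζ))
    unfold majorant
    refine ⟨?_, ?_, ?_⟩ <;> linarith
  refine ⟨hΦ, hΦ1, (hH.pow 3).mul hh, ?_, fun ζ _ => majorant_nonneg ζ, hi, fun ζ hζ => ?_,
    fun ζ hζ => ?_, fun ζ hζ => ?_⟩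
  · obtain ⟨M, hM⟩ := hM
    refine ⟨M, fun ζ hζ => ?_⟩
    rw [norm_mul, norm_pow]
    refine (mul_le_of_le_one_left (norm_nonneg _) ?_).trans (hM ζ hζ)
    exact pow_le_one₀ (norm_nonneg _) ((hb ζ hζ).trans (hΦ1 ζ hζ))
  · rw [norm_mul, norm_pow]
    have := hb ζ hζ
    gcongr
    exact (hle ζ).1
  · rw [norm_mul, norm_pow, mul_assoc, mul_comm ‖h ζ‖]
    have := hb ζ hζ
    gcongr
    exact (hle ζ).2.1
  · have dH := (hH.differentiableAt (isOpen_ball.mem_nhds hζ)).hasDerivAt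
    have dh := (hh.differentiableAt (isOpen_ball.mem_nhds hζ)).hasDerivAt
    have e : deriv (fun z => H z ^ 3 * h z) ζ =
        3 * H ζ ^ 2 * (deriv H ζ * h ζ) + H ζ ^ 2 * (H ζ * deriv h ζ) := by
      have := ((dH.pow 3).mul dh).deriv
      change deriv (H ^ 3 * h) ζ = _
      rw [this]
      simp only [Pi.pow_apply]
      push_cast
      ring
    have h1 := hb ζ hζ
    have h2 : ‖H ζ‖ ≤ 1 := h1.trans (hΦ1 ζ hζ)
    rw [e]
    calc _ ≤ ‖3 * H ζ ^ 2 * (deriv H ζ * h ζ)‖ + ‖H ζ ^ 2 * (H ζ * deriv h ζ)‖ := norm_add_le _ _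
      _ = 3 * ‖H ζ‖ ^ 2 * ‖deriv H ζ * h ζ‖ + ‖H ζ‖ ^ 2 * (‖H ζ‖ * ‖deriv h ζ‖) := by
          rw [norm_mul, norm_mul (3 : ℂ), norm_pow, norm_mul (H ζ ^ 2), norm_pow,
            norm_mul (H ζ) (deriv h ζ)]
          norm_num
      _ ≤ 3 * ‖H ζ‖ ^ 2 * ‖deriv H ζ * h ζ‖ + 3 * ‖H ζ‖ ^ 2 * ‖deriv h ζ‖ := by
          have h3 : ‖H ζ‖ * ‖deriv h ζ‖ ≤ ‖deriv h ζ‖ := mul_le_of_le_one_left (norm_nonneg _) h2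
          have h4 : 0 ≤ ‖H ζ‖ ^ 2 * ‖deriv h ζ‖ := by positivity
          have h5 : ‖H ζ‖ ^ 2 * (‖H ζ‖ * ‖deriv h ζ‖) ≤ ‖H ζ‖ ^ 2 * ‖deriv h ζ‖ := by gcongr
          linarith
      _ = 3 * ‖H ζ‖ ^ 2 * (‖deriv H ζ * h ζ‖ + ‖deriv h ζ‖) := by ring
      _ ≤ 3 * ‖Φ ζ‖ ^ 2 * majorant Φ H h ζ := by
          gcongr
          exact (hle ζ).2.2

variable [CompleteSpace E]

lemma continuousOn_majorant (hΦ : DifferentiableOn ℂ Φ (ball 0 1))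
    (hH : DifferentiableOn ℂ H (ball 0 1)) (hh : DifferentiableOn ℂ h (ball 0 1)) :
    ContinuousOn (majorant Φ H h) (ball 0 1) := by
  have h1 := (hΦ.deriv isOpen_ball).continuousOn
  have h2 := (hH.deriv isOpen_ball).continuousOn
  have h3 := (hh.deriv isOpen_ball).continuousOn
  have h4 := hh.continuousOn
  unfold majorant
  fun_prop

lemma lintegral_majorant_sq_le (hΦ : DifferentiableOn ℂ Φ (ball 0 1))
    (hH : DifferentiableOn ℂ H (ball 0 1)) {C₁ C₂ : ℝ}
    (hC₁ : IsCarleson Φ C₁) (hC₂ : IsCarleson H C₂) (hh : MemDirichlet h) :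
    ∫⁻ ζ in ball (0 : ℂ) 1, ENNReal.ofReal (majorant Φ H h ζ) ^ 2 ≤
      4 * (2 * ENNReal.ofReal Real.pi + ENNReal.ofReal C₁ + ENNReal.ofReal C₂) *
        ENNReal.ofReal (dirNormSq h) := by
  have hpi := Real.pi_pos
  have m1 : AEMeasurable (fun z => ‖h z‖ₑ ^ 2) (volume.restrict (ball 0 1)) :=
    (hh.1.continuousOn.enorm.aemeasurable measurableSet_ball).pow_const 2
  have m2 : AEMeasurable (fun z => ‖deriv Φ z‖ₑ ^ 2) (volume.restrict (ball 0 1)) :=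
    ((hΦ.deriv isOpen_ball).continuousOn.enorm.aemeasurable measurableSet_ball).pow_const 2
  have m3 : AEMeasurable (fun z => ‖deriv H z‖ₑ ^ 2) (volume.restrict (ball 0 1)) :=
    ((hH.deriv isOpen_ball).continuousOn.enorm.aemeasurable measurableSet_ball).pow_const 2
  have m4 : AEMeasurable (fun z => ‖deriv Φ z‖ₑ ^ 2 * ‖h z‖ₑ ^ 2 + ‖h z‖ₑ ^ 2)
      (volume.restrict (ball 0 1)) := (m2.mul m1).add m1
  have m5 : AEMeasurable (fun z => ‖deriv H z‖ₑ ^ 2 * ‖h z‖ₑ ^ 2)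
      (volume.restrict (ball 0 1)) := m3.mul m1
  have hpt : ∀ ζ, ENNReal.ofReal (majorant Φ H h ζ) ^ 2 ≤
      4 * ((‖deriv h ζ‖ₑ ^ 2 + ‖deriv H ζ‖ₑ ^ 2 * ‖h ζ‖ₑ ^ 2) +
        (‖deriv Φ ζ‖ₑ ^ 2 * ‖h ζ‖ₑ ^ 2 + ‖h ζ‖ₑ ^ 2)) := fun ζ => by
    rw [majorant, ENNReal.ofReal_add (by positivity) (by positivity),
      ENNReal.ofReal_add (by positivity) (by positivity),
      ENNReal.ofReal_add (by positivity) (by positivity),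
      ENNReal.ofReal_mul (by positivity), ofReal_norm, ofReal_norm, ofReal_norm, ofReal_norm,
      enorm_mul]
    refine (ENNReal_add_sq_le _ _).trans ?_
    refine (mul_le_mul_right (add_le_add (ENNReal_add_sq_le _ _) (ENNReal_add_sq_le _ _)) _).trans
      (le_of_eq ?_)
    ring
  calc _ ≤ _ := lintegral_mono hpt
    _ = 4 * ((∫⁻ ζ in ball (0 : ℂ) 1, ‖deriv h ζ‖ₑ ^ 2) +
          (∫⁻ ζ in ball (0 : ℂ) 1, ‖deriv H ζ‖ₑ ^ 2 * ‖h ζ‖ₑ ^ 2) +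
          ((∫⁻ ζ in ball (0 : ℂ) 1, ‖deriv Φ ζ‖ₑ ^ 2 * ‖h ζ‖ₑ ^ 2) +
          ∫⁻ ζ in ball (0 : ℂ) 1, ‖h ζ‖ₑ ^ 2)) := by
        rw [lintegral_const_mul' _ _ (by finiteness), lintegral_add_right' _ m4,
          lintegral_add_right' _ m5, lintegral_add_right' _ m1]
    _ ≤ 4 * (ENNReal.ofReal Real.pi * ENNReal.ofReal (dirNormSq h) +
          ENNReal.ofReal C₂ * ENNReal.ofReal (dirNormSq h) +
          (ENNReal.ofReal C₁ * ENNReal.ofReal (dirNormSq h) +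
          ENNReal.ofReal Real.pi * ENNReal.ofReal (dirNormSq h))) := by
        gcongr
        · rw [← ENNReal.ofReal_mul hpi.le]
          exact lintegral_deriv_sq_le_dirNormSq hh
        · exact hC₂ h hh
        · exact hC₁ h hh
        · rw [← ENNReal.ofReal_mul hpi.le]
          exact lintegral_sq_le_dirNormSq hh
    _ = _ := by ring

lemma integrableOn_of_lintegral_sq_ne_top {l : ℂ → ℝ} (hl : ContinuousOn l (ball 0 1))
    (h0 : ∀ ζ, 0 ≤ l ζ) (h2 : ∫⁻ ζ in ball (0 : ℂ) 1, ENNReal.ofReal (l ζ) ^ 2 ≠ ∞) :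
    IntegrableOn l (ball 0 1) ∧ ENNReal.ofReal (∫ ζ in ball (0 : ℂ) 1, l ζ) ^ 2 ≤
      volume (ball (0 : ℂ) 1) * ∫⁻ ζ in ball (0 : ℂ) 1, ENNReal.ofReal (l ζ) ^ 2 := by
  have hlm := hl.aemeasurable measurableSet_ball (μ := volume)
  have hcs := lintegral_mul_sq_le (μ := volume.restrict (ball (0 : ℂ) 1))
    (f := fun _ => 1) aemeasurable_const hlm.ennreal_ofReal
  simp only [one_mul, one_pow, lintegral_const, Measure.restrict_apply_univ] at hcs
  have hi : IntegrableOn l (ball 0 1) := by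
    refine ⟨hl.aestronglyMeasurable measurableSet_ball, ?_⟩
    simp only [HasFiniteIntegral, Real.enorm_of_nonneg (h0 _)]
    by_contra! htop
    rw [top_le_iff.1 htop] at hcs
    exact ENNReal.mul_ne_top measure_ball_lt_top.ne h2 
      (top_le_iff.1 ((by simp : (∞ : ℝ≥0∞) ≤ ∞ ^ 2).trans hcs))
  refine ⟨hi, ?_⟩
  rwa [ofReal_integral_eq_lintegral_ofReal hi (.of_forall h0)]

/-- Approximate solutions of `⟨U, Φ⟩ = H³ h` with uniform Dirichlet bounds. -/
lemma exists_approximate_solution (hΦ : DifferentiableOn ℂ Φ (ball 0 1))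
    (hΦ1 : ∀ z ∈ ball (0 : ℂ) 1, ‖Φ z‖ ≤ 1) (hH : DifferentiableOn ℂ H (ball 0 1))
    (hb : ∀ z ∈ ball (0 : ℂ) 1, ‖H z‖ ≤ ‖Φ z‖) {C₁ C₂ : ℝ}
    (hC₁ : IsCarleson Φ C₁) (hC₂ : IsCarleson H C₂) :
    ∃ C : ℝ, 0 ≤ C ∧ ∀ h, MemDirichlet h → (∃ M, ∀ z ∈ ball (0 : ℂ) 1, ‖h z‖ ≤ M) →
      ∀ ε : ℝ, 0 < ε → ∃ U : ℂ → E →L[ℂ] ℂ, DifferentiableOn ℂ U (ball 0 1) ∧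
        ‖U 0‖ₑ ^ 2 + ∫⁻ z in ball (0 : ℂ) 1, ‖deriv U z‖ₑ ^ 2 ≤
          ENNReal.ofReal (C * dirNormSq h) ∧
        ∀ z ∈ ball (0 : ℂ) 1, ‖U z (Φ z) - H z ^ 3 * h z‖ ≤
          ε * (C * ((1 - ‖z‖)⁻¹ ^ 3 * (1 + dirNormSq h))) := by
  obtain ⟨C₀, hC₀, hsol⟩ := hC₁.exists_sol_bound hΦ
  have hpi := Real.pi_pos
  set K : ℝ := 4 * (2 * Real.pi + max C₁ 0 + max C₂ 0) with hK
  have hK0 : 0 ≤ K := by positivity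
  have hKe : 4 * (2 * ENNReal.ofReal Real.pi + ENNReal.ofReal C₁ + ENNReal.ofReal C₂) =
      ENNReal.ofReal K := by
    rw [hK, ENNReal.ofReal_mul (by norm_num), ENNReal.ofReal_add (by positivity) (by positivity),
      ENNReal.ofReal_add (by positivity) (by positivity), ENNReal.ofReal_mul (by norm_num)]
    simp
  set v : ℝ := (volume (ball (0 : ℂ) 1)).toReal with hv
  have hve : volume (ball (0 : ℂ) 1) = ENNReal.ofReal v :=
    (ENNReal.ofReal_toReal measure_ball_lt_top.ne).symm
  have hv0 : 0 ≤ v := ENNReal.toReal_nonneg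
  have hd0 := inv_nonneg.2 diskMass_pos.le
  refine ⟨C₀ * K + diskMass⁻¹ * 4 * (1 + v * K), by positivity, fun h hh hM ε hε => ?_⟩
  have hD := dirNormSq_nonneg h
  have hl2 := lintegral_majorant_sq_le hΦ hH hC₁ hC₂ hh
  rw [hKe, ← ENNReal.ofReal_mul hK0] at hl2
  have hlt := ne_top_of_le_ne_top ENNReal.ofReal_ne_top hl2
  obtain ⟨hi, hi2⟩ := integrableOn_of_lintegral_sq_ne_top (continuousOn_majorant hΦ hH hh.1)
    majorant_nonneg hlt
  have hadm := admissible_majorant hΦ hΦ1 hH hb hh.1 hM hi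
  have hint0 : 0 ≤ ∫ ζ in ball (0 : ℂ) 1, majorant Φ H h ζ :=
    setIntegral_nonneg measurableSet_ball fun ζ _ => majorant_nonneg ζ
  set L := ∫ ζ in ball (0 : ℂ) 1, majorant Φ H h ζ
  have hL : L ^ 2 ≤ v * (K * dirNormSq h) := by
    have := hi2.trans (mul_le_mul_right hl2 _)
    rwa [hve, ← ENNReal.ofReal_mul hv0, ← ENNReal.ofReal_pow hint0,
      ENNReal.ofReal_le_ofReal_iff (by positivity)] at this
  have hL1 : L ≤ (1 + v * K) * (1 + dirNormSq h) := by
    have : 0 ≤ v * K := by positivity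
    nlinarith [sq_nonneg (L - 1)]
  refine ⟨sol Φ (fun z => H z ^ 3 * h z) ε, hadm.differentiableOn_sol hε, ?_, fun z hz => ?_⟩
  · refine (hsol _ _ ε hadm hε hlt).trans ?_
    calc _ ≤ ENNReal.ofReal C₀ * ENNReal.ofReal (K * dirNormSq h) := by gcongr
      _ = ENNReal.ofReal (C₀ * K * dirNormSq h) := by
          rw [← ENNReal.ofReal_mul hC₀, ← mul_assoc]
      _ ≤ _ := by
          gcongr
          have : 0 ≤ diskMass⁻¹ * 4 * (1 + v * K) := by positivity
          linarith
  · refine (hadm.norm_sol_apply_sub_le hε hz).trans ?_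
    have hz1 : 0 < 1 - ‖z‖ := by linarith [mem_ball_zero_iff.1 hz]
    calc _ ≤ diskMass⁻¹ * (4 * ε * (1 - ‖z‖)⁻¹ ^ 3 * ((1 + v * K) * (1 + dirNormSq h))) := by
          gcongr
      _ = ε * ((diskMass⁻¹ * 4 * (1 + v * K)) * ((1 - ‖z‖)⁻¹ ^ 3 * (1 + dirNormSq h))) := by ring
      _ ≤ _ := by
          gcongr
          have : 0 ≤ C₀ * K := by positivity
          linarith

end

lemma exists_functional {x : ℕ × ℕ → ℂ} (hx : ∑' p, ‖x p‖ₑ ^ 2 ≠ ∞) :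
    ∃ φ : Ell2 (ℕ × ℕ) →L[ℂ] ℂ, (∀ p, φ (Ell2.basis p) = x p) ∧ ‖φ‖ₑ ^ 2 = ∑' p, ‖x p‖ₑ ^ 2 := by
  have hc : ∑' p, ‖conj (x p)‖ₑ ^ 2 = ∑' p, ‖x p‖ₑ ^ 2 := by
    simp only [enorm_sq_eq_ofReal, RCLike.norm_conj]
  set v : Ell2 (ℕ × ℕ) := ⟨fun p => conj (x p), memEll2_of_tsum_ne_top (hc ▸ hx)⟩ with hv
  refine ⟨InnerProductSpace.toDual ℂ (Ell2 (ℕ × ℕ)) v, fun p => ?_, ?_⟩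
  · rw [InnerProductSpace.toDual_apply_apply, Ell2.basis, lp.inner_single_right]
    simp [hv]
  · rw [← ofReal_norm, LinearIsometryEquiv.norm_map, ofReal_norm, Ell2.enorm_sq, ← hc]

lemma exists_evalVec (v : Ell2 ℕ) {z : ℂ} (hz : z ∈ ball (0 : ℂ) 1) :
    ∃ y : Ell2 (ℕ × ℕ), ∀ p : ℕ × ℕ,
      y p = v p.1 * (((√((p.2 : ℝ) + 1) : ℝ) : ℂ)⁻¹ * z ^ p.2) := by
  have h1 : ∀ m : ℕ, ‖((√((m : ℝ) + 1) : ℝ) : ℂ)⁻¹ * z ^ m‖ₑ ^ 2 =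
      ENNReal.ofReal ((‖z‖ ^ 2) ^ m / ((m : ℝ) + 1)) := fun m => by
    rw [enorm_sq_eq_ofReal, norm_mul, norm_inv, norm_real,
      Real.norm_of_nonneg (Real.sqrt_nonneg _), mul_pow, inv_pow, Real.sq_sqrt (by positivity),
      norm_pow]
    congr 1
    ring
  have h2 : ∑' p : ℕ × ℕ, ‖v p.1 * (((√((p.2 : ℝ) + 1) : ℝ) : ℂ)⁻¹ * z ^ p.2)‖ₑ ^ 2 ≠ ∞ := by
    simp only [ENNReal.tsum_prod', enorm_mul (v _), mul_pow (‖v _‖ₑ), h1, ENNReal.tsum_mul_left,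
      ENNReal.tsum_mul_right]
    exact ENNReal.mul_ne_top (Ell2.enorm_sq_ne_top v) (summable_dirKernel hz).tsum_ofReal_ne_top
  exact ⟨⟨_, memEll2_of_tsum_ne_top h2⟩, fun p => rfl⟩

/-- The evaluation vector of the vector-valued Dirichlet space at `z` in the direction `v`. -/
noncomputable def evalVec (v : Ell2 ℕ) {z : ℂ} (hz : z ∈ ball (0 : ℂ) 1) : Ell2 (ℕ × ℕ) :=
  (exists_evalVec v hz).choose

lemma evalVec_apply (v : Ell2 ℕ) {z : ℂ} (hz : z ∈ ball (0 : ℂ) 1) (p : ℕ × ℕ) :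
    evalVec v hz p = v p.1 * (((√((p.2 : ℝ) + 1) : ℝ) : ℂ)⁻¹ * z ^ p.2) :=
  (exists_evalVec v hz).choose_spec p

lemma tsum_fiber_ne_top (φ : Ell2 (ℕ × ℕ) →L[ℂ] ℂ) (k : ℕ) :
    ∑' m, ‖φ (Ell2.basis (k, m))‖ₑ ^ 2 ≠ ∞ := by
  refine ne_top_of_le_ne_top (b := ‖φ‖ₑ ^ 2) (by finiteness) (le_trans ?_
    (Ell2.tsum_apply_basis_le φ))
  rw [ENNReal.tsum_prod']
  exact ENNReal.le_tsum (f := fun k => ∑' m, ‖φ (Ell2.basis (k, m))‖ₑ ^ 2) k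

lemma hasSum_evalVec (φ : Ell2 (ℕ × ℕ) →L[ℂ] ℂ) (v : Ell2 ℕ) {z : ℂ} (hz : z ∈ ball (0 : ℂ) 1) :
    HasSum (fun k => v k * dirFun (fun m => φ (Ell2.basis (k, m))) z) (φ (evalVec v hz)) := by
  refine (Ell2.hasSum_apply φ (evalVec v hz)).prod_fiberwise fun k => ?_
  have := ((dirFun_spec (tsum_fiber_ne_top φ k)).2.2 z hz).mul_left (v k)
  convert! this using 2 with m
  rw [evalVec_apply]
  ring

/-- An analytic map into the dual of `ℓ²` with finite Dirichlet norm is represented by a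
functional on `ℓ²(ℕ × ℕ)`. -/
lemma exists_functional_of_differentiableOn {U : ℂ → Ell2 ℕ →L[ℂ] ℂ}
    (hU : DifferentiableOn ℂ U (ball 0 1)) {R : ℝ}
    (hR : ‖U 0‖ₑ ^ 2 + ∫⁻ z in ball (0 : ℂ) 1, ‖deriv U z‖ₑ ^ 2 ≤ ENNReal.ofReal R) :
    ∃ φ : Ell2 (ℕ × ℕ) →L[ℂ] ℂ, ‖φ‖ₑ ^ 2 ≤ ENNReal.ofReal R ∧
      ∀ v, ∀ z, ∀ hz : z ∈ ball (0 : ℂ) 1, φ (evalVec v hz) = U z v := by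
  set u : ℕ → ℂ → ℂ := fun k z => U z (Ell2.basis k) with hu
  have hd : ∀ k, ∀ z ∈ ball (0 : ℂ) 1, HasDerivAt (u k) (deriv U z (Ell2.basis k)) z :=
    fun k z hz => by
      have h := (hU.differentiableAt (isOpen_ball.mem_nhds hz)).hasDerivAt
      simpa using h.clm_apply (hasDerivAt_const z (Ell2.basis k))
  have hud : ∀ k, DifferentiableOn ℂ (u k) (ball 0 1) := fun k z hz =>
    (hd k z hz).differentiableAt.differentiableWithinAt
  set x : ℕ × ℕ → ℂ := fun p => ((√((p.2 : ℝ) + 1) : ℝ) : ℂ) * dirCoeff (u p.1) p.2 with hx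
  have hm : ∀ k, AEMeasurable (fun z => ‖deriv (u k) z‖ₑ ^ 2) (volume.restrict (ball 0 1)) :=
    fun k => (((hud k).deriv isOpen_ball).continuousOn.enorm.aemeasurable
      measurableSet_ball).pow_const 2
  have hxR : ∑' p, ‖x p‖ₑ ^ 2 ≤ ENNReal.ofReal R := by
    refine le_trans ?_ hR
    rw [ENNReal.tsum_prod']
    calc _ ≤ ∑' k, (‖u k 0‖ₑ ^ 2 + ∫⁻ z in ball (0 : ℂ) 1, ‖deriv (u k) z‖ₑ ^ 2) := by
          refine ENNReal.tsum_le_tsum fun k => ?_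
          simp only [hx, ofReal_dirWeight_mul]
          exact tsum_ofReal_dirCoeff_le (hud k)
      _ = ∑' k, ‖U 0 (Ell2.basis k)‖ₑ ^ 2 +
            ∫⁻ z in ball (0 : ℂ) 1, ∑' k, ‖deriv (u k) z‖ₑ ^ 2 := by
          rw [ENNReal.tsum_add, lintegral_tsum hm]
      _ ≤ _ := by
          refine add_le_add (Ell2.tsum_apply_basis_le _)
            (setLIntegral_mono' measurableSet_ball fun z hz => ?_)
          simp only [fun k => (hd k z hz).deriv]
          exact Ell2.tsum_apply_basis_le _
  obtain ⟨φ, hφ, hφn⟩ := exists_functional (ne_top_of_le_ne_top ENNReal.ofReal_ne_top hxR)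
  refine ⟨φ, hφn.trans_le hxR, fun v z hz => ?_⟩
  refine (hasSum_evalVec φ v hz).unique ?_
  convert! Ell2.hasSum_apply (U z) v using 3 with k
  have h1 := (dirFun_spec (tsum_fiber_ne_top φ k)).2.2 z hz
  refine h1.unique ?_
  convert! hasSum_dirCoeff (hud k) hz using 2 with m
  rw [hφ, hx, inv_mul_cancel_left₀ (sqrt_succ_ne_zero m)]

section

open Filter

/-- The Taylor polynomials of `h` at the origin. -/
noncomputable def taylorSum (h : ℂ → ℂ) (n : ℕ) (z : ℂ) : ℂ :=
  ∑ m ∈ Finset.range n, dirCoeff h m * z ^ m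

lemma dirCoeff_taylorSum (h : ℂ → ℂ) (n : ℕ) :
    dirCoeff (taylorSum h n) = fun m => if m < n then dirCoeff h m else 0 := by
  refine dirCoeff_eq_of_hasSum (by unfold taylorSum; fun_prop) fun z _ => ?_
  have : taylorSum h n z = ∑ m ∈ Finset.range n, (if m < n then dirCoeff h m else 0) * z ^ m :=
    Finset.sum_congr rfl fun m hm => by rw [if_pos (Finset.mem_range.1 hm)]
  rw [this]
  refine hasSum_sum_of_ne_finset_zero fun m hm => ?_
  rw [if_neg (by simpa using hm), zero_mul]

lemma memDirichlet_taylorSum {h : ℂ → ℂ} (hh : MemDirichlet h) (n : ℕ) :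
    MemDirichlet (taylorSum h n) ∧ dirNormSq (taylorSum h n) ≤ dirNormSq h := by
  have hle : ∀ m : ℕ, ((m : ℝ) + 1) * ‖dirCoeff (taylorSum h n) m‖ ^ 2 ≤
      ((m : ℝ) + 1) * ‖dirCoeff h m‖ ^ 2 := fun m => by
    simp only [dirCoeff_taylorSum]
    split_ifs
    · exact le_rfl
    · rw [norm_zero, zero_pow two_ne_zero, mul_zero]
      positivity
  have hs := hh.2.of_nonneg_of_le (fun m => by positivity) hle
  exact ⟨⟨by unfold taylorSum; fun_prop, hs⟩, hs.tsum_le_tsum hle hh.2⟩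

lemma norm_taylorSum_le (h : ℂ → ℂ) (n : ℕ) :
    ∃ M, ∀ z ∈ ball (0 : ℂ) 1, ‖taylorSum h n z‖ ≤ M := by
  refine ⟨∑ m ∈ Finset.range n, ‖dirCoeff h m‖, fun z hz => (norm_sum_le _ _).trans ?_⟩
  refine Finset.sum_le_sum fun m _ => ?_
  rw [norm_mul, norm_pow]
  exact mul_le_of_le_one_right (norm_nonneg _)
    (pow_le_one₀ (norm_nonneg _) (mem_ball_zero_iff.1 hz).le)

/-- Bounded sequences in the dual converge weak-* along an ultrafilter. -/
lemma exists_weak_limit {V : Type*} [NormedAddCommGroup V] [NormedSpace ℂ V]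
    {φ : ℕ → V →L[ℂ] ℂ} {R : ℝ} (hR : ∀ n, ‖φ n‖ ≤ R) :
    ∃ ψ : V →L[ℂ] ℂ, ‖ψ‖ ≤ R ∧
      ∀ y, Tendsto (fun n => φ n y) (hyperfilter ℕ : Filter ℕ) (𝓝 (ψ y)) := by
  have hK := WeakDual.isCompact_closedBall (𝕜 := ℂ) (0 : StrongDual ℂ V) R
  have hmem : ∀ n, StrongDual.toWeakDual (φ n) ∈
      WeakDual.toStrongDual ⁻¹' closedBall (0 : StrongDual ℂ V) R := fun n => by
    simpa using hR n
  obtain ⟨ψ, hψ, hlim⟩ := hK.ultrafilter_le_nhds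
    ((hyperfilter ℕ).map fun n => StrongDual.toWeakDual (φ n))
    (le_principal_iff.2 (Ultrafilter.mem_map.2 (univ_mem' hmem)))
  refine ⟨WeakDual.toStrongDual ψ, by simpa using hψ, fun y => ?_⟩
  exact ((WeakDual.eval_continuous (𝕜 := ℂ) y).tendsto ψ).comp hlim

lemma exists_exact_functional {Φ : ℂ → Ell2 ℕ} {H : ℂ → ℂ} (hΦ : DifferentiableOn ℂ Φ (ball 0 1))
    (hΦ1 : ∀ z ∈ ball (0 : ℂ) 1, ‖Φ z‖ ≤ 1) (hH : DifferentiableOn ℂ H (ball 0 1))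
    (hb : ∀ z ∈ ball (0 : ℂ) 1, ‖H z‖ ≤ ‖Φ z‖) {C₁ C₂ : ℝ}
    (hC₁ : IsCarleson Φ C₁) (hC₂ : IsCarleson H C₂) :
    ∃ C : ℝ, 0 ≤ C ∧ ∀ h, MemDirichlet h → ∃ ψ : Ell2 (ℕ × ℕ) →L[ℂ] ℂ,
      ‖ψ‖ ^ 2 ≤ C * dirNormSq h ∧
      ∀ z, ∀ hz : z ∈ ball (0 : ℂ) 1, ψ (evalVec (Φ z) hz) = H z ^ 3 * h z := by
  obtain ⟨C, hC, hsol⟩ := exists_approximate_solution hΦ hΦ1 hH hb hC₁ hC₂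
  refine ⟨C, hC, fun h hh => ?_⟩
  have hD := dirNormSq_nonneg h
  have key : ∀ n : ℕ, ∃ φ : Ell2 (ℕ × ℕ) →L[ℂ] ℂ, ‖φ‖ ≤ √(C * dirNormSq h) ∧
      ∀ z, ∀ hz : z ∈ ball (0 : ℂ) 1, ‖φ (evalVec (Φ z) hz) - H z ^ 3 * taylorSum h n z‖ ≤
        1 / ((n : ℝ) + 1) * (C * ((1 - ‖z‖)⁻¹ ^ 3 * (1 + dirNormSq h))) := fun n => by
    obtain ⟨hn, hle⟩ := memDirichlet_taylorSum hh n
    obtain ⟨U, hU, hUR, hUz⟩ := hsol _ hn (norm_taylorSum_le h n) (1 / ((n : ℝ) + 1))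
      (by positivity)
    obtain ⟨φ, hφ, hφz⟩ := exists_functional_of_differentiableOn hU hUR
    have hnn := dirNormSq_nonneg (taylorSum h n)
    refine ⟨φ, Real.le_sqrt_of_sq_le ?_, fun z hz => ?_⟩
    · rw [← ofReal_norm, ← ENNReal.ofReal_pow (norm_nonneg _),
        ENNReal.ofReal_le_ofReal_iff (by positivity)] at hφ
      exact hφ.trans (by gcongr)
    · rw [hφz]
      refine (hUz z hz).trans ?_
      have : 0 < 1 - ‖z‖ := by linarith [mem_ball_zero_iff.1 hz]
      gcongr
  choose φ hφ hφz using key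
  obtain ⟨ψ, hψ, hlim⟩ := exists_weak_limit hφ
  refine ⟨ψ, ?_, fun z hz => ?_⟩
  · calc _ ≤ √(C * dirNormSq h) ^ 2 := by gcongr
      _ = _ := Real.sq_sqrt (by positivity)
  · have h1 : Tendsto (fun n => H z ^ 3 * taylorSum h n z) atTop (𝓝 (H z ^ 3 * h z)) :=
      ((hasSum_dirCoeff hh.1 hz).tendsto_sum_nat).const_mul _
    have h2 : Tendsto (fun n => φ n (evalVec (Φ z) hz) - H z ^ 3 * taylorSum h n z) atTop
        (𝓝 0) := by
      refine squeeze_zero_norm (fun n => hφz n z hz) ?_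
      have := (tendsto_one_div_add_atTop_nhds_zero_nat (𝕜 := ℝ)).mul_const
        (C * ((1 - ‖z‖)⁻¹ ^ 3 * (1 + dirNormSq h)))
      rwa [zero_mul] at this
    have h3 : Tendsto (fun n => φ n (evalVec (Φ z) hz)) atTop (𝓝 (H z ^ 3 * h z)) := by
      simpa using h2.add h1
    refine tendsto_nhds_unique (hlim _) (h3.mono_left ?_)
    rw [← Nat.cofinite_eq_atTop]
    exact hyperfilter_le_cofinite

end

lemma dirNormSq_components (ψ : Ell2 (ℕ × ℕ) →L[ℂ] ℂ) :
    (Summable fun k => dirNormSq (dirFun fun m => ψ (Ell2.basis (k, m)))) ∧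
      ∑' k, dirNormSq (dirFun fun m => ψ (Ell2.basis (k, m))) ≤ ‖ψ‖ ^ 2 := by
  have h : ∑' k, ENNReal.ofReal (dirNormSq (dirFun fun m => ψ (Ell2.basis (k, m)))) ≤
      ‖ψ‖ₑ ^ 2 := by
    refine le_trans (le_of_eq ?_) (Ell2.tsum_apply_basis_le ψ)
    rw [ENNReal.tsum_prod']
    exact tsum_congr fun k => ofReal_dirNormSq_dirFun (tsum_fiber_ne_top ψ k)
  have hs : Summable fun k => dirNormSq (dirFun fun m => ψ (Ell2.basis (k, m))) :=
    (ENNReal.summable_toReal (ne_top_of_le_ne_top (by finiteness) h)).congr fun k =>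
      ENNReal.toReal_ofReal (dirNormSq_nonneg _)
  refine ⟨hs, ?_⟩
  rwa [← ENNReal.ofReal_tsum_of_nonneg (fun k => dirNormSq_nonneg _) hs, ← ofReal_norm,
    ← ENNReal.ofReal_pow (norm_nonneg _), ENNReal.ofReal_le_ofReal_iff (by positivity)] at h

lemma norm_le_norm_column {Φ : ℂ → Ell2 ℕ} {H : ℂ → ℂ} {F : ℕ → ℂ → ℂ} {z : ℂ}
    (he : ∀ j, Φ z j = F j z) (hb : ‖H z‖ ^ 2 ≤ ∑' j : ℕ, ‖F j z‖ ^ 2) : ‖H z‖ ≤ ‖Φ z‖ := by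
  have h1 := lp.norm_rpow_eq_tsum (p := 2) (by norm_num) (Φ z)
  simp only [ENNReal.toReal_ofNat, Real.rpow_ofNat, he] at h1
  exact (sq_le_sq₀ (norm_nonneg _) (norm_nonneg _)).1 (h1 ▸ hb)

end WolffDirichlet

/-- The key estimate: under the hypotheses of Wolff's theorem for the
Dirichlet multipliers, the equation `F u = H³ h` can be solved with
uniform control of the norm. -/
theorem wolff_dirichlet_solution_estimate
    (H : ℂ → ℂ) (F : ℕ → ℂ → ℂ)
    (hH : IsMultiplier H) (hF : ∀ j, IsMultiplier (F j))
    (ha : ColNormLE F 1)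
    (hb : ∀ z ∈ ball (0:ℂ) 1, ‖H z‖ ^ 2 ≤ ∑' j : ℕ, ‖F j z‖ ^ 2) :
    ∃ K : ℝ, ∀ h : ℂ → ℂ, MemDirichlet h →
      ∃ u : ℕ → ℂ → ℂ, (∀ j, MemDirichlet (u j)) ∧
        (Summable fun j : ℕ => dirNormSq (u j)) ∧
        (∀ z ∈ ball (0:ℂ) 1,
          (Summable fun j : ℕ => F j z * u j z) ∧
          (∑' j : ℕ, F j z * u j z) = (H z) ^ 3 * h z) ∧
        (∑' j : ℕ, dirNormSq (u j)) ≤ K ^ 2 * dirNormSq h := by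
  open WolffDirichlet in
  obtain ⟨Φ, hΦ, he⟩ := exists_column hF ha
  have hΦ1 : ∀ z ∈ ball (0 : ℂ) 1, ‖Φ z‖ ≤ 1 := fun z hz => norm_column_le hF ha he hz
  have hHΦ : ∀ z ∈ ball (0 : ℂ) 1, ‖H z‖ ≤ ‖Φ z‖ := fun z hz =>
    norm_le_norm_column (he z hz) (hb z hz)
  obtain ⟨C₂, hC₂⟩ := exists_multiplier_carleson hH fun z hz => (hHΦ z hz).trans (hΦ1 z hz)
  obtain ⟨C, hC, hsol⟩ := exists_exact_functional hΦ hΦ1 hH.1 hHΦ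
    (isCarleson_column hF ha hΦ he) hC₂
  refine ⟨√C, fun h hh => ?_⟩
  obtain ⟨ψ, hψ, hψz⟩ := hsol h hh
  obtain ⟨hs, hle⟩ := dirNormSq_components ψ
  refine ⟨fun k => dirFun fun m => ψ (Ell2.basis (k, m)),
    fun k => (dirFun_spec (tsum_fiber_ne_top ψ k)).1, hs, fun z hz => ?_, ?_⟩
  · have hz' := hasSum_evalVec ψ (Φ z) hz
    simp only [he z hz, hψz z hz] at hz'
    exact ⟨hz'.summable, hz'.tsum_eq⟩
  · rw [Real.sq_sqrt hC]
    exact hle.trans hψ
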